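/- Let K be an algebraically closed field of characteristic zero whose transcendence degree over ℚ is at least 1 (e.g. K = ℂ), and let A = A(α,β,0) be a down-up algebra with β ≠ 0 and α + β = 1, so that the roots of t² − αt − β are λ = 1 and μ = −β. If either (i) λ = μ = 1 (i.e. α = 2, β = −1), or (ii) μ ≠ 1 and μ is not a root of unity, then sr(A) = 3. -/

import Mathlib

noncomputable section

/-- Defining relations of the down-up algebra `A(α,β,γ)`:
`D = ι 0`, `U = ι 1`, relations `DU² = αUDU + βU²D + γU` and `D²U = αDUD + βUD² + γD`. -/
inductive DownUpRel (K : Type) [Field K] (a b g : K) :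
    FreeAlgebra K (Fin 2) → FreeAlgebra K (Fin 2) → Prop
  | rel1 : DownUpRel K a b g
      (FreeAlgebra.ι K (0 : Fin 2) * FreeAlgebra.ι K (1 : Fin 2) * FreeAlgebra.ι K (1 : Fin 2))
      (a • (FreeAlgebra.ι K (1 : Fin 2) * FreeAlgebra.ι K (0 : Fin 2) * FreeAlgebra.ι K (1 : Fin 2)) +
       b • (FreeAlgebra.ι K (1 : Fin 2) * FreeAlgebra.ι K (1 : Fin 2) * FreeAlgebra.ι K (0 : Fin 2)) +
       g • FreeAlgebra.ι K (1 : Fin 2))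
  | rel2 : DownUpRel K a b g
      (FreeAlgebra.ι K (0 : Fin 2) * FreeAlgebra.ι K (0 : Fin 2) * FreeAlgebra.ι K (1 : Fin 2))
      (a • (FreeAlgebra.ι K (0 : Fin 2) * FreeAlgebra.ι K (1 : Fin 2) * FreeAlgebra.ι K (0 : Fin 2)) +
       b • (FreeAlgebra.ι K (1 : Fin 2) * FreeAlgebra.ι K (0 : Fin 2) * FreeAlgebra.ι K (0 : Fin 2)) +
       g • FreeAlgebra.ι K (0 : Fin 2))

/-- The down-up algebra `A(α,β,γ)`. -/
abbrev DownUp (K : Type) [Field K] (a b g : K) := RingQuot (DownUpRel K a b g)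

/-- The generator `D` of `A(α,β,γ)`. -/
def DownUp.D (K : Type) [Field K] (a b g : K) : DownUp K a b g :=
  RingQuot.mkAlgHom K (DownUpRel K a b g) (FreeAlgebra.ι K (0 : Fin 2))

/-- The generator `U` of `A(α,β,γ)`. -/
def DownUp.U (K : Type) [Field K] (a b g : K) : DownUp K a b g :=
  RingQuot.mkAlgHom K (DownUpRel K a b g) (FreeAlgebra.ι K (1 : Fin 2))

/-- A row `(u₁,…,u_s)` over `R` is unimodular if `u₁R + ⋯ + u_sR = R`. -/
def IsUnimodularRow {R : Type} [Ring R] {s : ℕ} (u : Fin s → R) : Prop :=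
  Submodule.span Rᵐᵒᵖ (Set.range u) = ⊤

/-- A unimodular row `(u₁,…,u_{s+1})` is stable if there exist `r₁,…,r_s` such that
`(u₁ + u_{s+1}r₁, …, u_s + u_{s+1}r_s)` is unimodular. -/
def IsStableRow {R : Type} [Ring R] {s : ℕ} (u : Fin (s + 1) → R) : Prop :=
  ∃ r : Fin s → R,
    IsUnimodularRow (fun i : Fin s => u i.castSucc + u (Fin.last s) * r i)

/-- The stable rank of `R`: the least `t` such that every unimodular row of
length `t + 1` over `R` is stable. -/
noncomputable def stableRank (R : Type) [Ring R] : ℕ :=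
  sInf {t : ℕ | ∀ u : Fin (t + 1) → R, IsUnimodularRow u → IsStableRow u}

section

open Polynomial

theorem exists_deriv_ne_zero (K : Type) [Field K] [CharZero K] (p : K) (hp : Transcendental ℚ p) :
    ∃ δ : K → K, (∀ a b, δ (a + b) = δ a + δ b) ∧ (∀ a b, δ (a * b) = a * δ b + b * δ a) ∧
      δ p = 1 := by
  classical
  let F := FractionRing ℚ[X]
  let e : ℚ[X] →+* (TrivSqZeroExt K K) := (aeval (TrivSqZeroExt.inl p + TrivSqZeroExt.inr 1 : (TrivSqZeroExt K K))).toRingHom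
  have hfst : ∀ f : ℚ[X], (e f).fst = aeval p f := by
    intro f
    have := aeval_algHom_apply (TrivSqZeroExt.fstHom ℚ K K) (TrivSqZeroExt.inl p + TrivSqZeroExt.inr 1 : (TrivSqZeroExt K K)) f
    have h2 : (TrivSqZeroExt.fstHom ℚ K K) (TrivSqZeroExt.inl p + TrivSqZeroExt.inr 1) = p := by
      change (TrivSqZeroExt.inl p + TrivSqZeroExt.inr 1 : TrivSqZeroExt K K).fst = p
      simp
    rw [h2] at this
    rw [this]; rfl
  have hu : ∀ y : nonZeroDivisors ℚ[X], IsUnit (e y) := by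
    intro y
    rw [TrivSqZeroExt.isUnit_iff_isUnit_fst, hfst]
    have : (y:ℚ[X]) ≠ 0 := nonZeroDivisors.coe_ne_zero y
    exact isUnit_iff_ne_zero.2 (fun h => this ((transcendental_iff.1 hp) _ h))
  let eF : F →+* (TrivSqZeroExt K K) := IsLocalization.lift hu
  let _ : Algebra F (TrivSqZeroExt K K) := eF.toAlgebra
  let _ : Algebra F K := ((TrivSqZeroExt.fstHom ℚ K K).toRingHom.comp eF).toAlgebra
  have hsm : Algebra.FormallySmooth F K := by
    obtain ⟨s, hs⟩ := exists_isTranscendenceBasis F K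
    have : Algebra.IsAlgebraic (IntermediateField.adjoin F (Set.range ((↑) : s → K))) K := hs.isAlgebraic_field
    exact .of_algebraicIndependent_of_isSeparable hs.1
  let g : (TrivSqZeroExt K K) →ₐ[F] K := { (TrivSqZeroExt.fstHom ℚ K K).toRingHom with
    commutes' := fun r => rfl }
  have hg : Function.Surjective g := TrivSqZeroExt.fst_surjective
  have hg' : IsNilpotent (RingHom.ker (g : (TrivSqZeroExt K K) →+* K)) := by
    refine ⟨2, ?_⟩
    refine (pow_two (RingHom.ker (g : TrivSqZeroExt K K →+* K))).trans ?_
    rw [Ideal.zero_eq_bot, eq_bot_iff, Ideal.mul_le]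
    intro x hx y hy
    have hx : x.fst = 0 := hx
    have hy : y.fst = 0 := hy
    simp only [Ideal.mem_bot]
    ext <;> simp [hx, hy]
  let L := Algebra.FormallySmooth.liftOfSurjective (AlgHom.id F K) g hg hg'
  have hL : ∀ x, (L x).fst = x := fun x =>
    Algebra.FormallySmooth.liftOfSurjective_apply (AlgHom.id F K) g hg hg' x
  refine ⟨fun x => (L x).snd, ?_, ?_, ?_⟩
  · intro a b; simp
  · intro a b
    simp [hL, mul_comm]
  · have h1 : p = algebraMap F K (algebraMap ℚ[X] F X) := by
      change p = (eF (algebraMap ℚ[X] F X)).fst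
      rw [IsLocalization.lift_eq, hfst]; simp
    have : L p = eF (algebraMap ℚ[X] F X) := by
      conv_lhs => rw [h1]
      rw [AlgHom.commutes]; rfl
    simp only [this]
    rw [IsLocalization.lift_eq]
    simp [e]

end

section

open Polynomial

theorem hensel_factor (K : Type) [Field K] (F : (PowerSeries K)[X]) (hF : F.Monic)
    (h0 : PowerSeries.constantCoeff (F.coeff 0) = 0)
    (h1 : ∃ i < F.natDegree, PowerSeries.constantCoeff (F.coeff i) ≠ 0) :
    ∃ G H : (PowerSeries K)[X], G.Monic ∧ H.Monic ∧ F = G * H ∧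
      G.natDegree < F.natDegree ∧ H.natDegree < F.natDegree := by
  have hmem : ∀ x : PowerSeries K, x ∈ IsLocalRing.maximalIdeal (PowerSeries K) ↔
      PowerSeries.constantCoeff x = 0 := by
    intro x
    rw [PowerSeries.maximalIdeal_eq_span_X, Ideal.mem_span_singleton, PowerSeries.X_dvd_iff]
  have hcomp : IsAdicComplete (IsLocalRing.maximalIdeal (PowerSeries K)) (PowerSeries K) := by
    rw [PowerSeries.maximalIdeal_eq_span_X]; infer_instance
  have hne : PowerSeries.map (IsLocalRing.residue (PowerSeries K)) (F : PowerSeries (PowerSeries K)) ≠ 0 := by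
    intro h
    have := congrArg (PowerSeries.coeff F.natDegree) h
    simp [hF] at this
  obtain ⟨f, h, hw⟩ := PowerSeries.exists_isWeierstrassFactorization hne
  have hfm := hw.isDistinguishedAt.monic
  -- F = f * q
  have hdiv := modByMonic_add_div F f
  set q := F /ₘ f
  set r := F %ₘ f
  have hne2 : PowerSeries.map (IsLocalRing.residue (PowerSeries K)) (f : PowerSeries (PowerSeries K)) ≠ 0 := by
    intro h
    have := congrArg (PowerSeries.coeff f.natDegree) h
    simp [hfm] at this
  have hord : (PowerSeries.map (Ideal.Quotient.mk (IsLocalRing.maximalIdeal (PowerSeries K))) (f : PowerSeries (PowerSeries K))).order.toNat = f.natDegree := by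
    rw [← Polynomial.polynomial_map_coe, hw.isDistinguishedAt.map_eq_X_pow]
    simp
  have hr : (f : PowerSeries (PowerSeries K)) * (h - q) = (r : (PowerSeries K)[X]) := by
    rw [mul_sub, ← hw.eq_mul, ← hdiv]; simp
  have hdeg : r.degree < f.natDegree := by
    rw [← degree_eq_natDegree hfm.ne_zero]
    exact degree_modByMonic_lt _ hfm
  obtain ⟨hq, hr0⟩ := (PowerSeries.IsWeierstrassDivisor.of_map_ne_zero hne2).eq_zero_of_mul_eq
    (by rw [hord]; exact hdeg) hr
  have hFq : F = f * q := by rw [← hdiv, hr0, zero_add]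
  have hqm : q.Monic := hfm.of_mul_monic_left (hFq ▸ hF)
  have hsum : F.natDegree = f.natDegree + q.natDegree := by rw [hFq, hfm.natDegree_mul hqm]
  have hhq : h = q := sub_eq_zero.1 hq
  refine ⟨f, q, hfm, hqm, hFq, ?_, ?_⟩
  · rcases Nat.eq_zero_or_pos q.natDegree with h2 | h2
    · exfalso
      have : q = 1 := hqm.natDegree_eq_zero.1 h2
      obtain ⟨i, hi, hi'⟩ := h1
      rw [this, mul_one] at hFq
      rw [hFq] at hi hi'
      exact hi' ((hmem _).1 (hw.isDistinguishedAt.mem hi))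
    · omega
  · rcases Nat.eq_zero_or_pos f.natDegree with h2 | h2
    · exfalso
      have : f = 1 := hfm.natDegree_eq_zero.1 h2
      have hu := hw.isUnit
      rw [hhq, ← one_mul q, ← this, ← hFq, PowerSeries.isUnit_iff_constantCoeff,
        PowerSeries.isUnit_iff_constantCoeff] at hu
      simp at hu
      exact hu h0
    · omega


/-- `f(z) ↦ f(z^N)` on power series. -/
noncomputable def expd (K : Type) [Field K] (N : ℕ) (hN : N ≠ 0) : PowerSeries K →+* PowerSeries K :=
  (PowerSeries.expand N hN : PowerSeries K →ₐ[K] PowerSeries K).toRingHom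

theorem expd_X (K : Type) [Field K] (N : ℕ) (hN : N ≠ 0) : expd K N hN PowerSeries.X = PowerSeries.X ^ N :=
  PowerSeries.expand_X N hN

theorem constantCoeff_expd (K : Type) [Field K] (N : ℕ) (hN : N ≠ 0) (f : PowerSeries K) :
    PowerSeries.constantCoeff (expd K N hN f) = PowerSeries.constantCoeff f :=
  PowerSeries.constantCoeff_expand N hN f

theorem ps_factor (K : Type) [Field K] (f : PowerSeries K) (hf : f ≠ 0) :
    ∃ u, f = PowerSeries.X ^ f.order.toNat * u ∧ PowerSeries.constantCoeff u ≠ 0 := by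
  obtain ⟨u, hu⟩ := PowerSeries.X_pow_order_dvd (φ := f)
  refine ⟨u, hu, ?_⟩
  have h1 := PowerSeries.coeff_order hf
  intro h
  apply h1
  have := congrArg (PowerSeries.coeff f.order.toNat) hu
  rw [this, PowerSeries.coeff_X_pow_mul', if_pos le_rfl]
  simpa using h

/-- The polynomial acquires all its roots after `z ↦ z^N`. -/
def HasPuis (K : Type) [Field K] (F : (PowerSeries K)[X]) : Prop :=
  ∃ N, ∃ hN : N ≠ 0, (F.map (expd K N hN)).Splits

theorem HasPuis.of_taylor {K : Type} [Field K] {F : (PowerSeries K)[X]} {c : PowerSeries K}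
    (h : HasPuis K (taylor c F)) : HasPuis K F := by
  obtain ⟨N, hN, h⟩ := h
  refine ⟨N, hN, ?_⟩
  have h2 := h.taylor (-(expd K N hN c))
  rw [map_taylor, taylor_taylor, neg_add_cancel, taylor_zero] at h2
  exact h2

theorem HasPuis.of_expd {K : Type} [Field K] {F : (PowerSeries K)[X]} {N : ℕ} {hN : N ≠ 0}
    (h : HasPuis K (F.map (expd K N hN))) : HasPuis K F := by
  obtain ⟨M, hM, h⟩ := h
  refine ⟨M * N, mul_ne_zero hM hN, ?_⟩
  rw [Polynomial.map_map] at h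
  convert h using 2
  ext1 x
  exact PowerSeries.expand_mul M hM N hN x

theorem HasPuis.scaleRoots {K : Type} [Field K] {F : (PowerSeries K)[X]} {c : PowerSeries K} (hF : F.Monic)
    (h : HasPuis K F) : HasPuis K (F.scaleRoots c) := by
  obtain ⟨N, hN, h⟩ := h
  refine ⟨N, hN, ?_⟩
  rw [map_scaleRoots _ _ _ (by rw [hF]; simp)]
  exact h.scaleRoots _

theorem taylor_coeff_pred {R : Type} [CommRing R] (F : R[X]) (hF : F.Monic) (n : ℕ)
    (hn : F.natDegree = n + 1) (c : R) : (taylor c F).coeff n = F.coeff n + (n + 1) * c := by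
  rw [taylor_coeff, eval_eq_sum_range' (n := 2)]
  · have : F.coeff (1 + n) = 1 := by rw [add_comm, ← hn]; exact hF
    simp [Finset.sum_range_succ, hasseDeriv_coeff, this]
    rw [add_comm 1 n, Nat.choose_symm_of_eq_add (b := 1) rfl]
    simp
  · refine lt_of_le_of_lt (natDegree_hasseDeriv_le F n) ?_
    omega

theorem monic_taylor {R : Type} [CommRing R] (F : R[X]) (hF : F.Monic) (c : R) : (taylor c F).Monic := by
  rw [taylor_apply]; exact hF.comp_X_add_C c

theorem puiseux (K : Type) [Field K] [IsAlgClosed K] [CharZero K] (n : ℕ) :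
    ∀ F : (PowerSeries K)[X], F.Monic → F.natDegree = n → HasPuis K F := by
  induction n using Nat.strong_induction_on with
  | _ n ih =>
  classical
  intro F0 hF0 hn0
  rcases n with _ | n
  · refine ⟨1, one_ne_zero, ?_⟩
    rw [hF0.natDegree_eq_zero.1 hn0]; simp
  -- shift to make the trace zero
  have hnK : ((n : PowerSeries K) + 1) * PowerSeries.C ((n + 1 : K)⁻¹) = 1 := by
    have : ((n : PowerSeries K) + 1) = PowerSeries.C (n + 1 : K) := by simp
    rw [this, ← map_mul, mul_inv_cancel₀ (by exact_mod_cast Nat.succ_ne_zero n), map_one]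
  apply HasPuis.of_taylor (c := -(PowerSeries.C ((n + 1 : K)⁻¹) * F0.coeff n))
  have htr : (taylor (-(PowerSeries.C ((n + 1 : K)⁻¹) * F0.coeff n)) F0).coeff n = 0 := by
    rw [taylor_coeff_pred F0 hF0 n hn0]
    linear_combination (- F0.coeff n) * hnK
  have hF : (taylor (-(PowerSeries.C ((n + 1 : K)⁻¹) * F0.coeff n)) F0).Monic := monic_taylor _ hF0 _
  have hn : (taylor (-(PowerSeries.C ((n + 1 : K)⁻¹) * F0.coeff n)) F0).natDegree = n + 1 := by
    rw [natDegree_taylor, hn0]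
  generalize taylor (-(PowerSeries.C ((n + 1 : K)⁻¹) * F0.coeff n)) F0 = F at *
  by_cases hX : ∀ i < n + 1, F.coeff i = 0
  · have : F = X ^ (n + 1) := by
      ext1 i
      rw [coeff_X_pow]
      rcases lt_trichotomy i (n + 1) with h | h | h
      · rw [hX i h, if_neg h.ne]
      · rw [h, if_pos rfl, ← hn]; exact hF
      · rw [if_neg h.ne']; exact coeff_eq_zero_of_natDegree_lt (by omega)
    refine ⟨1, one_ne_zero, ?_⟩
    rw [this]; simp
  push Not at hX
  obtain ⟨i₀, hi₀, hmin⟩ := Finset.exists_min_image ((Finset.range (n + 1)).filter fun i => F.coeff i ≠ 0)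
    (fun i => ((F.coeff i).order.toNat : ℚ) / ((n + 1 - i : ℕ) : ℚ)) (by
      obtain ⟨i, hi, hi'⟩ := hX
      exact ⟨i, by simp [hi, hi']⟩)
  simp only [Finset.mem_filter, Finset.mem_range] at hi₀ hmin
  set k := (F.coeff i₀).order.toNat with hk
  set N := n + 1 - i₀ with hNdef
  have hN : N ≠ 0 := by omega
  have hle : ∀ j < n + 1, F.coeff j ≠ 0 → k * (n + 1 - j) ≤ N * (F.coeff j).order.toNat := by
    intro j hj hj'
    have := hmin j ⟨hj, hj'⟩
    rw [div_le_div_iff₀ (by exact_mod_cast Nat.pos_of_ne_zero hN) (by exact_mod_cast (by omega))] at this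
    have h2 : k * (n + 1 - j) ≤ (F.coeff j).order.toNat * N := by exact_mod_cast this
    linarith
  have hdvd : ∀ j, ∃ g : PowerSeries K, j < n + 1 → expd K N hN (F.coeff j) = g * (PowerSeries.X ^ k) ^ (n + 1 - j) := by
    intro j
    by_cases hj : j < n + 1
    swap
    · exact ⟨0, fun h => absurd h hj⟩
    by_cases hj' : F.coeff j = 0
    · exact ⟨0, fun _ => by simp [hj']⟩
    · obtain ⟨u, hu, _⟩ := ps_factor K _ hj'
      have h2 : (PowerSeries.X : PowerSeries K) ^ (k * (n + 1 - j)) ∣ expd K N hN (F.coeff j) := by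
        rw [hu, map_mul, map_pow, expd_X, ← pow_mul]
        exact Dvd.dvd.mul_right (pow_dvd_pow _ (hle j hj hj')) _
      obtain ⟨g, hg⟩ := h2
      exact ⟨g, fun _ => by rw [hg, pow_mul]; ring⟩
  choose g hg using hdvd
  let F2 : (PowerSeries K)[X] := X ^ (n + 1) + ∑ j ∈ Finset.range (n + 1), monomial j (g j)
  have hdegs : (∑ j ∈ Finset.range (n + 1), monomial j (g j)).degree < ((n + 1 : ℕ) : WithBot ℕ) := by
    refine (degree_sum_le _ _).trans_lt ?_
    rw [Finset.sup_lt_iff (WithBot.bot_lt_coe _)]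
    intro j hj
    exact (degree_monomial_le _ _).trans_lt (by exact_mod_cast Finset.mem_range.1 hj)
  have hF2 : F2.Monic := monic_X_pow_add hdegs
  have hn2 : F2.natDegree = n + 1 := by
    rw [natDegree_add_eq_left_of_degree_lt, natDegree_X_pow]
    rw [degree_X_pow]; exact hdegs
  have hc2 : ∀ j < n + 1, F2.coeff j = g j := by
    intro j hj
    simp only [F2, coeff_add, coeff_X_pow, finsetSum_coeff, coeff_monomial]
    simp [hj.ne, hj]
  have hsc : F.map (expd K N hN) = F2.scaleRoots (PowerSeries.X ^ k) := by
    ext1 j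
    rw [coeff_map, coeff_scaleRoots, hn2]
    rcases lt_trichotomy j (n + 1) with h | h | h
    · rw [hc2 j h, hg j h]
    · rw [h, ← hn, show F.coeff F.natDegree = 1 from hF, hn, ← hn2, show F2.coeff F2.natDegree = 1 from hF2]
      simp
    · rw [coeff_eq_zero_of_natDegree_lt (by omega), coeff_eq_zero_of_natDegree_lt (by omega)]; simp
  apply HasPuis.of_expd (hN := hN)
  rw [hsc]
  apply HasPuis.scaleRoots hF2
  have hgi : PowerSeries.constantCoeff (g i₀) ≠ 0 := by
    obtain ⟨u, hu, hu'⟩ := ps_factor K _ hi₀.2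
    have h3 := hg i₀ hi₀.1
    rw [hu, map_mul, map_pow, expd_X, ← hNdef, ← hk, ← pow_mul, ← pow_mul, mul_comm, mul_comm N k] at h3
    have := mul_right_cancel₀ (pow_ne_zero _ PowerSeries.X_ne_zero) h3
    rw [← this, constantCoeff_expd]; exact hu'
  have hgn : g n = 0 := by
    have := hg n (by omega)
    rw [htr, map_zero, eq_comm, mul_eq_zero] at this
    exact this.resolve_right (pow_ne_zero _ (pow_ne_zero _ PowerSeries.X_ne_zero))
  obtain ⟨a, ha⟩ := IsAlgClosed.exists_root (F2.map (PowerSeries.constantCoeff (R := K))) (by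
    rw [hF2.degree_map, degree_eq_natDegree hF2.ne_zero, hn2]
    exact_mod_cast Nat.succ_ne_zero n)
  apply HasPuis.of_taylor (c := PowerSeries.C a)
  have hF3 : (taylor (PowerSeries.C a) F2).Monic := monic_taylor _ hF2 _
  have hn3 : (taylor (PowerSeries.C a) F2).natDegree = n + 1 := by rw [natDegree_taylor, hn2]
  obtain ⟨G, H, hG, hH, hGH, hGn, hHn⟩ := hensel_factor K _ hF3 (by
    rw [taylor_coeff_zero, ← ha.eq_zero, eval_map, eval₂_eq_eval_map]
    conv_rhs => rw [show a = PowerSeries.constantCoeff (PowerSeries.C a : PowerSeries K) by simp]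
    rw [eval_map_apply]) (by
    by_cases ha0 : a = 0
    · refine ⟨i₀, by omega, ?_⟩
      rw [ha0, map_zero, taylor_zero, hc2 _ hi₀.1]; exact hgi
    · refine ⟨n, by omega, ?_⟩
      rw [taylor_coeff_pred F2 hF2 n hn2, hc2 n (by omega), hgn]
      simp [ha0]
      exact_mod_cast Nat.succ_ne_zero n)
  rw [hGH]
  obtain ⟨N1, hN1, h1⟩ := ih G.natDegree (by omega) G hG rfl
  apply HasPuis.of_expd (hN := hN1)
  obtain ⟨N2, hN2, h2⟩ := ih (H.map (expd K N1 hN1)).natDegree (by rw [hH.natDegree_map]; omega) _ (hH.map _) rfl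
  refine ⟨N2, hN2, ?_⟩
  rw [Polynomial.map_mul, Polynomial.map_mul]
  exact (h1.map _).mul h2

end

section

open Polynomial Differential

theorem deg_C_mul_le {R : Type} [CommRing R] (c : R) (p : R[X]) : (C c * p).degree ≤ p.degree := by
  rw [← smul_eq_C_mul]; exact degree_smul_le c p

theorem deg_prod_X_sub_C {R : Type} [CommRing R] [Nontrivial R] (s : Multiset R) :
    (s.map fun ρ => X - C ρ).prod.degree = (Multiset.card s : WithBot ℕ) := by
  rw [degree_eq_natDegree (monic_multiset_prod_of_monic _ _ fun a _ => monic_X_sub_C a).ne_zero,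
    natDegree_multiset_prod_X_sub_C_eq_card]

/-- The Wronskian type expression (derivative of the second times the first, minus the reverse). -/
noncomputable def wr {M : Type} [CommRing M] [Differential M] (a b : M[X]) : M[X] :=
  mapCoeffs a * derivative b - derivative a * mapCoeffs b

theorem residue_aux {M : Type} [Field M] [Differential M] (α : M) (hα : α ≠ 0) (b v : M[X])
    (l : Multiset M) (hl : ∀ ρ ∈ l, ρ ≠ 0) :
    ∃ Q R : M[X], v * wr (C α * (l.map fun ρ => X - C ρ).prod) b =
      Q * (C α * (l.map fun ρ => X - C ρ).prod) + R ∧ R.degree < (Multiset.card l : WithBot ℕ) ∧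
      R.eval 0 = (C α * (l.map fun ρ => X - C ρ).prod).eval 0 *
        (l.map fun ρ => ρ⁻¹ * (v.eval ρ * (b.eval ρ)′)).sum := by
  induction l using Multiset.induction_on with
  | empty =>
    refine ⟨v * C (α′ / α) * derivative b, 0, ?_, by simp [WithBot.bot_lt_coe], by simp⟩
    simp only [wr, Multiset.map_zero, Multiset.prod_zero, mul_one, mapCoeffs_C, derivative_C, zero_mul, sub_zero, add_zero]
    have : C α′ = C (α′ / α) * C α := by rw [← C_mul, div_mul_cancel₀ _ hα]
    rw [this]; ring
  | cons ρ l ih =>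
    obtain ⟨Q, R, h1, h2, h3⟩ := ih (fun σ h => hl σ (Multiset.mem_cons_of_mem h))
    have hρ := hl ρ (Multiset.mem_cons_self _ _)
    set A := C α * (l.map fun ρ => X - C ρ).prod with hA
    have hA2 : (C α * (Multiset.map (fun ρ => X - C ρ) (ρ ::ₘ l)).prod) = (X - C ρ) * A := by
      rw [Multiset.map_cons, Multiset.prod_cons, hA]; ring
    rw [hA2]
    set G := v * (C ρ′ * derivative b + mapCoeffs b) with hG
    have hGe : G.eval ρ = v.eval ρ * (b.eval ρ)′ := by
      have := Differential.deriv_aeval_eq ρ b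
      simp only [coe_aeval_eq_eval] at this
      rw [hG, this]; simp; ring_nf; simp
    obtain ⟨g, hg⟩ : ∃ g, G = (X - C ρ) * g + C (v.eval ρ * (b.eval ρ)′) := by
      obtain ⟨g, hg⟩ := X_sub_C_dvd_sub_C_eval (p := G) (a := ρ)
      rw [hGe] at hg
      exact ⟨g, by rw [← hg]; ring⟩
    have hw : wr ((X - C ρ) * A) b = (X - C ρ) * wr A b - A * (C ρ′ * derivative b + mapCoeffs b) := by
      simp only [wr, Derivation.leibniz, map_sub, mapCoeffs_X, mapCoeffs_C, smul_eq_mul, derivative_mul,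
        derivative_sub, derivative_X, derivative_C]
      ring
    refine ⟨Q - g, (X - C ρ) * R - C (v.eval ρ * (b.eval ρ)′) * A, ?_, ?_, ?_⟩
    · rw [hw]
      linear_combination (X - C ρ) * h1 - A * hg
    · have hAd : A.degree ≤ (Multiset.card l : WithBot ℕ) := by
        rw [hA]
        refine (deg_C_mul_le _ _).trans ?_
        rw [deg_prod_X_sub_C]
      rw [Multiset.card_cons]
      refine (degree_sub_le _ _).trans_lt (max_lt ?_ ?_)
      · rw [degree_mul, degree_X_sub_C]
        push_cast
        rw [add_comm]
        exact WithBot.add_lt_add_right (by simp) h2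
      · refine (deg_C_mul_le _ _).trans_lt (hAd.trans_lt ?_)
        exact_mod_cast Nat.lt_succ_self _
    · rw [Multiset.map_cons, Multiset.sum_cons]
      simp only [eval_sub, eval_mul, eval_X, eval_C, h3]
      field_simp
      ring

theorem residue_formula {M : Type} [Field M] [Differential M] (α ℓ : M) (hα : α ≠ 0) (a b v q r : M[X])
    (l : Multiset M) (hl : ∀ ρ ∈ l, ρ ≠ 0) (ha : a = C α * (l.map fun ρ => X - C ρ).prod)
    (hbv : ∀ ρ ∈ l, v.eval ρ * b.eval ρ = 1) (hN : (wr a b).eval 0 = 0)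
    (hdiv : C ℓ * (v * wr a b) = q * a + r) (hr : r.degree < a.degree) :
    q.eval 0 = - (ℓ * (l.map fun ρ => ρ⁻¹ * ((b.eval ρ)′ / b.eval ρ)).sum) := by
  obtain ⟨Q, R, h1, h2, h3⟩ := residue_aux α hα b v l hl
  rw [← ha] at h1 h3
  have hdeg : a.degree = (Multiset.card l : WithBot ℕ) := by
    rw [ha, degree_C_mul hα, deg_prod_X_sub_C]
  have hq : q = C ℓ * Q := by
    by_contra hne
    have e : (q - C ℓ * Q) * a = C ℓ * R - r := by linear_combination C ℓ * h1 - hdiv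
    have d1 : (C ℓ * R - r).degree < a.degree := by
      refine (degree_sub_le _ _).trans_lt (max_lt ?_ hr)
      rw [hdeg]
      exact (deg_C_mul_le _ _).trans_lt h2
    rw [← e, degree_mul] at d1
    have : 0 ≤ (q - C ℓ * Q).degree := zero_le_degree_iff.2 (sub_ne_zero.2 hne)
    exact absurd d1 (not_lt.2 (le_add_of_nonneg_left this))
  have ha0 : a.eval 0 ≠ 0 := by
    rw [ha, eval_mul, eval_C]
    refine mul_ne_zero hα ?_
    rw [eval_multiset_prod, Multiset.map_map]
    intro h
    rw [Multiset.prod_eq_zero_iff, Multiset.mem_map] at h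
    obtain ⟨ρ, h1, h2⟩ := h
    simp at h2
    exact hl ρ h1 h2
  have hsum : (l.map fun ρ => ρ⁻¹ * ((b.eval ρ)′ / b.eval ρ)).sum =
      (l.map fun ρ => ρ⁻¹ * (v.eval ρ * (b.eval ρ)′)).sum := by
    congr 1
    refine Multiset.map_congr rfl ?_
    intro ρ h
    have := hbv ρ h
    have hb : b.eval ρ ≠ 0 := right_ne_zero_of_mul_eq_one this
    rw [eq_div_of_mul_eq hb this]
    field_simp
  rw [hsum]
  have e := congrArg (eval 0) h1
  simp only [eval_mul, eval_add, hN, h3] at e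
  rw [hq, eval_mul, eval_C]
  apply mul_right_cancel₀ ha0
  linear_combination - ℓ * e

end

section

open Polynomial Differential

theorem diff_mul {R : Type} [CommRing R] [Differential R] (a b : R) : (a * b)′ = a * b′ + b * a′ :=
  Derivation.leibniz (Differential.deriv (R := R)) a b

theorem logder_int {K : Type} [Field K]
    {M : Type} [Field M] [Algebra (PowerSeries K) M] [IsFractionRing (PowerSeries K) M] [Differential M]
    (i j : ℕ) (hij : j ≤ i)
    (h1 : ∀ f : PowerSeries K, ∃ g : PowerSeries K, (algebraMap (PowerSeries K) M PowerSeries.X) ^ j *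
      (algebraMap (PowerSeries K) M f)′ = algebraMap (PowerSeries K) M g)
    (h2 : ∃ g : PowerSeries K, (algebraMap (PowerSeries K) M PowerSeries.X) ^ i *
      (algebraMap (PowerSeries K) M PowerSeries.X)′ = algebraMap (PowerSeries K) M g * algebraMap (PowerSeries K) M PowerSeries.X) (f : M) :
    ∃ e, (algebraMap (PowerSeries K) M PowerSeries.X) ^ i * f′ = algebraMap (PowerSeries K) M e * f := by
  have hinj : Function.Injective (algebraMap (PowerSeries K) M) := IsFractionRing.injective (PowerSeries K) M
  set Z := algebraMap (PowerSeries K) M PowerSeries.X with hZ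
  have hps : ∀ f : PowerSeries K, ∃ e, Z ^ i * (algebraMap (PowerSeries K) M f)′ =
      algebraMap (PowerSeries K) M e * algebraMap (PowerSeries K) M f := by
    intro f
    by_cases hf : f = 0
    · exact ⟨0, by simp [hf]⟩
    obtain ⟨u, hu, hu0⟩ := ps_factor K f hf
    set k := f.order.toNat
    have hunit : IsUnit u := PowerSeries.isUnit_iff_constantCoeff.2 (isUnit_iff_ne_zero.2 hu0)
    obtain ⟨w, hw⟩ := hunit.exists_left_inv
    obtain ⟨g, hg⟩ := h1 u
    obtain ⟨g2, hg2⟩ := h2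
    have hk : ∀ k : ℕ, Z ^ i * (Z ^ k)′ = algebraMap (PowerSeries K) M ((k : PowerSeries K) * g2) * Z ^ k := by
      intro k
      induction k with
      | zero => simp
      | succ k ih =>
        rw [pow_succ, diff_mul]
        rw [map_mul] at ih ⊢
        rw [Nat.cast_succ, map_add, map_one]
        linear_combination Z ^ k * hg2 + Z * ih
    refine ⟨(k : PowerSeries K) * g2 + PowerSeries.X ^ (i - j) * (g * w), ?_⟩
    have hw' : algebraMap (PowerSeries K) M w * algebraMap (PowerSeries K) M u = 1 := by rw [← map_mul, hw, map_one]
    have hi : Z ^ i = Z ^ (i - j) * Z ^ j := by rw [← pow_add]; congr 1; omega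
    have hf' : algebraMap (PowerSeries K) M f = Z ^ k * algebraMap (PowerSeries K) M u := by rw [hu, map_mul, map_pow]
    rw [hf', diff_mul, map_add, map_mul _ (PowerSeries.X ^ _), map_pow _ PowerSeries.X, map_mul _ g]
    have hk' := hk k
    linear_combination algebraMap (PowerSeries K) M u * hk' + Z^k * (algebraMap (PowerSeries K) M u)′ * hi + Z ^ k * Z ^ (i-j) * hg
      - Z ^ (i-j) * algebraMap (PowerSeries K) M g * Z ^ k * hw'
  obtain ⟨x, y, hy, rfl⟩ := IsFractionRing.div_surjective (A := PowerSeries K) f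
  have hy0 : algebraMap (PowerSeries K) M y ≠ 0 :=
    IsFractionRing.to_map_ne_zero_of_mem_nonZeroDivisors hy
  obtain ⟨e1, h1⟩ := hps x
  obtain ⟨e2, h2⟩ := hps y
  refine ⟨e1 - e2, ?_⟩
  set g := algebraMap (PowerSeries K) M x / algebraMap (PowerSeries K) M y with hg
  have hx : algebraMap (PowerSeries K) M x = g * algebraMap (PowerSeries K) M y := by
    rw [hg, div_mul_cancel₀ _ hy0]
  have := congrArg (fun t : M => t′) hx
  simp only [diff_mul] at this
  rw [map_sub]
  apply mul_left_cancel₀ hy0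
  linear_combination -Z^i * this + h1 + algebraMap (PowerSeries K) M e1 * hx - g * h2

theorem reverse_prod {M : Type} [Field M] (l : Multiset M) (hl : ∀ τ ∈ l, τ ≠ 0) :
    ∃ c : M, c ≠ 0 ∧ (l.map fun τ => X - C τ).prod.reverse =
      C c * (l.map fun τ => X - C τ⁻¹).prod := by
  induction l using Multiset.induction_on with
  | empty => exact ⟨1, one_ne_zero, by
      rw [Multiset.map_zero, Multiset.prod_zero, ← C_1, reverse_C]; simp⟩
  | cons τ l ih =>
    obtain ⟨c, hc, h⟩ := ih fun σ h => hl σ (Multiset.mem_cons_of_mem h)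
    have hτ := hl τ (Multiset.mem_cons_self _ _)
    refine ⟨-τ * c, mul_ne_zero (neg_ne_zero.2 hτ) hc, ?_⟩
    rw [Multiset.map_cons, Multiset.prod_cons, reverse_mul_of_domain, h, Multiset.map_cons, Multiset.prod_cons]
    have : (X - C τ : M[X]).reverse = C (-τ) * (X - C τ⁻¹) := by
      have e : (X - C τ : M[X]) = X + C (-τ) := by simp [sub_eq_add_neg]
      rw [mul_sub, ← C_mul, neg_mul, mul_inv_cancel₀ hτ, e]
      have : (X + C (-τ) : M[X]).reverse = 1 + C (-τ) * X := by
        rw [reverse, natDegree_X_add_C, reflect_add, reflect_C]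
        simp [reflect_one_X]
      rw [this]; simp; ring
    rw [this, C_mul]; ring

theorem local_lemma {K : Type} [Field K]
    {M : Type} [Field M] [Algebra (PowerSeries K) M] [IsFractionRing (PowerSeries K) M] [Differential M]
    {B : Type} [CommRing B] [Differential B]
    (ψ : B →+* M) (hψi : Function.Injective ψ) (hψ : ∀ x, ψ (x′) = (ψ x)′)
    (a b u v q r : B[X]) (ℓ : B) (huv : u * a + v * b = 1) (hN : (wr a b).eval 0 = 0)
    (hdiv : C ℓ * (v * wr a b) = q * a + r) (hr : r.degree < a.degree)
    (t : Multiset (PowerSeries K)) (ht : Multiset.card t = a.natDegree) (ha0 : a.coeff 0 ≠ 0)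
    (hF : ∀ j ≤ a.natDegree, ψ (a.coeff j) = ψ (a.coeff 0) *
      algebraMap (PowerSeries K) M ((t.map fun τ => X - C τ).prod.coeff (a.natDegree - j))) :
    (∀ τ ∈ t, algebraMap (PowerSeries K) M τ ≠ 0 ∧
      (a.map ψ).eval (algebraMap (PowerSeries K) M τ)⁻¹ = 0 ∧
      (b.map ψ).eval (algebraMap (PowerSeries K) M τ)⁻¹ ≠ 0) ∧
    ψ (q.eval 0) = - (ψ ℓ * (t.map fun τ => algebraMap (PowerSeries K) M τ *
      (((b.map ψ).eval (algebraMap (PowerSeries K) M τ)⁻¹)′ / (b.map ψ).eval (algebraMap (PowerSeries K) M τ)⁻¹)).sum) := by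
  have hane : a ≠ 0 := fun h => ha0 (by simp [h])
  have hψ0 : ψ (a.coeff 0) ≠ 0 := fun h => ha0 (hψi (by rw [h, map_zero]))
  have hinj : Function.Injective (algebraMap (PowerSeries K) M) := IsFractionRing.injective (PowerSeries K) M
  set F := (t.map fun τ => X - C τ).prod with hFdef
  have htne : ∀ τ ∈ t, algebraMap (PowerSeries K) M τ ≠ 0 := by
    intro τ hτ h
    have h0 : τ = 0 := hinj (by rw [h, map_zero])
    have h1 := hF a.natDegree le_rfl
    rw [Nat.sub_self] at h1
    have h2 : F.coeff 0 = 0 := by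
      rw [coeff_zero_eq_eval_zero, hFdef, eval_multiset_prod, Multiset.map_map]
      apply Multiset.prod_eq_zero
      rw [Multiset.mem_map]
      exact ⟨τ, hτ, by simp [h0]⟩
    rw [h2, map_zero, mul_zero] at h1
    have : a.coeff a.natDegree = 0 := hψi (by rw [h1, map_zero])
    exact hane (leadingCoeff_eq_zero.1 this)
  have hFM : F.map (algebraMap (PowerSeries K) M) = ((t.map (algebraMap (PowerSeries K) M)).map fun τ => X - C τ).prod := by
    rw [hFdef, Polynomial.map_multiset_prod, Multiset.map_map, Multiset.map_map]
    simp
  have hFdeg : (F.map (algebraMap (PowerSeries K) M)).natDegree = a.natDegree := by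
    rw [hFM, natDegree_multiset_prod_X_sub_C_eq_card, Multiset.card_map, ht]
  have hdega : (a.map ψ).natDegree = a.natDegree := natDegree_map_eq_of_injective hψi a
  obtain ⟨c, hc, hrev⟩ := reverse_prod (t.map (algebraMap (PowerSeries K) M)) (by
    intro τ h
    obtain ⟨σ, hσ, rfl⟩ := Multiset.mem_map.1 h
    exact htne σ hσ)
  have haM : a.map ψ = C (ψ (a.coeff 0) * c) *
      ((t.map fun τ => (algebraMap (PowerSeries K) M τ)⁻¹).map fun ρ => X - C ρ).prod := by
    rw [C_mul, mul_assoc]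
    rw [Multiset.map_map] at hrev ⊢
    have e : (Multiset.map ((fun ρ => X - C ρ) ∘ fun τ => ((algebraMap (PowerSeries K) M) τ)⁻¹) t)
      = Multiset.map (fun τ => X - C τ⁻¹) (Multiset.map (⇑(algebraMap (PowerSeries K) M)) t) := by
      rw [Multiset.map_map]; rfl
    rw [e, ← hrev, ← Multiset.map_map, ← hFM]
    ext1 j
    rw [coeff_map, coeff_C_mul, coeff_reverse, hFdeg]
    rcases le_or_gt j a.natDegree with h | h
    · rw [revAt_le h, hF j h, coeff_map]
    · rw [revAt_eq_self_of_lt h, coeff_eq_zero_of_natDegree_lt h, coeff_eq_zero_of_natDegree_lt (p := F.map (algebraMap (PowerSeries K) M)) (n := j) (by rw [hFdeg]; exact h)]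
      simp
  have hmc : ∀ p : B[X], (mapCoeffs p).map ψ = mapCoeffs (p.map ψ) := by
    intro p; ext1 n; simp [hψ]
  have hwr : (wr a b).map ψ = wr (a.map ψ) (b.map ψ) := by
    simp [wr, hmc, derivative_map]
  have hroot : ∀ τ ∈ t, (a.map ψ).eval (algebraMap (PowerSeries K) M τ)⁻¹ = 0 := by
    intro τ hτ
    rw [haM, eval_mul, eval_multiset_prod, Multiset.map_map]
    apply mul_eq_zero_of_right
    apply Multiset.prod_eq_zero
    rw [Multiset.mem_map]
    exact ⟨_, Multiset.mem_map_of_mem _ hτ, by simp⟩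
  refine ⟨fun τ hτ => ⟨htne τ hτ, hroot τ hτ, ?_⟩, ?_⟩
  · intro hb
    have h1 := congrArg (fun p => (p.map ψ).eval (algebraMap (PowerSeries K) M τ)⁻¹) huv
    simp [hroot τ hτ, hb] at h1
  have key := residue_formula (ψ (a.coeff 0) * c) (ψ ℓ) (mul_ne_zero hψ0 hc) (a.map ψ) (b.map ψ)
    (v.map ψ) (q.map ψ) (r.map ψ) (t.map fun τ => (algebraMap (PowerSeries K) M τ)⁻¹) (by
      intro ρ h
      obtain ⟨τ, hτ, rfl⟩ := Multiset.mem_map.1 h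
      exact inv_ne_zero (htne τ hτ)) haM (by
      intro ρ hρ
      have h1 := congrArg (fun p => (p.map ψ).eval ρ) huv
      have h2 : (a.map ψ).eval ρ = 0 := by
        rw [haM, eval_mul, eval_multiset_prod, Multiset.map_map]
        apply mul_eq_zero_of_right
        apply Multiset.prod_eq_zero
        rw [Multiset.mem_map]
        exact ⟨ρ, hρ, by simp⟩
      simpa [h2] using h1) (by
      rw [← hwr]
      have := congrArg ψ hN
      simpa [← coeff_zero_eq_eval_zero] using this) (by
      have := congrArg (Polynomial.map ψ) hdiv
      simpa [hwr] using this) (by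
      rw [degree_map_eq_of_injective hψi, degree_map_eq_of_injective hψi]; exact hr)
  have h0 : (q.map ψ).eval 0 = ψ (q.eval 0) := by simp [← coeff_zero_eq_eval_zero]
  rw [← h0, key, Multiset.map_map]
  congr 3
  refine Multiset.map_congr rfl ?_
  intro τ hτ
  simp only [Function.comp]
  rw [inv_inv]

end

section

open Polynomial Differential

noncomputable def psD {K : Type} [Field K] [Differential K] (f : PowerSeries K) : PowerSeries K :=
  PowerSeries.mk fun n => (PowerSeries.coeff n f)′

theorem coeff_psD {K : Type} [Field K] [Differential K] (f : PowerSeries K) (n : ℕ) :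
    PowerSeries.coeff n (psD f) = (PowerSeries.coeff n f)′ := by simp [psD]

theorem constantCoeff_psD {K : Type} [Field K] [Differential K] (f : PowerSeries K) :
    PowerSeries.constantCoeff (psD f) = (PowerSeries.constantCoeff f)′ := by
  rw [← PowerSeries.coeff_zero_eq_constantCoeff_apply, coeff_psD, PowerSeries.coeff_zero_eq_constantCoeff_apply]

theorem psD_add {K : Type} [Field K] [Differential K] (f g : PowerSeries K) :
    psD (f + g) = psD f + psD g := by ext n; simp [coeff_psD]

theorem psD_mul {K : Type} [Field K] [Differential K] (f g : PowerSeries K) :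
    psD (f * g) = f * psD g + g * psD f := by
  ext n
  rw [mul_comm g, coeff_psD, map_add, PowerSeries.coeff_mul, PowerSeries.coeff_mul, PowerSeries.coeff_mul,
    map_sum, ← Finset.sum_add_distrib]
  refine Finset.sum_congr rfl fun x _ => ?_
  rw [diff_mul, coeff_psD, coeff_psD]; ring

theorem psD_C {K : Type} [Field K] [Differential K] (c : K) :
    psD (PowerSeries.C c) = PowerSeries.C (c′) := by
  ext n; rw [coeff_psD, PowerSeries.coeff_C, PowerSeries.coeff_C]; split_ifs <;> simp

theorem psD_one {K : Type} [Field K] [Differential K] :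
    psD (1 : PowerSeries K) = 0 := by
  rw [← map_one (PowerSeries.C (R := K)), psD_C]; simp

theorem psD_X_pow {K : Type} [Field K] [Differential K] (k : ℕ) :
    psD (PowerSeries.X ^ k : PowerSeries K) = 0 := by
  ext n; rw [coeff_psD, PowerSeries.coeff_X_pow]; split_ifs <;> simp

noncomputable def psDer {K : Type} [Field K] (f : PowerSeries K) : PowerSeries K := PowerSeries.derivative K f

theorem psDer_mul {K : Type} [Field K] (f g : PowerSeries K) : psDer (f * g) = f * psDer g + g * psDer f :=
  Derivation.leibniz _ _ _

theorem exists_diffM (K : Type) [Field K] [Differential K] (M : Type) [Field M] [Algebra (PowerSeries K) M]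
    [IsFractionRing (PowerSeries K) M] (c : M) :
    ∃ D : Differential M, ∀ f : PowerSeries K, D.deriv (algebraMap (PowerSeries K) M f) =
      algebraMap (PowerSeries K) M (psD f) + c * algebraMap (PowerSeries K) M (psDer f) := by
  let e : PowerSeries K →+* TrivSqZeroExt M M :=
    { toFun := fun f => TrivSqZeroExt.inl (algebraMap _ M f) +
        TrivSqZeroExt.inr (algebraMap (PowerSeries K) M (psD f) + c * algebraMap (PowerSeries K) M (psDer f))
      map_one' := by
        ext
        · simp
        · simp [psDer, psD_one]
      map_zero' := by
        have : psD (0 : PowerSeries K) = 0 := by ext n; simp [coeff_psD]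
        ext
        · simp
        · simp [psDer, this]
      map_add' := by
        intro f g
        ext
        · simp
        · simp [psDer, psD_add]; ring
      map_mul' := by
        intro f g
        ext
        · simp
        · simp [psDer_mul, psD_mul]; ring }
  have hfst : ∀ f, (e f).fst = algebraMap _ M f := fun f => by simp [e]
  have hsnd : ∀ f, (e f).snd = (algebraMap (PowerSeries K) M (psD f) + c * algebraMap (PowerSeries K) M (psDer f)) :=
    fun f => by simp [e]
  have hu : ∀ y : nonZeroDivisors (PowerSeries K), IsUnit (e y) := by
    intro y
    rw [TrivSqZeroExt.isUnit_iff_isUnit_fst, hfst]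
    exact isUnit_iff_ne_zero.2 (IsFractionRing.to_map_ne_zero_of_mem_nonZeroDivisors y.2)
  let L : M →+* TrivSqZeroExt M M := IsLocalization.lift hu
  have hL : ∀ x, L (algebraMap _ M x) = e x := fun x => IsLocalization.lift_eq hu x
  have hLf : ∀ x, (L x).fst = x := by
    intro x
    have : ((TrivSqZeroExt.fstHom M M M).toRingHom.comp L) = RingHom.id M := by
      refine IsLocalization.ringHom_ext (nonZeroDivisors (PowerSeries K)) ?_
      ext f
      change (L (algebraMap _ M f)).fst = algebraMap _ M f
      rw [hL, hfst]
    exact congrArg (fun h : M →+* M => h x) this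
  let D : Derivation ℤ M M := Derivation.mk' ((AddMonoidHom.mk' (fun x => (L x).snd) (by intro a b; simp)).toIntLinearMap) (by
    intro a b
    change (L (a * b)).snd = a • (L b).snd + b • (L a).snd
    simp [hLf]; rw [mul_comm])
  refine ⟨⟨D⟩, fun f => ?_⟩
  change (L (algebraMap _ M f)).snd = _
  rw [hL, hsnd]

theorem mkF {R : Type} [CommRing R] [Nontrivial R] (m : ℕ) (c : ℕ → R) (hc : c 0 = 1) :
    ∃ F : R[X], F.Monic ∧ F.natDegree = m ∧ ∀ j ≤ m, F.coeff (m - j) = c j := by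
  let F : R[X] := ∑ i ∈ Finset.range (m + 1), monomial i (c (m - i))
  have hco : ∀ i, F.coeff i = if i < m + 1 then c (m - i) else 0 := by
    intro i
    simp only [F, finsetSum_coeff, coeff_monomial]
    rw [Finset.sum_ite_eq' (Finset.range (m+1)) i]
    simp
  have hd : F.natDegree ≤ m := by
    rw [natDegree_le_iff_coeff_eq_zero]
    intro N hN
    rw [hco, if_neg (by omega)]
  have hm : F.coeff m = 1 := by rw [hco, if_pos (by omega), Nat.sub_self, hc]
  refine ⟨F, monic_of_natDegree_le_of_coeff_eq_one m hd hm, ?_, ?_⟩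
  · exact natDegree_eq_of_le_of_coeff_ne_zero hd (by rw [hm]; exact one_ne_zero)
  · intro j hj
    rw [hco, if_pos (by omega)]; congr 1; omega

/-- Puiseux roots of a polynomial with prescribed reversed coefficients. -/
theorem puis_roots (K : Type) [Field K] [IsAlgClosed K] [CharZero K] (m : ℕ) (c : ℕ → PowerSeries K) (hc : c 0 = 1) :
    ∃ N, ∃ hN : N ≠ 0, ∃ t : Multiset (PowerSeries K), Multiset.card t = m ∧
      ∀ j ≤ m, (t.map fun τ => X - C τ).prod.coeff (m - j) = expd K N hN (c j) := by
  obtain ⟨F, hF, hd, hco⟩ := mkF m c hc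
  obtain ⟨N, hN, hs⟩ := puiseux K m F hF hd
  have h1 := hs.eq_prod_roots_of_monic (hF.map _)
  refine ⟨N, hN, (F.map (expd K N hN)).roots, ?_, ?_⟩
  · have := congrArg natDegree h1
    rw [natDegree_multiset_prod_X_sub_C_eq_card, hF.natDegree_map, hd] at this
    exact this.symm
  · intro j hj
    rw [← h1, coeff_map, hco j hj]

end

section

open Polynomial Differential

@[reducible] noncomputable def diffPoly (K : Type) [Field K] [Differential K] : Differential K[X] := ⟨mapCoeffs⟩

attribute [local instance] diffPoly

theorem comm_diff {K : Type} [Field K] [Differential K] {M : Type} [Field M] [Differential M] (ψ : K[X] →+* M)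
    (hC : ∀ c : K, (ψ (C c))′ = ψ (C (c′))) (hX : (ψ X)′ = 0) (p : K[X]) : ψ (p′) = (ψ p)′ := by
  have hd : ∀ p : K[X], p′ = mapCoeffs p := fun _ => rfl
  have hXn : ∀ n : ℕ, ((ψ X) ^ n)′ = 0 := by
    intro n
    induction n with
    | zero => simp
    | succ n ih => rw [pow_succ, diff_mul, ih, hX]; simp
  induction p using Polynomial.induction_on' with
  | add p q hp hq => rw [map_add, map_add, map_add, map_add, hp, hq]
  | monomial n c =>
    have e : (monomial n c : K[X])′ = C (c′) * X ^ n := by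
      rw [hd]; ext i; simp [coeff_monomial, coeff_X_pow]
      split_ifs with h1 h2 <;> simp_all
    rw [e, ← C_mul_X_pow_eq_monomial, map_mul, map_mul, map_pow, diff_mul, hXn, hC]; ring

/-- the map `w ↦ w0 + z^N`. -/
noncomputable def plc (K : Type) [Field K] (w0 : K) (N : ℕ) (hN : N ≠ 0) : K[X] →+* PowerSeries K :=
  (expd K N hN).comp ((Polynomial.coeToPowerSeries.ringHom).comp (taylorAlgHom w0).toRingHom)

theorem plc_apply (K : Type) [Field K] (w0 : K) (N : ℕ) (hN : N ≠ 0) (p : K[X]) :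
    plc K w0 N hN p = expd K N hN ((taylor w0 p : K[X]) : PowerSeries K) := rfl

theorem expd_inj (K : Type) [Field K] (N : ℕ) (hN : N ≠ 0) : Function.Injective (expd K N hN) := by
  intro f g h
  ext n
  have := congrArg (PowerSeries.coeff (N * n)) h
  simpa [expd, PowerSeries.coeff_expand_mul] using this

theorem expd_C (K : Type) [Field K] (N : ℕ) (hN : N ≠ 0) (c : K) : expd K N hN (PowerSeries.C c) = PowerSeries.C c := by
  exact PowerSeries.expand_C N hN c

theorem plc_inj (K : Type) [Field K] (w0 : K) (N : ℕ) (hN : N ≠ 0) : Function.Injective (plc K w0 N hN) := by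
  intro f g h
  rw [plc_apply, plc_apply] at h
  exact taylor_injective w0 (Polynomial.coe_injective K (expd_inj K N hN h))

theorem plc_C (K : Type) [Field K] (w0 : K) (N : ℕ) (hN : N ≠ 0) (c : K) : plc K w0 N hN (C c) = PowerSeries.C c := by
  rw [plc_apply, taylor_C, Polynomial.coe_C, expd_C]

theorem plc_X (K : Type) [Field K] (w0 : K) (N : ℕ) (hN : N ≠ 0) :
    plc K w0 N hN X = PowerSeries.X ^ N + PowerSeries.C w0 := by
  rw [plc_apply, taylor_X, Polynomial.coe_add, Polynomial.coe_X, Polynomial.coe_C, map_add, expd_C, expd_X]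

theorem constantCoeff_plc (K : Type) [Field K] (w0 : K) (N : ℕ) (hN : N ≠ 0) (p : K[X]) :
    PowerSeries.constantCoeff (plc K w0 N hN p) = p.eval w0 := by
  rw [plc_apply, constantCoeff_expd, Polynomial.constantCoeff_coe, taylor_coeff_zero]

theorem exists_plc_diff (K : Type) [Field K] [CharZero K] [Differential K] (M : Type) [Field M] [Algebra (PowerSeries K) M]
    [IsFractionRing (PowerSeries K) M] (w0 : K) (N : ℕ) (hN : N ≠ 0) :
    ∃ _ : Differential M, (∀ p, algebraMap (PowerSeries K) M (plc K w0 N hN (p′)) = (algebraMap (PowerSeries K) M (plc K w0 N hN p))′) ∧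
      (∀ f : PowerSeries K, ∃ g : PowerSeries K, (algebraMap (PowerSeries K) M PowerSeries.X) ^ (N - 1) *
        (algebraMap (PowerSeries K) M f)′ = algebraMap (PowerSeries K) M g) ∧
      (w0′ = 0 → ∀ f : PowerSeries K, (algebraMap (PowerSeries K) M f)′ = algebraMap (PowerSeries K) M (psD f)) := by
  have hinj : Function.Injective (algebraMap (PowerSeries K) M) := IsFractionRing.injective (PowerSeries K) M
  set Z := algebraMap (PowerSeries K) M PowerSeries.X with hZ
  have hZ0 : Z ≠ 0 := fun h => PowerSeries.X_ne_zero (hinj (by rw [← hZ, h, map_zero]))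
  have hN' : (N : K) ≠ 0 := Nat.cast_ne_zero.2 hN
  obtain ⟨D, hD⟩ := exists_diffM K M (- algebraMap (PowerSeries K) M (PowerSeries.C (w0′ / N)) * (Z ^ (N - 1))⁻¹)
  have hdC : ∀ c : K, psDer (PowerSeries.C c) = 0 := fun c => by simp [psDer]
  have hdX : psDer (PowerSeries.X ^ N + PowerSeries.C w0) = PowerSeries.C (N : K) * PowerSeries.X ^ (N - 1) := by
    rw [psDer, map_add, PowerSeries.derivative_pow]; simp
  have hZN : Z ^ (N - 1) ≠ 0 := pow_ne_zero _ hZ0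
  refine ⟨D, ?_, ?_, ?_⟩
  · intro p
    refine comm_diff ((algebraMap (PowerSeries K) M).comp (plc K w0 N hN)) ?_ ?_ p
    · intro c
      simp only [RingHom.comp_apply, plc_C]
      rw [hD, psD_C, hdC]; simp
    · simp only [RingHom.comp_apply, plc_X]
      rw [hD, hdX, psD_add, psD_X_pow, psD_C, zero_add, map_mul, map_pow, ← hZ]
      have : (PowerSeries.C (w0′) : PowerSeries K) = PowerSeries.C (w0′ / N) * PowerSeries.C (N : K) := by
        rw [← map_mul, div_mul_cancel₀ _ hN']
      rw [this, map_mul]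
      field_simp
      ring
  · intro f
    refine ⟨PowerSeries.X ^ (N - 1) * psD f - PowerSeries.C (w0′ / N) * psDer f, ?_⟩
    rw [hD, map_sub, map_mul, map_mul, map_pow, ← hZ]
    field_simp
    ring
  · intro h f
    rw [hD, h]; simp

end

section

open Polynomial Differential

attribute [local instance] diffPoly

theorem map_eval_alg {B O M : Type} [CommRing B] [CommRing O] [CommRing M] (ψ : B →+* O) (φ : O →+* M) (b : B[X]) (x : O) :
    (b.map (φ.comp ψ)).eval (φ x) = φ ((b.map ψ).eval x) := by
  rw [← Polynomial.map_map, eval_map, eval₂_hom]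

/-- local data at a finite place -/
theorem place_data (K : Type) [Field K] [IsAlgClosed K] [CharZero K] (a : K[X][X]) (w0 : K)
    (h0 : (a.coeff 0).eval w0 ≠ 0) :
    ∃ N, ∃ hN : N ≠ 0, ∃ t : Multiset (PowerSeries K), Multiset.card t = a.natDegree ∧
      ∀ j ≤ a.natDegree, plc K w0 N hN (a.coeff j) = plc K w0 N hN (a.coeff 0) *
        ((t.map fun τ => X - C τ).prod.coeff (a.natDegree - j)) := by
  have hu : IsUnit ((taylor w0 (a.coeff 0) : K[X]) : PowerSeries K) := by
    rw [PowerSeries.isUnit_iff_constantCoeff, Polynomial.constantCoeff_coe, taylor_coeff_zero]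
    exact isUnit_iff_ne_zero.2 h0
  obtain ⟨i, hi⟩ := hu.exists_right_inv
  obtain ⟨N, hN, t, ht, hco⟩ := puis_roots K a.natDegree
    (fun j => ((taylor w0 (a.coeff j) : K[X]) : PowerSeries K) * i) hi
  refine ⟨N, hN, t, ht, fun j hj => ?_⟩
  rw [hco j hj, plc_apply, plc_apply, ← map_mul]
  congr 1
  linear_combination - ((taylor w0 (a.coeff j) : K[X]) : PowerSeries K) * hi

theorem unit_at (K : Type) [Field K] (M : Type) [Field M] [Algebra (PowerSeries K) M]
    [IsFractionRing (PowerSeries K) M] {B : Type} [CommRing B] (ψ : B →+* PowerSeries K)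
    (a b u v : B[X]) (huv : u * a + v * b = 1) (τ : PowerSeries K) (hτ : PowerSeries.constantCoeff τ ≠ 0)
    (ha : (a.map ((algebraMap (PowerSeries K) M).comp ψ)).eval (algebraMap (PowerSeries K) M τ)⁻¹ = 0) :
    ∃ σ β : PowerSeries K, τ * σ = 1 ∧ IsUnit β ∧ β = (b.map ψ).eval σ ∧
      (b.map ((algebraMap (PowerSeries K) M).comp ψ)).eval (algebraMap (PowerSeries K) M τ)⁻¹ = algebraMap _ M β := by
  have hinj : Function.Injective (algebraMap (PowerSeries K) M) := IsFractionRing.injective (PowerSeries K) M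
  have hu : IsUnit τ := PowerSeries.isUnit_iff_constantCoeff.2 (isUnit_iff_ne_zero.2 hτ)
  obtain ⟨σ, hσ⟩ := hu.exists_right_inv
  have hs : (algebraMap (PowerSeries K) M τ)⁻¹ = algebraMap _ M σ := by
    refine (eq_inv_of_mul_eq_one_left ?_).symm
    rw [← map_mul, mul_comm, hσ, map_one]
  rw [hs, map_eval_alg] at ha
  have ha' : (a.map ψ).eval σ = 0 := hinj (by rw [ha, map_zero])
  have h1 := congrArg (fun p => (p.map ψ).eval σ) huv
  simp [ha'] at h1
  exact ⟨σ, _, hσ, IsUnit.of_mul_eq_one_right _ h1, rfl, by rw [hs, map_eval_alg]⟩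

theorem multiset_sum_lift {K : Type} [Field K] {M : Type} [Field M] [Algebra (PowerSeries K) M]
    (t : Multiset (PowerSeries K)) (Z : M) (f : PowerSeries K → M)
    (h : ∀ τ ∈ t, ∃ g : PowerSeries K, Z * f τ = algebraMap _ M g) :
    ∃ g : PowerSeries K, Z * (t.map f).sum = algebraMap _ M g := by
  induction t using Multiset.induction_on with
  | empty => exact ⟨0, by simp⟩
  | cons τ t ih =>
    obtain ⟨g1, h1⟩ := ih fun σ hσ => h σ (Multiset.mem_cons_of_mem hσ)
    obtain ⟨g2, h2⟩ := h τ (Multiset.mem_cons_self _ _)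
    exact ⟨g2 + g1, by rw [Multiset.map_cons, Multiset.sum_cons, mul_add, h1, h2, map_add]⟩

theorem place_finite (K : Type) [Field K] [IsAlgClosed K] [CharZero K] [Differential K]
    (a b u v q r : K[X][X]) (ℓ : K[X]) (huv : u * a + v * b = 1) (hN : (wr a b).eval 0 = 0)
    (hdiv : C ℓ * (v * wr a b) = q * a + r) (hr : r.degree < a.degree) (w0 : K)
    (h0 : (a.coeff 0).eval w0 ≠ 0) :
    ∃ N, ∃ hN : N ≠ 0, ∃ s, PowerSeries.X ^ (N - 1) * plc K w0 N hN (q.eval 0) = - (plc K w0 N hN ℓ * s) := by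
  obtain ⟨N, hN0, t, ht, hF⟩ := place_data K a w0 h0
  refine ⟨N, hN0, ?_⟩
  let M := FractionRing (PowerSeries K)
  have hinj : Function.Injective (algebraMap (PowerSeries K) M) := IsFractionRing.injective (PowerSeries K) M
  obtain ⟨D, hcomm, hreg, -⟩ := exists_plc_diff K M w0 N hN0
  set Z := algebraMap (PowerSeries K) M PowerSeries.X with hZ
  obtain ⟨hroot, hq⟩ := local_lemma ((algebraMap (PowerSeries K) M).comp (plc K w0 N hN0))
    (hinj.comp (plc_inj K w0 N hN0)) hcomm a b u v q r ℓ huv hN hdiv hr t ht (fun h => h0 (by simp [h])) (by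
      intro j hj
      rw [RingHom.comp_apply, RingHom.comp_apply, hF j hj, map_mul])
  obtain ⟨gX, hgX⟩ := hreg PowerSeries.X
  have hlog := logder_int (M := M) N (N - 1) (Nat.sub_le _ _) hreg ⟨gX, by
    rw [← hgX, ← hZ]
    have : Z ^ N = Z ^ (N - 1) * Z := by rw [← pow_succ]; congr 1; omega
    rw [this]; ring⟩
  obtain ⟨s, hs⟩ := multiset_sum_lift t (Z ^ (N - 1)) _ (fun τ hτ => by
    obtain ⟨h1, h2, h3⟩ := hroot τ hτ
    show ∃ g : PowerSeries K, Z ^ (N - 1) * (algebraMap _ M τ * (((b.map ((algebraMap (PowerSeries K) M).comp (plc K w0 N hN0))).eval (algebraMap (PowerSeries K) M τ)⁻¹)′ / (b.map ((algebraMap (PowerSeries K) M).comp (plc K w0 N hN0))).eval (algebraMap (PowerSeries K) M τ)⁻¹)) = _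
    by_cases hτ0 : PowerSeries.constantCoeff τ = 0
    · obtain ⟨τ', hτ'⟩ := PowerSeries.X_dvd_iff.2 hτ0
      obtain ⟨e, he⟩ := hlog ((b.map ((algebraMap (PowerSeries K) M).comp (plc K w0 N hN0))).eval (algebraMap (PowerSeries K) M τ)⁻¹)
      refine ⟨τ' * e, ?_⟩
      rw [← hZ] at he
      have hzn : Z ^ N = Z ^ (N - 1) * Z := by rw [← pow_succ]; congr 1; omega
      have hτM : algebraMap _ M τ = Z * algebraMap _ M τ' := by rw [hτ', map_mul]
      rw [hzn] at he
      rw [mul_div_assoc', mul_div_assoc', div_eq_iff h3, map_mul, mul_assoc, ← he]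
      rw [hτM]; ring
    · obtain ⟨σ, β, hσ, hβ, -, hb⟩ := unit_at K M (plc K w0 N hN0) a b u v huv τ hτ0 h2
      obtain ⟨g, hg⟩ := hreg β
      obtain ⟨β', hβ'⟩ := hβ.exists_left_inv
      rw [hb] at h3 ⊢
      refine ⟨τ * (g * β'), ?_⟩
      rw [mul_div_assoc', mul_div_assoc', div_eq_iff h3, map_mul, map_mul, ← hg]
      have : algebraMap _ M β' * algebraMap _ M β = 1 := by rw [← map_mul, hβ', map_one]
      linear_combination - algebraMap _ M τ * (Z ^ (N - 1) * (algebraMap _ M β)′) * this)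
  refine ⟨s, hinj ?_⟩
  rw [map_neg, map_mul, map_mul, ← hs, map_pow, ← hZ]
  simp only [RingHom.comp_apply] at hq
  rw [hq]
  ring

end

section

open Polynomial Differential

attribute [local instance] diffPoly

section
variable (K : Type) [Field K] (M : Type) [Field M] [Algebra (PowerSeries K) M]
    [IsFractionRing (PowerSeries K) M]

/-- the map `w ↦ z^{-N}`. -/
noncomputable def plcInf (N : ℕ) : K[X] →+* M :=
  eval₂RingHom ((algebraMap (PowerSeries K) M).comp PowerSeries.C) ((algebraMap (PowerSeries K) M PowerSeries.X) ^ N)⁻¹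

theorem plcInf_reflect (N : ℕ) (hN : N ≠ 0) (p : K[X]) (d : ℕ) (hd : p.natDegree ≤ d) :
    plcInf K M N p * ((algebraMap (PowerSeries K) M PowerSeries.X) ^ N) ^ d =
      algebraMap (PowerSeries K) M (expd K N hN ((reflect d p : K[X]) : PowerSeries K)) := by
  have hinj : Function.Injective (algebraMap (PowerSeries K) M) := IsFractionRing.injective (PowerSeries K) M
  set Z := algebraMap (PowerSeries K) M PowerSeries.X with hZ
  have hZ0 : Z ≠ 0 := fun h => PowerSeries.X_ne_zero (hinj (by rw [← hZ, h, map_zero]))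
  have hZN : Z ^ N ≠ 0 := pow_ne_zero _ hZ0
  have h1 : ∀ P : K[X], algebraMap (PowerSeries K) M (expd K N hN (P : PowerSeries K)) =
      eval₂ ((algebraMap (PowerSeries K) M).comp PowerSeries.C) (Z ^ N) P := by
    intro P
    have : ((algebraMap (PowerSeries K) M).comp ((expd K N hN).comp (Polynomial.coeToPowerSeries.ringHom))) =
      eval₂RingHom ((algebraMap (PowerSeries K) M).comp PowerSeries.C) (Z ^ N) := by
      ext x
      · simp [expd_C]
      · simp [expd_X, hZ]
    exact congrArg (fun f : K[X] →+* M => f P) this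
  let inv : Invertible ((Z ^ N)⁻¹) := invertibleOfNonzero (inv_ne_zero hZN)
  have h2 := eval₂_reflect_mul_pow ((algebraMap (PowerSeries K) M).comp PowerSeries.C) ((Z ^ N)⁻¹) d p hd
  rw [invOf_eq_inv, inv_inv] at h2
  rw [h1, plcInf, coe_eval₂RingHom, ← h2, mul_assoc, ← mul_pow, inv_mul_cancel₀ hZN, one_pow, mul_one]

theorem plcInf_inj (N : ℕ) (hN : N ≠ 0) : Function.Injective (plcInf K M N) := by
  have hinj : Function.Injective (algebraMap (PowerSeries K) M) := IsFractionRing.injective (PowerSeries K) M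
  rw [injective_iff_map_eq_zero]
  intro p hp
  have h := plcInf_reflect K M N hN p p.natDegree le_rfl
  rw [hp, zero_mul] at h
  have h1 : expd K N hN ((reflect p.natDegree p : K[X]) : PowerSeries K) = 0 := hinj (by rw [← h, map_zero])
  have h2 := expd_inj K N hN (h1.trans (map_zero _).symm)
  have h3 : reflect p.natDegree p = 0 := Polynomial.coe_injective K (by rw [h2]; simp)
  simpa using h3

theorem exists_plcInf_diff [Differential K] (N : ℕ) :
    ∃ _ : Differential M, (∀ p, plcInf K M N (p′) = (plcInf K M N p)′) ∧
      (∀ f : PowerSeries K, (algebraMap (PowerSeries K) M f)′ = algebraMap (PowerSeries K) M (psD f)) := by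
  have hinj : Function.Injective (algebraMap (PowerSeries K) M) := IsFractionRing.injective (PowerSeries K) M
  obtain ⟨D, hD⟩ := exists_diffM K M 0
  simp only [zero_mul, add_zero] at hD
  refine ⟨D, fun p => comm_diff (plcInf K M N) ?_ ?_ p, hD⟩
  · intro c
    simp only [plcInf, coe_eval₂RingHom, eval₂_C, RingHom.comp_apply]
    rw [hD, psD_C]
  · simp only [plcInf, coe_eval₂RingHom, eval₂_X]
    set Z := algebraMap (PowerSeries K) M PowerSeries.X with hZ
    have hZ0 : Z ≠ 0 := fun h => PowerSeries.X_ne_zero (hinj (by rw [← hZ, h, map_zero]))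
    have hZN : Z ^ N ≠ 0 := pow_ne_zero _ hZ0
    have h1 : (Z ^ N)′ = 0 := by
      rw [hZ, ← map_pow, hD, psD_X_pow, map_zero]
    have h2 : (Z ^ N * (Z ^ N)⁻¹)′ = 0 := by rw [mul_inv_cancel₀ hZN]; simp
    rw [diff_mul, h1, mul_zero, add_zero] at h2
    exact (mul_eq_zero.1 h2).resolve_left hZN

end

theorem psD_logs {K : Type} [Field K] [Differential K]
    {M : Type} [Field M] [Algebra (PowerSeries K) M] [IsFractionRing (PowerSeries K) M] [Differential M]
    (hD : ∀ f : PowerSeries K, (algebraMap (PowerSeries K) M f)′ = algebraMap (PowerSeries K) M (psD f)) (f : M) :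
    ∃ e, f′ = algebraMap (PowerSeries K) M e * f := by
  have := logder_int (M := M) 0 0 le_rfl (fun f => ⟨psD f, by rw [hD]; simp⟩) ⟨0, by
    have : psD (PowerSeries.X : PowerSeries K) = 0 := by simpa using psD_X_pow (K := K) 1
    rw [hD, this]; simp⟩ f
  simpa using this

theorem place_infty (K : Type) [Field K] [IsAlgClosed K] [CharZero K] [Differential K]
    (a b u v q r : K[X][X]) (ℓ : K[X]) (huv : u * a + v * b = 1) (hN : (wr a b).eval 0 = 0)
    (hdiv : C ℓ * (v * wr a b) = q * a + r) (hr : r.degree < a.degree)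
    (h0 : a.coeff 0 ≠ 0) (hdeg : ∀ j, 0 < j → (a.coeff j).degree < (a.coeff 0).degree) (hl : ℓ ≠ 0) :
    (q.eval 0).degree < ℓ.degree := by
  set d := (a.coeff 0).natDegree with hd
  have hcle : ∀ j, (a.coeff j).natDegree ≤ d := by
    intro j
    rcases Nat.eq_zero_or_pos j with rfl | hj
    · exact le_rfl
    · exact natDegree_le_natDegree (hdeg j hj).le
  have hc0 : ∀ P : K[X], ∀ d, PowerSeries.constantCoeff ((reflect d P : K[X]) : PowerSeries K) = P.coeff d := by
    intro P d
    rw [Polynomial.constantCoeff_coe, coeff_reflect]; simp [revAt_le]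
  have hu : IsUnit ((reflect d (a.coeff 0) : K[X]) : PowerSeries K) := by
    rw [PowerSeries.isUnit_iff_constantCoeff, hc0]
    exact isUnit_iff_ne_zero.2 (leadingCoeff_ne_zero.2 h0)
  obtain ⟨i, hi⟩ := hu.exists_right_inv
  obtain ⟨N, hN0, t, ht, hco⟩ := puis_roots K a.natDegree
    (fun j => ((reflect d (a.coeff j) : K[X]) : PowerSeries K) * i) hi
  let M := FractionRing (PowerSeries K)
  have hinj : Function.Injective (algebraMap (PowerSeries K) M) := IsFractionRing.injective (PowerSeries K) M
  obtain ⟨D, hcomm, hD⟩ := exists_plcInf_diff K M N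
  set Z := algebraMap (PowerSeries K) M PowerSeries.X with hZ
  have hZ0 : Z ≠ 0 := fun h => PowerSeries.X_ne_zero (hinj (by rw [← hZ, h, map_zero]))
  have hZd : ∀ d, (Z ^ N) ^ d ≠ 0 := fun d => pow_ne_zero _ (pow_ne_zero _ hZ0)
  obtain ⟨hroot, hq⟩ := local_lemma (plcInf K M N)
    (plcInf_inj K M N hN0) hcomm a b u v q r ℓ huv hN hdiv hr t ht h0 (by
      intro j hj
      apply mul_right_cancel₀ (hZd d)
      rw [hco j hj, plcInf_reflect K M N hN0 _ d (hcle j), mul_right_comm, plcInf_reflect K M N hN0 _ d (hcle 0),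
        ← map_mul, ← map_mul]
      congr 2
      linear_combination - ((reflect d (a.coeff j) : K[X]) : PowerSeries K) * hi)
  -- all roots have zero constant coefficient
  have hτ0 : ∀ τ ∈ t, PowerSeries.constantCoeff τ = 0 := by
    intro τ hτ
    have e1 : ((t.map fun τ => X - C τ).prod.map PowerSeries.constantCoeff) = X ^ a.natDegree := by
      ext1 k
      rw [coeff_map]
      rcases le_or_gt k a.natDegree with hk | hk
      · have := hco (a.natDegree - k) (Nat.sub_le _ _)
        rw [Nat.sub_sub_self hk] at this
        rw [this, constantCoeff_expd, coeff_X_pow]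
        rcases eq_or_lt_of_le hk with h | h
        · rw [if_pos h, h, Nat.sub_self, hi, map_one]
        · rw [if_neg h.ne, map_mul, hc0, coeff_eq_zero_of_degree_lt, zero_mul]
          refine (hdeg _ (by omega)).trans_le ?_
          exact degree_le_natDegree
      · rw [coeff_eq_zero_of_natDegree_lt (p := (t.map fun τ => X - C τ).prod) (n := k), map_zero, coeff_X_pow, if_neg hk.ne']
        rw [natDegree_multiset_prod_X_sub_C_eq_card, ht]; exact hk
    have e2 := congrArg (eval (PowerSeries.constantCoeff τ)) e1
    rw [eval_pow, eval_X, eval_map_apply, eval_multiset_prod, Multiset.map_map, Multiset.prod_eq_zero, map_zero] at e2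
    · exact eq_zero_of_pow_eq_zero e2.symm
    · rw [Multiset.mem_map]
      exact ⟨τ, hτ, by simp⟩
  choose e he using fun f => psD_logs (M := M) hD f
  obtain ⟨s, hs, hs0⟩ : ∃ s : PowerSeries K, plcInf K M N (q.eval 0) = - (plcInf K M N ℓ * algebraMap _ M s) ∧
      PowerSeries.constantCoeff s = 0 := by
    refine ⟨(t.map fun τ => τ * e ((b.map (plcInf K M N)).eval (algebraMap (PowerSeries K) M τ)⁻¹)).sum, ?_, ?_⟩
    · rw [hq, map_multiset_sum, Multiset.map_map]
      congr 3
      refine Multiset.map_congr rfl ?_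
      intro τ hτ
      rw [Function.comp_apply, map_mul]
      congr 1
      rw [div_eq_iff (hroot τ hτ).2.2]
      exact he _
    · rw [map_multiset_sum, Multiset.map_map]
      apply Multiset.sum_eq_zero
      intro x hx
      obtain ⟨τ, hτ, rfl⟩ := Multiset.mem_map.1 hx
      simp [hτ0 τ hτ]
  by_contra hcon
  rw [not_lt] at hcon
  set d' := (q.eval 0).natDegree with hd'
  have e1 := plcInf_reflect K M N hN0 (q.eval 0) d' le_rfl
  have e2 := plcInf_reflect K M N hN0 ℓ d' (natDegree_le_natDegree hcon)
  rw [hs, neg_mul, mul_right_comm, e2, ← map_mul, ← map_neg] at e1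
  have e3 := congrArg PowerSeries.constantCoeff (hinj e1)
  rw [map_neg, map_mul, hs0, mul_zero, constantCoeff_expd, hc0] at e3
  have : q.eval 0 = 0 := leadingCoeff_eq_zero.1 (by rw [leadingCoeff, ← hd', ← e3, neg_zero])
  rw [this, degree_zero, le_bot_iff, degree_eq_bot] at hcon
  exact hl hcon

end

section

open Polynomial Differential

attribute [local instance] diffPoly

theorem final_calc {K : Type} [Field K] [CharZero K] [Differential K] (p κ : K) (hp : p′ = 1) (hp0 : p ≠ 0)
    (hp3 : p ^ 3 ≠ 1) (hκ : κ ^ 2 * p = 1) (c1 c2 σ1 σ2 : K) (hs1 : κ * σ1 = 1) (hs2 : (-κ) * σ2 = 1)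
    (h1 : (σ1 ^ 3 + 1)′ = c1 * (σ1 ^ 3 + 1)) (h2 : (σ2 ^ 3 + 1)′ = c2 * (σ2 ^ 3 + 1)) :
    κ * c1 + (-κ) * c2 ≠ 0 := by
  have hκ0 : κ ≠ 0 := by rintro rfl; simp at hs1
  have hs : σ2 = -σ1 := by
    apply mul_left_cancel₀ hκ0; linear_combination hs1 - hs2
  subst hs
  have hσ : σ1 ^ 2 = p := by
    have : κ ^ 2 * σ1 ^ 2 = κ ^ 2 * p := by rw [← mul_pow, hs1, hκ]; ring
    exact mul_left_cancel₀ (pow_ne_zero 2 hκ0) this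
  have hσ0 : σ1 ≠ 0 := by rintro rfl; simp at hs1
  have hd : 2 * σ1 * σ1′ = 1 := by
    have := congrArg (fun x : K => x′) hσ
    simp only [pow_two, diff_mul, hp] at this
    linear_combination this
  have hd3 : (σ1 ^ 3)′ = 3 * σ1 ^ 2 * σ1′ := by
    rw [pow_succ, pow_two, diff_mul, diff_mul]; ring
  have e1 : (σ1 ^ 3 + 1)′ = 3 * σ1 ^ 2 * σ1′ := by rw [map_add, hd3]; simp
  have e2 : ((-σ1) ^ 3 + 1)′ = -(3 * σ1 ^ 2 * σ1′) := by
    rw [Odd.neg_pow (by decide), map_add, map_neg, hd3]; simp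
  rw [e1] at h1
  rw [e2] at h2
  -- multiply out
  intro h
  have hc : c1 = c2 := by
    apply mul_left_cancel₀ hκ0; linear_combination h
  subst hc
  have h3 : c1 * 2 = 0 := by linear_combination - h1 - h2
  have h4 : c1 = 0 := by simpa using h3
  rw [h4, zero_mul] at h1
  have : 3 * σ1 = 0 := by linear_combination 2 * h1 - 3 * σ1 * hd
  simp [hσ0] at this

theorem place_zero (K : Type) [Field K] [IsAlgClosed K] [CharZero K] [Differential K]
    (a b u v q r : K[X][X]) (ℓ : K[X]) (huv : u * a + v * b = 1) (hN : (wr a b).eval 0 = 0)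
    (hdiv : C ℓ * (v * wr a b) = q * a + r) (hr : r.degree < a.degree) (hl : ℓ ≠ 0) (hq0 : q.eval 0 = 0)
    (p : K) (hp : p′ = 1) (hp0 : p ≠ 0) (hp3 : p ^ 3 ≠ 1) (ha : a.map (evalRingHom 0) = X ^ 2 - C p)
    (hb : b.map (evalRingHom 0) = X ^ 3 + 1) : False := by
  have haj : ∀ j, (a.coeff j).eval 0 = (X ^ 2 - C p : K[X]).coeff j := by
    intro j; rw [← ha, coeff_map]; rfl
  have h00 : (a.coeff 0).eval 0 = -p := by rw [haj]; simp
  have h0 : (a.coeff 0).eval 0 ≠ 0 := by rw [h00]; exact neg_ne_zero.2 hp0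
  obtain ⟨N, hN0, t, ht, hF⟩ := place_data K a 0 h0
  let M := FractionRing (PowerSeries K)
  have hinj : Function.Injective (algebraMap (PowerSeries K) M) := IsFractionRing.injective (PowerSeries K) M
  obtain ⟨D, hcomm, -, hD⟩ := exists_plc_diff K M 0 N hN0
  specialize hD (map_zero _)
  obtain ⟨hroot, hq⟩ := local_lemma ((algebraMap (PowerSeries K) M).comp (plc K 0 N hN0))
    (hinj.comp (plc_inj K 0 N hN0)) hcomm a b u v q r ℓ huv hN hdiv hr t ht (fun h => h0 (by simp [h])) (by
      intro j hj
      rw [RingHom.comp_apply, RingHom.comp_apply, hF j hj, map_mul])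
  choose e he using fun f => psD_logs (M := M) hD f
  set bb : PowerSeries K → M := fun τ =>
    (b.map ((algebraMap (PowerSeries K) M).comp (plc K 0 N hN0))).eval (algebraMap (PowerSeries K) M τ)⁻¹ with hbb
  have hs : (t.map fun τ => τ * e (bb τ)).sum = 0 := by
    rw [hq0, map_zero, zero_eq_neg, mul_eq_zero] at hq
    rcases hq with hq | hq
    · exfalso
      exact hl ((hinj.comp (plc_inj K 0 N hN0)) (by simpa using hq))
    · apply hinj
      rw [map_zero, ← hq, map_multiset_sum, Multiset.map_map]
      congr 1
      refine Multiset.map_congr rfl ?_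
      intro τ hτ
      rw [Function.comp_apply, map_mul]
      congr 1
      exact eq_div_of_mul_eq (hroot τ hτ).2.2 (he _).symm
  have hev : ∀ τ ∈ t, PowerSeries.constantCoeff τ ≠ 0 → ∃ σ : K, PowerSeries.constantCoeff τ * σ = 1 ∧
      (σ ^ 3 + 1)′ = PowerSeries.constantCoeff (e (bb τ)) * (σ ^ 3 + 1) := by
    intro τ hτ hτ0
    obtain ⟨σ, β, hσ, hβ, hβ', hb'⟩ := unit_at K M (plc K 0 N hN0) a b u v huv τ hτ0 (hroot τ hτ).2.1
    refine ⟨PowerSeries.constantCoeff σ, by rw [← map_mul, hσ, map_one], ?_⟩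
    have h1 := he (bb τ)
    have h2 : bb τ = algebraMap _ M β := hb'
    have h3 : psD β = e (bb τ) * β := by
      apply hinj
      rw [← hD, map_mul, ← h2, h1]
    have h4 : PowerSeries.constantCoeff β = PowerSeries.constantCoeff σ ^ 3 + 1 := by
      rw [hβ', ← eval_map_apply, Polynomial.map_map]
      have : (PowerSeries.constantCoeff.comp (plc K 0 N hN0)) = evalRingHom 0 := by
        ext x
        · simp [plc_C]
        · simp [plc_X, hN0]
      rw [this, hb]; simp
    have h5 := congrArg PowerSeries.constantCoeff h3
    rwa [constantCoeff_psD, map_mul, h4] at h5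
  have hsum : (t.map fun τ => PowerSeries.constantCoeff τ * PowerSeries.constantCoeff (e (bb τ))).sum = 0 := by
    have := congrArg PowerSeries.constantCoeff hs
    rw [map_multiset_sum, Multiset.map_map, map_zero] at this
    rw [← this]
    congr 1
    refine Multiset.map_congr rfl fun τ _ => ?_
    simp
  have hm2 : 2 ≤ a.natDegree := by
    have : (a.map (evalRingHom 0)).natDegree = 2 := by rw [ha]; exact natDegree_X_pow_sub_C
    rw [← this]; exact natDegree_map_le
  have hpm : ((t.map fun τ => X - C τ).prod.map PowerSeries.constantCoeff) = X ^ (a.natDegree - 2) * (X ^ 2 - C p⁻¹) := by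
    ext1 k
    rw [coeff_map]
    rcases le_or_gt k a.natDegree with hk | hk
    · have h1 := congrArg PowerSeries.constantCoeff (hF (a.natDegree - k) (Nat.sub_le _ _))
      rw [Nat.sub_sub_self hk, map_mul, constantCoeff_plc, constantCoeff_plc, h00, haj] at h1
      have h2 : PowerSeries.constantCoeff ((t.map fun τ => X - C τ).prod.coeff k) = - p⁻¹ * (X ^ 2 - C p : K[X]).coeff (a.natDegree - k) := by
        rw [h1]; field_simp
      rw [h2, mul_sub, ← pow_add, Nat.sub_add_cancel hm2, coeff_sub, coeff_sub, coeff_X_pow, coeff_X_pow,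
        coeff_mul_C, coeff_X_pow, coeff_C]
      by_cases hk1 : k = a.natDegree
      · rw [if_neg (by omega), if_pos (by omega), if_pos hk1, if_neg (by omega)]; field_simp; simp
      · by_cases hk2 : k = a.natDegree - 2
        · rw [if_pos (by omega), if_neg (by omega), if_neg (by omega), if_pos (by omega)]; simp
        · rw [if_neg (by omega), if_neg (by omega), if_neg (by omega), if_neg (by omega)]; simp
    · rw [coeff_eq_zero_of_natDegree_lt (p := (t.map fun τ => X - C τ).prod) (n := k), map_zero,
        mul_sub, ← pow_add, Nat.sub_add_cancel hm2, coeff_sub, coeff_X_pow, coeff_mul_C, coeff_X_pow,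
        if_neg (by omega), if_neg (by omega)]
      · simp
      · rw [natDegree_multiset_prod_X_sub_C_eq_card, ht]; exact hk
  obtain ⟨κ, hκ⟩ := IsAlgClosed.exists_pow_nat_eq (p⁻¹) (n := 2) (by norm_num)
  have hκ0 : κ ≠ 0 := by
    rintro rfl
    simp at hκ
    exact hp0 hκ.symm
  have hmm : t.map PowerSeries.constantCoeff = κ ::ₘ (-κ) ::ₘ Multiset.replicate (a.natDegree - 2) 0 := by
    have h1 : ((t.map PowerSeries.constantCoeff).map fun x => X - C x).prod =
        ((κ ::ₘ (-κ) ::ₘ Multiset.replicate (a.natDegree - 2) (0:K)).map fun x => X - C x).prod := by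
      rw [Polynomial.map_multiset_prod, Multiset.map_map] at hpm
      rw [Multiset.map_map]
      have h2 : (Multiset.map ((fun x => X - C x) ∘ ⇑PowerSeries.constantCoeff) t) =
        (Multiset.map (Polynomial.map PowerSeries.constantCoeff ∘ fun τ => X - C τ) t) :=
        Multiset.map_congr rfl fun τ _ => by simp
      rw [h2, hpm, Multiset.map_cons, Multiset.map_cons, Multiset.prod_cons, Multiset.prod_cons, Multiset.map_replicate,
        Multiset.prod_replicate, ← hκ]
      simp
      ring
    have h2 := congrArg roots h1
    rwa [roots_multiset_prod_X_sub_C, roots_multiset_prod_X_sub_C] at h2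
  have hκm : κ ∈ t.map PowerSeries.constantCoeff := by rw [hmm]; simp
  obtain ⟨τ1, hτ1, hκ1⟩ := Multiset.mem_map.1 hκm
  obtain ⟨t1, rfl⟩ := Multiset.exists_cons_of_mem hτ1
  rw [Multiset.map_cons, hκ1, Multiset.cons_inj_right] at hmm
  have hκm : -κ ∈ t1.map PowerSeries.constantCoeff := by rw [hmm]; simp
  obtain ⟨τ2, hτ2, hκ2⟩ := Multiset.mem_map.1 hκm
  obtain ⟨t2, rfl⟩ := Multiset.exists_cons_of_mem hτ2
  rw [Multiset.map_cons, hκ2, Multiset.cons_inj_right] at hmm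
  have hrest : (t2.map fun τ => PowerSeries.constantCoeff τ * PowerSeries.constantCoeff (e (bb τ))).sum = 0 := by
    apply Multiset.sum_eq_zero
    intro x hx
    obtain ⟨τ, hτ, rfl⟩ := Multiset.mem_map.1 hx
    have : PowerSeries.constantCoeff τ ∈ t2.map PowerSeries.constantCoeff := Multiset.mem_map_of_mem _ hτ
    rw [hmm] at this
    rw [Multiset.eq_of_mem_replicate this, zero_mul]
  obtain ⟨σ1, hs1, hd1⟩ := hev τ1 hτ1 (by rw [hκ1]; exact hκ0)
  obtain ⟨σ2, hs2, hd2⟩ := hev τ2 (Multiset.mem_cons_of_mem hτ2) (by rw [hκ2]; exact neg_ne_zero.2 hκ0)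
  rw [Multiset.map_cons, Multiset.sum_cons, Multiset.map_cons, Multiset.sum_cons, hrest, add_zero, hκ1, hκ2] at hsum
  rw [hκ1] at hs1
  rw [hκ2] at hs2
  exact final_calc p κ hp hp0 hp3 (by rw [hκ]; exact inv_mul_cancel₀ hp0) _ _ σ1 σ2 hs1 hs2 hd1 hd2 hsum

end

section

open Polynomial Differential

attribute [local instance] diffPoly

theorem pseudo_div {R : Type} [CommRing R] [IsDomain R] (a : R[X]) (ha : a ≠ 0) (n : ℕ) :
    ∀ p : R[X], p.natDegree < n → ∃ ℓ : R, ℓ ≠ 0 ∧ ∃ q r : R[X], C ℓ * p = q * a + r ∧ r.degree < a.degree := by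
  induction n with
  | zero => intro p h; omega
  | succ n ih =>
    intro p hp
    by_cases hlt : p.degree < a.degree
    · exact ⟨1, one_ne_zero, 0, p, by simp, hlt⟩
    rw [not_lt] at hlt
    have hp0 : p ≠ 0 := by
      rintro rfl
      rw [degree_zero, le_bot_iff, degree_eq_bot] at hlt
      exact ha hlt
    have hlc : a.leadingCoeff ≠ 0 := leadingCoeff_ne_zero.2 ha
    have hlp : p.leadingCoeff ≠ 0 := leadingCoeff_ne_zero.2 hp0
    set s := C p.leadingCoeff * X ^ (p.natDegree - a.natDegree) with hs
    have hnd : a.natDegree ≤ p.natDegree := natDegree_le_natDegree hlt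
    have hd : (C a.leadingCoeff * p - s * a).degree < p.degree := by
      have e1 : (C a.leadingCoeff * p).degree = p.degree := degree_C_mul hlc
      rw [← e1]
      refine degree_sub_lt_left ?_ (mul_ne_zero (C_ne_zero.2 hlc) hp0) ?_
      · rw [e1, hs, degree_mul, degree_C_mul_X_pow _ hlp, degree_eq_natDegree ha, degree_eq_natDegree hp0]
        norm_cast; omega
      · rw [leadingCoeff_mul, leadingCoeff_mul, hs, leadingCoeff_C, leadingCoeff_C_mul_X_pow, mul_comm]
    by_cases hz : C a.leadingCoeff * p - s * a = 0
    · refine ⟨a.leadingCoeff, hlc, s, 0, by rw [add_zero]; exact sub_eq_zero.1 hz, ?_⟩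
      rw [degree_zero, bot_lt_iff_ne_bot, Ne, degree_eq_bot]; exact ha
    obtain ⟨ℓ, hℓ, q, r, h1, h2⟩ := ih _ (lt_of_lt_of_le (natDegree_lt_natDegree hz hd) (Nat.lt_succ_iff.1 hp))
    refine ⟨ℓ * a.leadingCoeff, mul_ne_zero hℓ hlc, q + C ℓ * s, r, ?_, h2⟩
    rw [C_mul]
    linear_combination h1

theorem degree_mapCoeffs_le {R : Type} [CommRing R] [Differential R] (a : R[X]) : (mapCoeffs a).degree ≤ a.degree := by
  rw [degree_le_iff_coeff_zero]
  intro m hm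
  rw [coeff_mapCoeffs, coeff_eq_zero_of_degree_lt hm, map_zero]

theorem degree_wr {R : Type} [CommRing R] [IsDomain R] [Differential R] (a b : R[X]) (ha : a ≠ 0) (hb : b ≠ 0) :
    (wr a b).degree < a.degree + b.degree := by
  have h1 := degree_derivative_lt ha
  have h2 := degree_derivative_lt hb
  have n1 := degree_mapCoeffs_le a
  have n2 := degree_mapCoeffs_le b
  rw [wr]
  have ba : a.degree ≠ ⊥ := by rwa [Ne, degree_eq_bot]
  have bb : b.degree ≠ ⊥ := by rwa [Ne, degree_eq_bot]
  refine (degree_sub_le _ _).trans_lt (max_lt ?_ ?_)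
  · rw [degree_mul]
    exact (add_le_add_left n1 _).trans_lt (WithBot.add_lt_add_left ba h2)
  · rw [degree_mul]
    exact (add_le_add_right n2 _).trans_lt (WithBot.add_lt_add_right bb h1)

theorem common_div {R : Type} [CommRing R] [IsDomain R] [Differential R] (a b u v : R[X]) (ha : a ≠ 0) (hb : b ≠ 0)
    (huv : u * a + v * b = 1) : ∃ ℓ : R, ℓ ≠ 0 ∧ ∃ q r r' : R[X],
      C ℓ * (v * wr a b) = q * a + r ∧ r.degree < a.degree ∧
      C ℓ * (u * wr b a) = q * b + r' ∧ r'.degree < b.degree := by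
  obtain ⟨ℓ1, h1, q1, r1, e1, d1⟩ := pseudo_div a ha _ (v * wr a b) (Nat.lt_succ_self _)
  obtain ⟨ℓ2, h2, q2, r2, e2, d2⟩ := pseudo_div b hb _ (u * wr b a) (Nat.lt_succ_self _)
  have D1 : (C ℓ2 * r1).degree < a.degree := (deg_C_mul_le _ _).trans_lt d1
  have D2 : (C ℓ1 * r2).degree < b.degree := (deg_C_mul_le _ _).trans_lt d2
  have ba : a.degree ≠ ⊥ := by rwa [Ne, degree_eq_bot]
  have bb : b.degree ≠ ⊥ := by rwa [Ne, degree_eq_bot]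
  have hw : wr b a = - wr a b := by simp only [wr]; ring
  have hq : C ℓ2 * q1 = C ℓ1 * q2 := by
    by_contra hne
    have e : (C ℓ2 * q1 - C ℓ1 * q2) * (a * b) = C (ℓ1 * ℓ2) * wr a b + (C ℓ1 * r2) * a - (C ℓ2 * r1) * b := by
      rw [C_mul]
      rw [hw] at e2
      linear_combination -C ℓ2 * b * e1 + C ℓ1 * a * e2 + C ℓ1 * C ℓ2 * wr a b * huv
    have hd : ((C ℓ2 * q1 - C ℓ1 * q2) * (a * b)).degree < a.degree + b.degree := by
      rw [e]
      refine (degree_sub_le _ _).trans_lt (max_lt ((degree_add_le _ _).trans_lt (max_lt ?_ ?_)) ?_)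
      · exact (deg_C_mul_le _ _).trans_lt (degree_wr a b ha hb)
      · rw [degree_mul, add_comm a.degree]
        exact WithBot.add_lt_add_right ba D2
      · rw [degree_mul]
        exact WithBot.add_lt_add_right bb D1
    rw [degree_mul, degree_mul] at hd
    have : 0 ≤ (C ℓ2 * q1 - C ℓ1 * q2).degree := zero_le_degree_iff.2 (sub_ne_zero.2 hne)
    exact absurd hd (not_lt.2 (le_add_of_nonneg_left this))
  refine ⟨ℓ1 * ℓ2, mul_ne_zero h1 h2, C ℓ2 * q1, C ℓ2 * r1, C ℓ1 * r2, ?_, D1, ?_, D2⟩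
  · rw [C_mul]; linear_combination C ℓ2 * e1
  · rw [hq, C_mul]; linear_combination C ℓ1 * e2

theorem place_concl (K : Type) [Field K] (w0 : K) (N : ℕ) (hN : N ≠ 0) (q1 l1 : K[X]) (s : PowerSeries K)
    (h : PowerSeries.X ^ (N - 1) * plc K w0 N hN q1 = - (plc K w0 N hN l1 * s)) (hl : l1.eval w0 = 0) :
    q1.eval w0 = 0 := by
  obtain ⟨l2, rfl⟩ := dvd_iff_isRoot.2 hl
  have h1 : plc K w0 N hN (X - C w0) = PowerSeries.X ^ (N - 1) * PowerSeries.X := by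
    rw [map_sub, plc_X, plc_C, ← pow_succ]; simp; congr 1; omega
  rw [map_mul, h1] at h
  have h2 : plc K w0 N hN q1 = - (PowerSeries.X * plc K w0 N hN l2 * s) := by
    apply mul_left_cancel₀ (pow_ne_zero (N - 1) (PowerSeries.X_ne_zero (R := K)))
    rw [h]; ring
  rw [← constantCoeff_plc K w0 N hN, h2]; simp

theorem family_false (K : Type) [Field K] [IsAlgClosed K] [CharZero K] [Differential K]
    (a b u v : K[X][X]) (huv : u * a + v * b = 1) (ha1 : a.coeff 1 = 0) (hb1 : b.coeff 1 = 0)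
    (hdeg : ∀ j, 0 < j → (a.coeff j).degree < (a.coeff 0).degree)
    (p : K) (hp : p′ = 1) (hp0 : p ≠ 0) (hp3 : p ^ 3 ≠ 1) (ha : a.map (evalRingHom 0) = X ^ 2 - C p)
    (hb : b.map (evalRingHom 0) = X ^ 3 + 1) : False := by
  have hane : a ≠ 0 := by
    rintro rfl
    have := congrArg natDegree ha
    rw [natDegree_X_pow_sub_C] at this
    simp at this
  have hbne : b ≠ 0 := by
    rintro rfl
    have := congrArg natDegree hb
    rw [← C_1, natDegree_X_pow_add_C] at this
    simp at this
  have hder : ∀ f : K[X][X], f.coeff 1 = 0 → (derivative f).eval 0 = 0 := by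
    intro f hf
    rw [← coeff_zero_eq_eval_zero, coeff_derivative]; simp [hf]
  have hN : (wr a b).eval 0 = 0 := by
    rw [wr]; simp [hder a ha1, hder b hb1]
  have hN' : (wr b a).eval 0 = 0 := by
    rw [wr]; simp [hder a ha1, hder b hb1]
  obtain ⟨ℓ, hℓ, q, r, r', e1, d1, e2, d2⟩ := common_div a b u v hane hbne huv
  have hvu : v * b + u * a = 1 := by rw [add_comm]; exact huv
  have h0 : a.coeff 0 ≠ 0 := by
    intro h
    have := hdeg 1 one_pos
    rw [h, degree_zero] at this
    exact absurd this not_lt_bot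
  have hinf := place_infty K a b u v q r ℓ huv hN e1 d1 h0 hdeg hℓ
  -- divide by the gcd
  classical
  set g := EuclideanDomain.gcd (q.eval 0) ℓ with hg
  have hg0 : g ≠ 0 := fun h => hℓ ((EuclideanDomain.gcd_eq_zero_iff.1 h).2)
  obtain ⟨q1, hq1⟩ := EuclideanDomain.gcd_dvd_left (q.eval 0) ℓ
  obtain ⟨l1, hl1⟩ := EuclideanDomain.gcd_dvd_right (q.eval 0) ℓ
  rw [← hg] at hq1 hl1
  have hcop : IsCoprime q1 l1 := by
    have hxy := EuclideanDomain.gcd_eq_gcd_ab (q.eval 0) ℓ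
    rw [← hg] at hxy
    set x := EuclideanDomain.gcdA (q.eval 0) ℓ
    set y := EuclideanDomain.gcdB (q.eval 0) ℓ
    replace hxy : g = (g * q1) * x + (g * l1) * y := by rw [← hq1, ← hl1]; exact hxy
    refine ⟨x, y, mul_left_cancel₀ hg0 ?_⟩
    linear_combination -hxy
  have hloc : ∀ w0 : K, l1.eval w0 ≠ 0 := by
    intro w0 hw
    obtain ⟨N, hN0, s, hs⟩ : ∃ N, ∃ hN : N ≠ 0, ∃ s, PowerSeries.X ^ (N - 1) * plc K w0 N hN (q.eval 0) = - (plc K w0 N hN ℓ * s) := by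
      by_cases hz : (a.coeff 0).eval w0 = 0
      · refine place_finite K b a v u q r' ℓ hvu hN' e2 d2 w0 ?_
        intro hz'
        have := congrArg (fun f : K[X][X] => (f.coeff 0).eval w0) huv
        simp [mul_coeff_zero, hz, hz'] at this
      · exact place_finite K a b u v q r ℓ huv hN e1 d1 w0 hz
    have hs' : PowerSeries.X ^ (N - 1) * plc K w0 N hN0 q1 = - (plc K w0 N hN0 l1 * s) := by
      have hgp : plc K w0 N hN0 g ≠ 0 := fun h => hg0 (plc_inj K w0 N hN0 (by rw [h, map_zero]))
      apply mul_left_cancel₀ hgp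
      rw [hq1, hl1, map_mul, map_mul] at hs
      linear_combination hs
    have hq := place_concl K w0 N hN0 q1 l1 s hs' hw
    obtain ⟨x, y, hxy⟩ := hcop
    have := congrArg (eval w0) hxy
    simp [hq, hw] at this
  have hl1d : l1.degree = 0 := by
    by_contra h
    obtain ⟨x, hx⟩ := IsAlgClosed.exists_root l1 h
    exact hloc x hx
  have hq0 : q.eval 0 = 0 := by
    rw [hq1, hl1, degree_mul, degree_mul, hl1d, add_zero] at hinf
    by_contra hne
    have hq1' : q1 ≠ 0 := by rintro rfl; exact hne (by rw [hq1, mul_zero])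
    have : 0 ≤ q1.degree := zero_le_degree_iff.2 hq1'
    exact absurd hinf (not_lt.2 (le_add_of_nonneg_right this))
  exact place_zero K a b u v q r ℓ huv hN e1 d1 hℓ hq0 p hp hp0 hp3 ha hb

end

section

open Polynomial Differential

attribute [local instance] diffPoly

theorem unimod_iff {R : Type} [Ring R] {s : ℕ} (u : Fin s → R) :
    IsUnimodularRow u ↔ ∃ b : Fin s → R, ∑ i, u i * b i = 1 := by
  rw [IsUnimodularRow, Submodule.eq_top_iff']
  constructor
  · intro h
    obtain ⟨c, hc⟩ := (Submodule.mem_span_range_iff_exists_fun _).1 (h 1)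
    exact ⟨fun i => (c i).unop, by rw [← hc]; exact Finset.sum_congr rfl fun i _ => rfl⟩
  · rintro ⟨b, hb⟩ x
    rw [Submodule.mem_span_range_iff_exists_fun]
    refine ⟨fun i => MulOpposite.op (b i * x), ?_⟩
    have : x = ∑ i, u i * (b i * x) := by
      calc x = (∑ i, u i * b i) * x := by rw [hb, one_mul]
        _ = _ := by
          rw [Finset.sum_mul]; exact Finset.sum_congr rfl fun i _ => mul_assoc _ _ _
    conv_rhs => rw [this]
    rfl

/-- dominated by the constant term in the `w`-degree -/
def Good {K : Type} [Field K] (f : K[X][X]) (d : ℕ) : Prop :=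
  (f.coeff 0).degree = d ∧ ∀ j, 0 < j → (f.coeff j).degree < d

theorem Good.le {K : Type} [Field K] {f : K[X][X]} {d : ℕ} (h : Good f d) (j : ℕ) : (f.coeff j).degree ≤ d := by
  rcases Nat.eq_zero_or_pos j with rfl | hj
  · exact h.1.le
  · exact (h.2 j hj).le

theorem Good.mul {K : Type} [Field K] {f g : K[X][X]} {d e : ℕ} (hf : Good f d) (hg : Good g e) :
    Good (f * g) (d + e) := by
  constructor
  · rw [mul_coeff_zero, degree_mul, hf.1, hg.1]; norm_cast
  · intro j hj
    rw [coeff_mul]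
    refine (degree_sum_le _ _).trans_lt ?_
    rw [Finset.sup_lt_iff (WithBot.bot_lt_coe _)]
    rintro ⟨i, k⟩ hik
    have hik := Finset.HasAntidiagonal.mem_antidiagonal.1 hik
    dsimp only at hik ⊢
    rw [degree_mul]
    push_cast
    rcases Nat.eq_zero_or_pos i with rfl | hi
    · have hk : 0 < k := by omega
      exact (add_le_add_left (hf.le 0) _).trans_lt (WithBot.add_lt_add_left (WithBot.coe_ne_bot) (hg.2 k hk))
    · exact (add_le_add_right (hg.le k) _).trans_lt (WithBot.add_lt_add_right (WithBot.coe_ne_bot) (hf.2 i hi))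

theorem Good.pow {K : Type} [Field K] {f : K[X][X]} {d : ℕ} (hf : Good f d) (n : ℕ) : Good (f ^ n) (n * d) := by
  induction n with
  | zero =>
    constructor
    · simp
    · intro j hj
      rw [pow_zero, coeff_one, if_neg (by omega), degree_zero]; exact WithBot.bot_lt_coe _
  | succ n ih => rw [pow_succ, Nat.succ_mul]; exact ih.mul hf

theorem Good.add {K : Type} [Field K] {f g : K[X][X]} {d e : ℕ} (hf : Good f d) (hg : Good g e) (h : d < e) :
    Good (f + g) e := by
  have h' : (d : WithBot ℕ) < e := by exact_mod_cast h
  constructor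
  · rw [coeff_add, degree_add_eq_right_of_degree_lt, hg.1]
    rw [hf.1, hg.1]; exact h'
  · intro j hj
    rw [coeff_add]
    exact (degree_add_le _ _).trans_lt (max_lt ((hf.le j).trans_lt h') (hg.2 j hj))

theorem Good.sum {K : Type} [Field K] (s : Finset ℕ) (hs : s.Nonempty) (f : ℕ → K[X][X]) (d : ℕ → ℕ)
    (hd : ∀ i ∈ s, ∀ j ∈ s, d i = d j → i = j) (h : ∀ i ∈ s, Good (f i) (d i)) :
    ∃ i ∈ s, Good (∑ i ∈ s, f i) (d i) := by
  classical
  induction hs using Finset.Nonempty.cons_induction with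
  | singleton a => exact ⟨a, by simp, by simpa using h a (by simp)⟩
  | cons a s ha hs ih =>
    obtain ⟨i, hi, hg⟩ := ih (fun i hi j hj => hd i (by simp [hi]) j (by simp [hj])) (fun i hi => h i (by simp [hi]))
    have hga := h a (by simp)
    rw [Finset.sum_cons]
    rcases lt_trichotomy (d a) (d i) with hlt | heq | hgt
    · exact ⟨i, by simp [hi], hga.add hg hlt⟩
    · exfalso
      have := hd a (by simp) i (by simp [hi]) heq
      exact ha (this ▸ hi)
    · exact ⟨a, by simp, by rw [add_comm]; exact hg.add hga hgt⟩

theorem Good.const {K : Type} [Field K] (c : K) (hc : c ≠ 0) : Good (C (C c) : K[X][X]) 0 := by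
  constructor
  · rw [coeff_C_zero, degree_C hc]; rfl
  · intro j hj
    rw [coeff_C, if_neg (by omega), degree_zero]; exact WithBot.bot_lt_coe _

theorem Good.gen {K : Type} [Field K] (n M : ℕ) (hn : 0 < n) (hM : 0 < M) : Good (X ^ n + C (X ^ M) : K[X][X]) M := by
  constructor
  · rw [coeff_add, coeff_X_pow, if_neg (by omega), coeff_C_zero, zero_add, degree_X_pow]
  · intro j hj
    rw [coeff_add, coeff_C, if_neg (by omega), coeff_X_pow, add_zero]
    split_ifs
    · rw [degree_one]; exact_mod_cast hM
    · rw [degree_zero]; exact WithBot.bot_lt_coe _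

/-- the one-parameter family of cuspidal lines -/
noncomputable def famInner (K : Type) [Field K] : K[X] →+* K[X][X] := eval₂RingHom (C.comp C) (X ^ 2 + C (X ^ 1))
noncomputable def fam (K : Type) [Field K] (M : ℕ) : K[X][X] →+* K[X][X] :=
  eval₂RingHom (famInner K) (X ^ 3 + C (X ^ M))

theorem famInner_good (K : Type) [Field K] (p : K[X]) (hp : p ≠ 0) : ∃ i ≤ p.natDegree, Good (famInner K p) i := by
  obtain ⟨i, hi, h⟩ := Good.sum p.support (nonempty_support_iff.2 hp) (fun i => C (C (p.coeff i)) * (X ^ 2 + C (X ^ 1)) ^ i)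
    (fun i => i) (fun i _ j _ h => h) (by
      intro i hi
      have := (Good.const (p.coeff i) (mem_support_iff.1 hi)).mul ((Good.gen (K := K) 2 1 two_pos one_pos).pow i)
      simpa using this)
  refine ⟨i, le_natDegree_of_mem_supp i hi, ?_⟩
  rw [famInner, coe_eval₂RingHom, eval₂_eq_sum]
  exact h

theorem fam_good (K : Type) [Field K] (P : K[X][X]) (hP : P ≠ 0) :
    ∃ M, 0 < M ∧ ∃ d, Good (fam K M P) d := by
  set M := (P.support.sup fun k => (P.coeff k).natDegree) + 1 with hM
  have hlt : ∀ k ∈ P.support, (P.coeff k).natDegree < M := fun k hk =>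
    Nat.lt_succ_of_le (Finset.le_sup (f := fun k => (P.coeff k).natDegree) hk)
  refine ⟨M, Nat.succ_pos _, ?_⟩
  have h1 : ∀ k, ∃ i, k ∈ P.support → i < M ∧ Good (famInner K (P.coeff k)) i := by
    intro k
    by_cases hk : k ∈ P.support
    · obtain ⟨i, hi, h⟩ := famInner_good K (P.coeff k) (mem_support_iff.1 hk)
      exact ⟨i, fun _ => ⟨hi.trans_lt (hlt k hk), h⟩⟩
    · exact ⟨0, fun h => absurd h hk⟩
  choose i hi using h1
  obtain ⟨k, hk, h⟩ := Good.sum P.support (nonempty_support_iff.2 hP)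
    (fun k => famInner K (P.coeff k) * (X ^ 3 + C (X ^ M)) ^ k) (fun k => i k + k * M) (by
      intro a ha b hb h
      have h1 := (hi a ha).1
      have h2 := (hi b hb).1
      have hMp : 0 < M := Nat.succ_pos _
      have h3 : (i a + a * M) / M = (i b + b * M) / M := by rw [h]
      rw [Nat.add_mul_div_right _ _ hMp, Nat.add_mul_div_right _ _ hMp, Nat.div_eq_of_lt h1, Nat.div_eq_of_lt h2] at h3
      omega) (by
      intro k hk
      exact (hi k hk).2.mul ((Good.gen 3 M (by norm_num) (Nat.succ_pos _)).pow k))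
  refine ⟨i k + k * M, ?_⟩
  rw [fam, coe_eval₂RingHom, eval₂_eq_sum]
  exact h

theorem coeff_one_mul {R : Type} [CommRing R] (f g : R[X]) (hf : f.coeff 1 = 0) (hg : g.coeff 1 = 0) :
    (f * g).coeff 1 = 0 := by
  rw [coeff_mul, Finset.Nat.antidiagonal_succ]; simp [hf, hg]

theorem coeff_one_pow {R : Type} [CommRing R] (f : R[X]) (hf : f.coeff 1 = 0) (n : ℕ) : (f ^ n).coeff 1 = 0 := by
  induction n with
  | zero => simp [coeff_one]
  | succ n ih => rw [pow_succ]; exact coeff_one_mul _ _ ih hf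

theorem fam_coeff_one (K : Type) [Field K] (M : ℕ) (P : K[X][X]) : (fam K M P).coeff 1 = 0 := by
  have h1 : ∀ p : K[X], (famInner K p).coeff 1 = 0 := by
    intro p
    rw [famInner, coe_eval₂RingHom, eval₂_eq_sum, sum_def, finsetSum_coeff]
    refine Finset.sum_eq_zero fun i _ => coeff_one_mul _ _ ?_ (coeff_one_pow _ ?_ _)
    · simp [coeff_C]
    · simp [coeff_C, coeff_X_pow]
  rw [fam, coe_eval₂RingHom, eval₂_eq_sum, sum_def, finsetSum_coeff]
  refine Finset.sum_eq_zero fun i _ => coeff_one_mul _ _ (h1 _) (coeff_one_pow _ ?_ _)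
  rw [coeff_add, coeff_X_pow, coeff_C]; simp

theorem comm_not_stable (K : Type) [Field K] [IsAlgClosed K] [CharZero K] (htr : ∃ x : K, Transcendental ℚ x) :
    ∃ u : Fin 3 → K[X][X], IsUnimodularRow u ∧ ¬ IsStableRow u := by
  obtain ⟨p, hp⟩ := htr
  obtain ⟨δ, hadd, hmul, hδp⟩ := exists_deriv_ne_zero K p hp
  let D : Derivation ℤ K K := Derivation.mk' ((AddMonoidHom.mk' δ hadd).toIntLinearMap) (by
    intro a b; exact hmul a b)
  let _ : Differential K := ⟨D⟩
  have hp' : p′ = 1 := hδp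
  have hp0 : p ≠ 0 := by
    rintro rfl
    rw [map_zero] at hp'
    exact zero_ne_one hp'
  have hp3 : p ^ 3 ≠ 1 := by
    intro h
    have := congrArg (fun x : K => x′) h
    simp only [pow_succ, pow_zero, one_mul, diff_mul, hp', Derivation.map_one_eq_zero] at this
    have h3 : 3 * p ^ 2 = 0 := by linear_combination this
    simp [hp0] at h3
  refine ⟨![C X - C (C p), X + 1, X ^ 2 - C X ^ 3], ?_, ?_⟩
  · rw [unimod_iff]
    set c : K := 1 - p ^ 3 with hc
    have hc0 : c ≠ 0 := by rw [hc, sub_ne_zero]; exact hp3.symm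
    refine ⟨![C (C c⁻¹) * (C X ^ 2 + C (C p) * C X + C (C p) ^ 2), - (C (C c⁻¹) * (X - 1)), C (C c⁻¹)], ?_⟩
    have h1 : (C (C c⁻¹) : K[X][X]) * (1 - C (C p) ^ 3) = 1 := by
      have : (1 - C (C p) ^ 3 : K[X][X]) = C (C c) := by rw [hc]; simp
      rw [this, ← C_mul, ← C_mul, inv_mul_cancel₀ hc0]; simp
    simp [Fin.sum_univ_three]
    linear_combination h1
  · rintro ⟨r, hr⟩
    rw [unimod_iff] at hr
    obtain ⟨e, he⟩ := hr
    rw [Fin.sum_univ_two] at he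
    simp at he
    set P : K[X][X] := C X - C (C p) + (X ^ 2 - C X ^ 3) * r 0 with hP
    set Q : K[X][X] := X + 1 + (X ^ 2 - C X ^ 3) * r 1 with hQ
    have hx : ∀ M, fam K M (C X) = X ^ 2 + C X := fun M => by simp [fam, famInner]
    have hcc : ∀ M c, fam K M (C (C c)) = C (C c) := fun M c => by simp [fam, famInner]
    have hy : ∀ M, fam K M X = X ^ 3 + C (X ^ M) := fun M => by simp [fam]
    have h0 : ∀ M, 0 < M → ∀ s, (fam K M ((X ^ 2 - C X ^ 3) * s)).map (evalRingHom 0) = 0 := by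
      intro M hM s
      rw [map_mul, map_sub, map_pow, map_pow, hx, hy]
      simp [hM.ne']
      left; ring
    have hPM : ∀ M, 0 < M → (fam K M P).map (evalRingHom 0) = X ^ 2 - C p := by
      intro M hM
      rw [hP, map_add, Polynomial.map_add, h0 M hM, map_sub, hx, hcc]
      simp
    have hQM : ∀ M, 0 < M → (fam K M Q).map (evalRingHom 0) = X ^ 3 + 1 := by
      intro M hM
      rw [hQ, map_add, Polynomial.map_add, h0 M hM, map_add, hy]
      simp [hM.ne']
    have hPne : P ≠ 0 := by
      intro h
      have := hPM 1 one_pos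
      rw [h] at this
      have := congrArg natDegree this
      rw [natDegree_X_pow_sub_C] at this
      simp at this
    obtain ⟨M, hM, d, hd⟩ := fam_good K P hPne
    refine family_false K (fam K M P) (fam K M Q) (fam K M (e 0)) (fam K M (e 1)) ?_ (fam_coeff_one K M P)
      (fam_coeff_one K M Q) ?_ p hp' hp0 hp3 (hPM M hM) (hQM M hM)
    · have := congrArg (fam K M) he
      rw [map_add, map_mul, map_mul, map_one] at this
      rw [mul_comm, mul_comm (fam K M (e 1))]
      exact this
    · intro j hj
      rw [hd.1]; exact hd.2 j hj

end

section

open Polynomial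

/-- every row of length 3 in `A` stable implies the same in a quotient -/
theorem stable_of_surj {R S : Type} [Ring R] [Ring S] (f : R →+* S) (hf : Function.Surjective f)
    (h : ∀ u : Fin 3 → R, IsUnimodularRow u → IsStableRow u) :
    ∀ u : Fin 3 → S, IsUnimodularRow u → IsStableRow u := by
  intro u hu
  rw [unimod_iff] at hu
  obtain ⟨b, hb⟩ := hu
  choose a ha using fun i => hf (u i)
  choose c hc using fun i => hf (b i)
  rw [Fin.sum_univ_three] at hb
  set d := 1 - (a 0 * c 0 + a 1 * c 1 + a 2 * c 2) with hd
  have hd0 : f d = 0 := by rw [hd]; simp [ha, hc, hb]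
  obtain ⟨r, hr⟩ := h ![a 0, a 1, a 2 * c 2 + d] (by
    rw [unimod_iff]
    refine ⟨![c 0, c 1, 1], ?_⟩
    rw [Fin.sum_univ_three]
    simp [hd]
    abel)
  rw [unimod_iff] at hr
  obtain ⟨e, he⟩ := hr
  refine ⟨fun i => b 2 * f (r i), ?_⟩
  rw [unimod_iff]
  refine ⟨fun i => f (e i), ?_⟩
  have := congrArg f he
  rw [Fin.sum_univ_two] at this ⊢
  simp [ha, hc, hd0] at this
  simp [← mul_assoc]
  exact this

theorem two_of_one {R : Type} [Ring R] (h : ∀ u : Fin 2 → R, IsUnimodularRow u → IsStableRow u) :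
    ∀ u : Fin 3 → R, IsUnimodularRow u → IsStableRow u := by
  intro u hu
  rw [unimod_iff] at hu
  obtain ⟨b, hb⟩ := hu
  rw [Fin.sum_univ_three] at hb
  obtain ⟨r, hr⟩ := h ![u 0, u 1 * b 1 + u 2 * b 2] (by
    rw [unimod_iff]
    refine ⟨![b 0, 1], ?_⟩
    rw [Fin.sum_univ_two]
    simp [← add_assoc, hb])
  rw [unimod_iff] at hr
  obtain ⟨e, he⟩ := hr
  simp at he
  refine ⟨![b 2 * r 0, 0], ?_⟩
  rw [unimod_iff]
  refine ⟨![e 0, b 1 * r 0 * e 0], ?_⟩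
  rw [Fin.sum_univ_two]
  simp
  rw [← he]; noncomm_ring

theorem not_zero {R : Type} [Ring R] [Nontrivial R] : ¬ ∀ u : Fin 1 → R, IsUnimodularRow u → IsStableRow u := by
  intro h
  obtain ⟨r, hr⟩ := h ![1] (by rw [unimod_iff]; exact ⟨![1], by simp⟩)
  rw [unimod_iff] at hr
  obtain ⟨b, hb⟩ := hr
  simp at hb

/-- the commutative quotient -/
noncomputable def piC (K : Type) [Field K] (a b : K) (h1 : a + b = 1) : DownUp K a b 0 →ₐ[K] K[X][X] :=
  RingQuot.liftAlgHom K ⟨FreeAlgebra.lift K ![C X, X], by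
    intro x y hxy
    have h2 : (C (C a) + C (C b) : K[X][X]) = 1 := by rw [← C_add, ← C_add, h1]; simp
    cases hxy
    all_goals
      simp [Algebra.smul_def, Polynomial.algebraMap_apply]
    · linear_combination (-C X * X * X) * h2
    · linear_combination (-C X * C X * X) * h2⟩

theorem piC_D (K : Type) [Field K] (a b : K) (h1 : a + b = 1) : piC K a b h1 (DownUp.D K a b 0) = C X := by
  simp [piC, DownUp.D]

theorem piC_U (K : Type) [Field K] (a b : K) (h1 : a + b = 1) : piC K a b h1 (DownUp.U K a b 0) = X := by
  simp [piC, DownUp.U]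

theorem piC_surj (K : Type) [Field K] (a b : K) (h1 : a + b = 1) : Function.Surjective (piC K a b h1) := by
  intro f
  induction f using Polynomial.induction_on' with
  | add p q hp hq =>
    obtain ⟨x, rfl⟩ := hp
    obtain ⟨y, rfl⟩ := hq
    exact ⟨x + y, map_add _ _ _⟩
  | monomial n p =>
    induction p using Polynomial.induction_on' with
    | add p q hp hq =>
      obtain ⟨x, hx⟩ := hp
      obtain ⟨y, hy⟩ := hq
      exact ⟨x + y, by rw [map_add, hx, hy, ← map_add]⟩
    | monomial m c =>
      refine ⟨c • (DownUp.D K a b 0 ^ m * DownUp.U K a b 0 ^ n), ?_⟩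
      rw [map_smul, map_mul, map_pow, map_pow, piC_D, piC_U]
      rw [← C_mul_X_pow_eq_monomial, ← C_mul_X_pow_eq_monomial]
      simp [Algebra.smul_def, Polynomial.algebraMap_apply, mul_assoc]

theorem stableRank_eq_of (K : Type) [Field K] [IsAlgClosed K] [CharZero K] (a b : K)
    (h1 : a + b = 1) (htr : ∃ x : K, Transcendental ℚ x)
    (hup : ∀ u : Fin 4 → DownUp K a b 0, IsUnimodularRow u → IsStableRow u) :
    stableRank (DownUp K a b 0) = 3 := by
  have hnt : Nontrivial (DownUp K a b 0) := (piC K a b h1).toRingHom.domain_nontrivial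
  have h2 : ¬ ∀ u : Fin 3 → DownUp K a b 0, IsUnimodularRow u → IsStableRow u := by
    intro h
    obtain ⟨u, hu, hn⟩ := comm_not_stable K htr
    exact hn (stable_of_surj (piC K a b h1).toRingHom (piC_surj K a b h1) h u hu)
  refine le_antisymm (Nat.sInf_le hup) (le_csInf ⟨3, hup⟩ ?_)
  intro t ht
  by_contra hlt
  have : t = 0 ∨ t = 1 ∨ t = 2 := by omega
  rcases this with rfl | rfl | rfl
  · exact not_zero ht
  · exact h2 (two_of_one ht)
  · exact h2 ht

end

section

open Polynomial

/-- `q`-Weyl algebra data: `D U = μ U D + c`, with PBW basis `U^i D^j`. -/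
structure QW (F R : Type) [Field F] [Ring R] [Algebra F R] where
  U : R
  D : R
  μ : F
  c : F
  rel : D * U = μ • (U * D) + c • (1 : R)
  B : Module.Basis (ℕ × ℕ) F R
  hB : ∀ i j, B (i, j) = U ^ i * D ^ j
  hμ : μ ≠ 0
  hq : ∀ i, 0 < i → (∑ k ∈ Finset.range i, μ ^ k) ≠ 0
  hcase : (μ = 1 ∧ c ≠ 0) ∨ (∀ n, 0 < n → μ ^ n ≠ 1)

namespace QW
variable {F R : Type} [Field F] [Ring R] [Algebra F R] (H : QW F R)

def q (i : ℕ) : F := ∑ k ∈ Finset.range i, H.μ ^ k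

theorem q_succ (i : ℕ) : H.q (i + 1) = H.q i + H.μ ^ i := by rw [q, Finset.sum_range_succ]; rfl
@[simp] theorem q_zero : H.q 0 = 0 := by simp [q]

theorem D_U_pow (i : ℕ) : H.D * H.U ^ i = H.μ ^ i • (H.U ^ i * H.D) + (H.q i * H.c) • H.U ^ (i - 1) := by
  induction i with
  | zero => simp
  | succ i ih =>
    rw [pow_succ, ← mul_assoc, ih, add_mul, smul_mul_assoc, mul_assoc, H.rel]
    rcases i with _ | i
    · simp [q]
    · simp only [Nat.add_sub_cancel, smul_mul_assoc, mul_add, mul_smul_comm, smul_add, ← pow_succ, mul_one, smul_smul]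
      rw [← mul_assoc, ← pow_succ, H.q_succ (i + 1), add_assoc, ← add_smul]
      congr 2; ring

theorem D_pow_U (j : ℕ) : H.D ^ j * H.U = H.μ ^ j • (H.U * H.D ^ j) + (H.q j * H.c) • H.D ^ (j - 1) := by
  induction j with
  | zero => simp
  | succ i ih =>
    rw [pow_succ', mul_assoc, ih, mul_add, mul_smul_comm, ← mul_assoc, H.rel]
    rcases i with _ | i
    · simp [q]
    · simp only [Nat.add_sub_cancel, smul_mul_assoc, add_mul, mul_smul_comm, smul_add, one_mul, smul_smul]
      rw [mul_assoc, ← pow_succ', ← pow_succ', H.q_succ (i + 1), add_assoc, ← add_smul, ← pow_succ]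
      congr 2; ring

def om : R := H.D * H.U - H.U * H.D

theorem om_eq : H.om = (H.μ - 1) • (H.U * H.D) + H.c • (1 : R) := by
  rw [om, H.rel, sub_smul, one_smul]; abel

theorem om_U : H.om * H.U = H.μ • (H.U * H.om) := by
  rw [om_eq, add_mul, smul_mul_assoc, mul_assoc, H.rel]
  simp only [mul_add, smul_add, mul_smul_comm, smul_smul, smul_mul_assoc, one_mul, mul_one, ← mul_assoc]
  rw [add_assoc, ← add_smul, mul_comm]; congr 2; ring

theorem D_om : H.D * H.om = H.μ • (H.om * H.D) := by
  rw [om_eq, mul_add, mul_smul_comm, ← mul_assoc, H.rel]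
  simp only [add_mul, smul_add, mul_smul_comm, smul_smul, smul_mul_assoc, one_mul, mul_one]
  rw [add_assoc, ← add_smul, mul_comm]; congr 2; ring

theorem D_pow_om (i : ℕ) : H.D ^ i * H.om = H.μ ^ i • (H.om * H.D ^ i) := by
  induction i with
  | zero => simp
  | succ i ih => rw [pow_succ', mul_assoc, ih, mul_smul_comm, ← mul_assoc, D_om, smul_mul_assoc, smul_smul, mul_assoc, pow_succ]

theorem om_U_pow (i : ℕ) : H.om * H.U ^ i = H.μ ^ i • (H.U ^ i * H.om) := by
  induction i with
  | zero => simp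
  | succ i ih => rw [pow_succ, ← mul_assoc, ih, smul_mul_assoc, mul_assoc, om_U, mul_smul_comm, smul_smul, mul_assoc, pow_succ]

theorem span_B : Submodule.span F (Set.range H.B) = ⊤ := H.B.span_eq

/-- induction principle -/
theorem ind {P : R → Prop} (h0 : ∀ i j, P (H.U ^ i * H.D ^ j)) (hadd : ∀ x y, P x → P y → P (x + y))
    (hz : P 0) (hs : ∀ (a : F) x, P x → P (a • x)) (x : R) : P x := by
  have : x ∈ Submodule.span F (Set.range H.B) := by rw [span_B]; trivial
  induction this using Submodule.span_induction with
  | mem x h => obtain ⟨⟨i, j⟩, rfl⟩ := h; rw [H.hB]; exact h0 i j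
  | zero => exact hz
  | add x y _ _ hx hy => exact hadd x y hx hy
  | smul a x _ hx => exact hs a x hx

theorem normal_left (x : R) : ∃ y, H.om * x = y * H.om := by
  refine H.ind (P := fun x => ∃ y, H.om * x = y * H.om) ?_ ?_ ?_ ?_ x
  · intro i j
    refine ⟨(H.μ ^ i * (H.μ ^ j)⁻¹) • (H.U ^ i * H.D ^ j), ?_⟩
    rw [← mul_assoc, om_U_pow, smul_mul_assoc, smul_mul_assoc, mul_assoc, mul_assoc, D_pow_om, mul_smul_comm, smul_smul]
    congr 1
    field_simp [H.hμ]
  · rintro x y ⟨a, ha⟩ ⟨b, hb⟩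
    exact ⟨a + b, by rw [mul_add, add_mul, ha, hb]⟩
  · exact ⟨0, by simp⟩
  · rintro a x ⟨b, hb⟩
    exact ⟨a • b, by rw [mul_smul_comm, hb, smul_mul_assoc]⟩

theorem normal_right (x : R) : ∃ y, x * H.om = H.om * y := by
  refine H.ind (P := fun x => ∃ y, x * H.om = H.om * y) ?_ ?_ ?_ ?_ x
  · intro i j
    refine ⟨((H.μ ^ i)⁻¹ * H.μ ^ j) • (H.U ^ i * H.D ^ j), ?_⟩
    rw [mul_smul_comm, ← mul_assoc, om_U_pow, smul_mul_assoc, mul_assoc, mul_assoc, D_pow_om, mul_smul_comm, smul_smul]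
    congr 1
    field_simp [H.hμ]
  · rintro x y ⟨a, ha⟩ ⟨b, hb⟩
    exact ⟨a + b, by rw [add_mul, mul_add, ha, hb]⟩
  · exact ⟨0, by simp⟩
  · rintro a x ⟨b, hb⟩
    exact ⟨a • b, by rw [smul_mul_assoc, hb, mul_smul_comm]⟩

/-- filtration by D-degree (strict) -/
def L (n : ℕ) : Submodule F R := Submodule.span F (H.B '' {p | p.2 < n})

theorem mem_L (i j n : ℕ) (h : j < n) : H.U ^ i * H.D ^ j ∈ H.L n := by
  rw [← H.hB]; exact Submodule.subset_span ⟨_, h, rfl⟩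

theorem L_ind {n : ℕ} {S : Submodule F R} (f : R →ₗ[F] R) (h : ∀ i j, j < n → f (H.U ^ i * H.D ^ j) ∈ S) :
    ∀ x ∈ H.L n, f x ∈ S := by
  intro x hx
  have : H.L n ≤ S.comap f := by
    rw [L, Submodule.span_le]
    rintro _ ⟨⟨i, j⟩, hij, rfl⟩
    rw [H.hB]; exact h i j hij
  exact this hx

theorem top_DU (j k : ℕ) : H.D ^ j * H.U ^ k - H.μ ^ (j * k) • (H.U ^ k * H.D ^ j) ∈ H.L j := by
  induction j with
  | zero => simp
  | succ j ih =>
    have h1 := H.L_ind (S := H.L (j + 1)) (LinearMap.mulLeft F H.D) (by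
      intro a b hb
      rw [LinearMap.mulLeft_apply, ← mul_assoc, D_U_pow, add_mul, smul_mul_assoc, smul_mul_assoc, mul_assoc, ← pow_succ']
      exact add_mem (Submodule.smul_mem _ _ (H.mem_L _ _ _ (by omega))) (Submodule.smul_mem _ _ (H.mem_L _ _ _ (by omega)))) _ ih
    rw [LinearMap.mulLeft_apply, mul_sub, ← mul_assoc, ← pow_succ', mul_smul_comm, ← mul_assoc, D_U_pow, add_mul, smul_add,
      smul_mul_assoc, smul_mul_assoc, mul_assoc, ← pow_succ', smul_smul, ← pow_add] at h1
    have h2 : H.μ ^ (j * k) • (H.q k * H.c) • (H.U ^ (k - 1) * H.D ^ j) ∈ H.L (j + 1) :=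
      Submodule.smul_mem _ _ (Submodule.smul_mem _ _ (H.mem_L _ _ _ (by omega)))
    have := add_mem h1 h2
    rw [sub_add_eq_sub_sub, sub_add_cancel] at this
    rw [Nat.succ_mul]; exact this

theorem top_mul (i j k l : ℕ) : H.U ^ i * H.D ^ j * (H.U ^ k * H.D ^ l)
    - H.μ ^ (j * k) • (H.U ^ (i + k) * H.D ^ (j + l)) ∈ H.L (j + l) := by
  have h1 := H.L_ind (S := H.L (j + l)) ((LinearMap.mulLeft F (H.U ^ i)).comp (LinearMap.mulRight F (H.D ^ l))) (by
      intro a b hb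
      simp only [LinearMap.comp_apply, LinearMap.mulLeft_apply, LinearMap.mulRight_apply]
      rw [mul_assoc, ← mul_assoc, ← pow_add, ← pow_add]
      exact H.mem_L _ _ _ (by omega)) _ (H.top_DU j k)
  simp only [LinearMap.comp_apply, LinearMap.mulLeft_apply, LinearMap.mulRight_apply] at h1
  convert h1 using 1
  rw [pow_add, pow_add]
  simp only [sub_mul, mul_sub, mul_smul_comm, smul_mul_assoc, mul_assoc]

theorem coeff_L {n : ℕ} {x : R} (hx : x ∈ H.L n) (a b : ℕ) (hb : n ≤ b) : H.B.repr x (a, b) = 0 := by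
  have : H.L n ≤ LinearMap.ker (Finsupp.lapply (a, b) ∘ₗ (H.B.repr : R →ₗ[F] ((ℕ × ℕ) →₀ F))) := by
    rw [L, Submodule.span_le]
    rintro _ ⟨⟨i, j⟩, hij, rfl⟩
    simp only [Set.mem_ofPred_eq] at hij
    simp [Finsupp.single_apply]
    intro _ _; omega
  exact this hx

theorem coeff_mul (i j k l a b : ℕ) (hb : j + l ≤ b) :
    H.B.repr (H.B (i, j) * H.B (k, l)) (a, b) = if a = i + k ∧ b = j + l then H.μ ^ (j * k) else 0 := by
  have h := H.coeff_L (H.top_mul i j k l) a b hb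
  rw [← H.hB, ← H.hB, ← H.hB, map_sub, map_smul, H.B.repr_self, Finsupp.sub_apply, sub_eq_zero] at h
  rw [h, Finsupp.smul_apply, Finsupp.single_apply]
  simp only [Prod.mk.injEq, smul_eq_mul, mul_ite, mul_one, mul_zero]
  congr 1; simp [eq_comm]

theorem exists_top (x : R) (hx : x ≠ 0) : ∃ M N, H.B.repr x (M, N) ≠ 0 ∧
    ∀ i j, H.B.repr x (i, j) ≠ 0 → j < N ∨ (j = N ∧ i ≤ M) := by
  have hs : (H.B.repr x).support.Nonempty := by
    rw [Finsupp.support_nonempty_iff]; simpa using hx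
  obtain ⟨⟨M, N⟩, hm, hmax⟩ := Finset.exists_max_image _ (fun p : ℕ × ℕ => toLex (p.2, p.1)) hs
  refine ⟨M, N, Finsupp.mem_support_iff.1 hm, fun i j hij => ?_⟩
  have := hmax (i, j) (Finsupp.mem_support_iff.2 hij)
  rw [Prod.Lex.le_iff] at this
  exact this

theorem mul_ne_zero' (H : QW F R) (x y : R) (hx : x ≠ 0) (hy : y ≠ 0) : x * y ≠ 0 := by
  obtain ⟨M, N, h1, h2⟩ := H.exists_top x hx
  obtain ⟨M', N', h1', h2'⟩ := H.exists_top y hy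
  intro h
  have key : H.B.repr (x * y) (M + M', N + N') = H.B.repr x (M, N) * H.B.repr y (M', N') * H.μ ^ (N * M') := by
    conv_lhs => rw [← H.B.linearCombination_repr x, ← H.B.linearCombination_repr y]
    rw [Finsupp.linearCombination_apply, Finsupp.linearCombination_apply, Finsupp.sum, Finsupp.sum, Finset.sum_mul_sum]
    simp only [map_sum, Finsupp.coe_finsetSum, Finset.sum_apply, smul_mul_smul_comm, map_smul, Finsupp.smul_apply]
    rw [Finset.sum_eq_single (M, N), Finset.sum_eq_single (M', N')]
    · rw [coeff_mul _ _ _ _ _ _ _ le_rfl]; simp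
    · rintro ⟨k, l⟩ hkl hne
      rcases h2' k l (Finsupp.mem_support_iff.1 hkl) with h | ⟨rfl, h⟩
      · rw [coeff_mul _ _ _ _ _ _ _ (by omega), if_neg (by omega), smul_zero]
      · have : k ≠ M' := fun h => hne (by rw [h])
        rw [coeff_mul _ _ _ _ _ _ _ (by omega), if_neg (by omega), smul_zero]
    · intro h; rw [Finsupp.notMem_support_iff.1 h]; simp
    · rintro ⟨i, j⟩ hij hne
      refine Finset.sum_eq_zero ?_
      rintro ⟨k, l⟩ hkl
      have a1 := h2 i j (Finsupp.mem_support_iff.1 hij)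
      have a2 := h2' k l (Finsupp.mem_support_iff.1 hkl)
      have a3 : ¬ (i = M ∧ j = N) := by rintro ⟨rfl, rfl⟩; exact hne rfl
      rw [coeff_mul _ _ _ _ _ _ _ (by omega), if_neg (by omega), smul_zero]
    · intro h; rw [Finsupp.notMem_support_iff.1 h]; simp
  rw [h, map_zero, Finsupp.zero_apply] at key
  exact mul_ne_zero (mul_ne_zero h1 h1') (pow_ne_zero _ H.hμ) key.symm

end QW

end

section

open Polynomial

namespace QW
variable {F R : Type} [Field F] [Ring R] [Algebra F R] (H : QW F R)

/-- right ideals -/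
def IsR (I : Submodule F R) : Prop := ∀ x ∈ I, ∀ r, x * r ∈ I

/-- saturation with respect to `ω` -/
def sat (I : Submodule F R) : Submodule F R where
  carrier := {x | ∃ k, ∀ l, k ≤ l → x * H.om ^ l ∈ I}
  add_mem' := by
    rintro x y ⟨k, hk⟩ ⟨k', hk'⟩
    refine ⟨max k k', fun l hl => ?_⟩
    rw [add_mul]
    exact add_mem (hk l ((le_max_left _ _).trans hl)) (hk' l ((le_max_right _ _).trans hl))
  zero_mem' := ⟨0, fun l _ => by rw [zero_mul]; exact zero_mem _⟩
  smul_mem' := by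
    rintro a x ⟨k, hk⟩
    exact ⟨k, fun l hl => by rw [smul_mul_assoc]; exact Submodule.smul_mem _ _ (hk l hl)⟩

theorem mem_sat {I : Submodule F R} (hI : IsR I) (x : R) : x ∈ H.sat I ↔ ∃ k, x * H.om ^ k ∈ I := by
  constructor
  · rintro ⟨k, hk⟩; exact ⟨k, hk k le_rfl⟩
  · rintro ⟨k, hk⟩
    refine ⟨k, fun l hl => ?_⟩
    obtain ⟨m, rfl⟩ := Nat.exists_eq_add_of_le hl
    rw [pow_add, ← mul_assoc]; exact hI _ hk _

theorem normal_right_pow (k : ℕ) (x : R) : ∃ y, x * H.om ^ k = H.om ^ k * y := by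
  induction k generalizing x with
  | zero => exact ⟨x, by simp⟩
  | succ k ih =>
    obtain ⟨y, hy⟩ := ih x
    obtain ⟨w, hw⟩ := H.normal_right y
    exact ⟨w, by rw [pow_succ, ← mul_assoc, hy, mul_assoc, hw, mul_assoc]⟩

theorem le_sat {I : Submodule F R} (hI : IsR I) : I ≤ H.sat I := fun x hx => ⟨0, fun l _ => hI x hx _⟩

theorem sat_isR {I : Submodule F R} (hI : IsR I) : IsR (H.sat I) := by
  intro x hx r
  rw [mem_sat _ hI] at hx ⊢
  obtain ⟨k, hk⟩ := hx
  obtain ⟨y, hy⟩ := H.normal_right_pow k r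
  exact ⟨k, by rw [mul_assoc, hy, ← mul_assoc]; exact hI _ hk _⟩

def IsSat (I : Submodule F R) : Prop := ∀ x, x * H.om ∈ I → x ∈ I

theorem IsSat.pow {I : Submodule F R} (hI : H.IsSat I) (x : R) (k : ℕ) (h : x * H.om ^ k ∈ I) : x ∈ I := by
  induction k with
  | zero => simpa using h
  | succ k ih => rw [pow_succ, ← mul_assoc] at h; exact ih (hI _ h)

theorem sat_isSat {I : Submodule F R} (hI : IsR I) : H.IsSat (H.sat I) := by
  intro x hx
  rw [mem_sat _ hI] at hx ⊢
  obtain ⟨k, hk⟩ := hx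
  exact ⟨k + 1, by rw [pow_succ', ← mul_assoc]; exact hk⟩

theorem sat_le {I W : Submodule F R} (hI : IsR I) (hW : H.IsSat W) (h : I ≤ W) : H.sat I ≤ W := by
  intro x hx
  rw [mem_sat _ hI] at hx
  obtain ⟨k, hk⟩ := hx
  exact hW.pow H x k (h hk)

theorem coeff_comm_D (h1 : H.μ = 1) (x : R) (i j : ℕ) :
    H.B.repr (H.D * x - x * H.D) (i, j) = H.q (i + 1) * H.c * H.B.repr x (i + 1, j) := by
  refine H.ind (P := fun x => H.B.repr (H.D * x - x * H.D) (i, j) = H.q (i + 1) * H.c * H.B.repr x (i + 1, j)) ?_ ?_ ?_ ?_ x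
  · intro a b
    rw [← mul_assoc, D_U_pow, h1, one_pow, one_smul, add_mul, mul_assoc, mul_assoc, ← pow_succ', ← pow_succ, add_sub_cancel_left,
      smul_mul_assoc, ← H.hB, ← H.hB, map_smul, H.B.repr_self, H.B.repr_self, Finsupp.smul_apply, Finsupp.single_apply, Finsupp.single_apply]
    rcases a with _ | a
    · simp
    · simp only [Nat.add_sub_cancel, Prod.mk.injEq, Nat.add_right_cancel_iff, smul_eq_mul]
      split_ifs with h
      · rw [h.1]
      · simp
  · intro x y hx hy
    rw [mul_add, add_mul, add_sub_add_comm, map_add, Finsupp.add_apply, hx, hy, map_add, Finsupp.add_apply]; ring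
  · simp
  · intro a x hx
    rw [mul_smul_comm, smul_mul_assoc, ← smul_sub, map_smul, Finsupp.smul_apply, hx, map_smul, Finsupp.smul_apply]
    simp only [smul_eq_mul]; ring

theorem coeff_comm_U (h1 : H.μ = 1) (x : R) (i j : ℕ) :
    H.B.repr (x * H.U - H.U * x) (i, j) = H.q (j + 1) * H.c * H.B.repr x (i, j + 1) := by
  refine H.ind (P := fun x => H.B.repr (x * H.U - H.U * x) (i, j) = H.q (j + 1) * H.c * H.B.repr x (i, j + 1)) ?_ ?_ ?_ ?_ x
  · intro a b
    rw [mul_assoc, D_pow_U, h1, one_pow, one_smul, mul_add, ← mul_assoc, ← mul_assoc, ← pow_succ', ← pow_succ, add_sub_cancel_left,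
      mul_smul_comm, ← H.hB, ← H.hB, map_smul, H.B.repr_self, H.B.repr_self, Finsupp.smul_apply, Finsupp.single_apply, Finsupp.single_apply]
    rcases b with _ | b
    · simp
    · simp only [Nat.add_sub_cancel, Prod.mk.injEq, Nat.add_right_cancel_iff, smul_eq_mul]
      split_ifs with h
      · rw [h.2]
      · simp
  · intro x y hx hy
    rw [mul_add, add_mul, add_sub_add_comm, map_add, Finsupp.add_apply, hx, hy, map_add, Finsupp.add_apply]; ring
  · simp
  · intro a x hx
    rw [mul_smul_comm, smul_mul_assoc, ← smul_sub, map_smul, Finsupp.smul_apply, hx, map_smul, Finsupp.smul_apply]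
    simp only [smul_eq_mul]; ring

theorem eq_const (x : R) (h : ∀ i j, (i, j) ≠ (0, 0) → H.B.repr x (i, j) = 0) : x = H.B.repr x (0, 0) • (1 : R) := by
  apply H.B.repr.injective
  have : (1 : R) = H.B (0, 0) := by rw [H.hB]; simp
  rw [map_smul, this, H.B.repr_self]
  ext ⟨i, j⟩
  by_cases hij : (i, j) = (0, 0)
  · rw [hij]; simp
  · rw [h i j hij, Finsupp.smul_apply, Finsupp.single_apply, if_neg (Ne.symm hij), smul_zero]

theorem weyl_simple (h1 : H.μ = 1) (hc : H.c ≠ 0) (J : Submodule F R) (hl : ∀ x ∈ J, ∀ r, r * x ∈ J) (hr : IsR J) (N : ℕ) :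
    ∀ x ∈ J, x ≠ 0 → (∀ i j, H.B.repr x (i, j) ≠ 0 → i + j ≤ N) → (1 : R) ∈ J := by
  induction N with
  | zero =>
    intro x hx hx0 h
    have := H.eq_const x (fun i j hij => by
      by_contra hne
      have := h i j hne
      exact hij (by ext <;> simp <;> omega))
    have hne : H.B.repr x (0, 0) ≠ 0 := fun h0 => hx0 (by rw [this, h0, zero_smul])
    rw [this] at hx
    exact (Submodule.smul_mem_iff _ hne).1 hx
  | succ N ih =>
    intro x hx hx0 h
    have hq : ∀ i, H.q (i + 1) ≠ 0 := fun i => H.hq (i + 1) (Nat.succ_pos _)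
    by_cases ha : ∃ i j, H.B.repr x (i + 1, j) ≠ 0
    · obtain ⟨i, j, hij⟩ := ha
      refine ih (H.D * x - x * H.D) (sub_mem (hl _ hx _) (hr _ hx _)) ?_ ?_
      · intro h0
        have := H.coeff_comm_D h1 x i j
        rw [h0, map_zero, Finsupp.zero_apply] at this
        exact mul_ne_zero (mul_ne_zero (hq i) hc) hij this.symm
      · intro a b hab
        rw [coeff_comm_D _ h1] at hab
        have := h _ _ (right_ne_zero_of_mul hab)
        omega
    by_cases hb : ∃ i j, H.B.repr x (i, j + 1) ≠ 0
    · obtain ⟨i, j, hij⟩ := hb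
      refine ih (x * H.U - H.U * x) (sub_mem (hr _ hx _) (hl _ hx _)) ?_ ?_
      · intro h0
        have := H.coeff_comm_U h1 x i j
        rw [h0, map_zero, Finsupp.zero_apply] at this
        exact mul_ne_zero (mul_ne_zero (hq j) hc) hij this.symm
      · intro a b hab
        rw [coeff_comm_U _ h1] at hab
        have := h _ _ (right_ne_zero_of_mul hab)
        omega
    push Not at ha hb
    have := H.eq_const x (fun i j hij => by
      rcases i with _ | i
      · rcases j with _ | j
        · exact absurd rfl hij
        · exact hb _ _
      · exact ha _ _)
    have hne : H.B.repr x (0, 0) ≠ 0 := fun h0 => hx0 (by rw [this, h0, zero_smul])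
    rw [this] at hx
    exact (Submodule.smul_mem_iff _ hne).1 hx

end QW

end

section

open Polynomial

namespace QW
variable {F R : Type} [Field F] [Ring R] [Algebra F R] (H : QW F R)

def fac (p : ℕ × ℕ) : F := H.μ ^ p.1 * (H.μ ^ p.2)⁻¹

/-- the automorphism `x ↦ ω x ω⁻¹` (as a linear map) -/
noncomputable def sg : R →ₗ[F] R := H.B.constr F (fun p => H.fac p • H.B p)

theorem sg_B (p : ℕ × ℕ) : H.sg (H.B p) = H.fac p • H.B p := by rw [sg, H.B.constr_basis]

theorem om_mul (x : R) : H.om * x = H.sg x * H.om := by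
  refine H.ind (P := fun x => H.om * x = H.sg x * H.om) ?_ ?_ ?_ ?_ x
  · intro i j
    rw [← H.hB, sg_B, H.hB, ← mul_assoc, om_U_pow, smul_mul_assoc, smul_mul_assoc, mul_assoc, mul_assoc, D_pow_om, mul_smul_comm, smul_smul]
    congr 1
    rw [fac]
    field_simp [H.hμ]
  · intro x y hx hy; rw [mul_add, hx, hy, map_add, add_mul]
  · simp
  · intro a x hx; rw [mul_smul_comm, hx, map_smul, smul_mul_assoc]

theorem repr_sg (x : R) (p : ℕ × ℕ) : H.B.repr (H.sg x) p = H.fac p * H.B.repr x p := by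
  refine H.ind (P := fun x => H.B.repr (H.sg x) p = H.fac p * H.B.repr x p) ?_ ?_ ?_ ?_ x
  · intro i j
    rw [← H.hB, sg_B, map_smul, H.B.repr_self, Finsupp.smul_apply, Finsupp.single_apply, smul_eq_mul]
    split_ifs with h
    · rw [h]
    · simp
  · intro x y hx hy; rw [map_add, map_add, Finsupp.add_apply, hx, hy, map_add, Finsupp.add_apply, mul_add]
  · simp
  · intro a x hx; rw [map_smul, map_smul, Finsupp.smul_apply, hx, map_smul, Finsupp.smul_apply]; simp only [smul_eq_mul]; ring

theorem exists_homog (J : Submodule F R) (hJ : ∀ x ∈ J, H.sg x ∈ J) (n : ℕ) :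
    ∀ x ∈ J, x ≠ 0 → (H.B.repr x).support.card ≤ n → ∃ h ∈ J, h ≠ 0 ∧ ∃ p, H.sg h = H.fac p • h := by
  classical
  induction n with
  | zero =>
    intro x _ hx0 h
    have : H.B.repr x = 0 := by simpa using h
    exact absurd (by simpa using this) hx0
  | succ n ih =>
    intro x hx hx0 hn
    have hs : (H.B.repr x).support.Nonempty := by
      rw [Finsupp.support_nonempty_iff]; simpa using hx0
    obtain ⟨p, hp⟩ := hs
    by_cases hall : H.sg x = H.fac p • x
    · exact ⟨x, hx, hx0, p, hall⟩
    refine ih (H.sg x - H.fac p • x) (sub_mem (hJ _ hx) (Submodule.smul_mem _ _ hx)) (sub_ne_zero.2 hall) ?_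
    have hsub : (H.B.repr (H.sg x - H.fac p • x)).support ⊆ (H.B.repr x).support.erase p := by
      intro r hr
      rw [Finsupp.mem_support_iff, map_sub, map_smul, Finsupp.sub_apply, Finsupp.smul_apply, repr_sg, smul_eq_mul, ← sub_mul] at hr
      rw [Finset.mem_erase, Finsupp.mem_support_iff]
      refine ⟨?_, right_ne_zero_of_mul hr⟩
      rintro rfl
      simp at hr
    have := Finset.card_le_card hsub
    rw [Finset.card_erase_of_mem hp] at this
    omega

theorem U_aeval (p : F[X]) : H.U * aeval H.om p = aeval H.om (p.comp (C H.μ⁻¹ * X)) * H.U := by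
  have h1 : H.U * H.om = H.μ⁻¹ • (H.om * H.U) := by rw [om_U, smul_smul, inv_mul_cancel₀ H.hμ, one_smul]
  have h2 : ∀ n, H.U * H.om ^ n = (H.μ⁻¹ ^ n) • (H.om ^ n * H.U) := by
    intro n
    induction n with
    | zero => simp
    | succ n ih => rw [pow_succ, ← mul_assoc, ih, smul_mul_assoc, mul_assoc, h1, mul_smul_comm, smul_smul, mul_assoc, pow_succ]
  induction p using Polynomial.induction_on' with
  | add p q hp hq => rw [map_add, mul_add, hp, hq, add_comp, map_add, add_mul]
  | monomial n a =>
    rw [← C_mul_X_pow_eq_monomial]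
    simp only [map_mul, aeval_C, map_pow, aeval_X, mul_comp, C_comp, X_pow_comp, mul_pow]
    rw [← Algebra.smul_def, mul_smul_comm, h2, ← Algebra.smul_def, ← map_pow, ← Algebra.smul_def, smul_mul_assoc, smul_mul_assoc]

theorem D_aeval (p : F[X]) : H.D * aeval H.om p = aeval H.om (p.comp (C H.μ * X)) * H.D := by
  have h1 : H.D * H.om = H.μ • (H.om * H.D) := H.D_om
  have h2 : ∀ n, H.D * H.om ^ n = (H.μ ^ n) • (H.om ^ n * H.D) := by
    intro n
    induction n with
    | zero => simp
    | succ n ih => rw [pow_succ, ← mul_assoc, ih, smul_mul_assoc, mul_assoc, h1, mul_smul_comm, smul_smul, mul_assoc, pow_succ]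
  induction p using Polynomial.induction_on' with
  | add p q hp hq => rw [map_add, mul_add, hp, hq, add_comp, map_add, add_mul]
  | monomial n a =>
    rw [← C_mul_X_pow_eq_monomial]
    simp only [map_mul, aeval_C, map_pow, aeval_X, mul_comp, C_comp, X_pow_comp, mul_pow]
    rw [← Algebra.smul_def, mul_smul_comm, h2, ← Algebra.smul_def, ← map_pow, ← Algebra.smul_def, smul_mul_assoc, smul_mul_assoc]

theorem UD_diag (h1 : H.μ ≠ 1) (j : ℕ) : ∃ p : F[X], H.U ^ j * H.D ^ j = aeval H.om p := by
  induction j with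
  | zero => exact ⟨1, by simp⟩
  | succ j ih =>
    obtain ⟨p, hp⟩ := ih
    have h2 : H.U * H.D = aeval H.om (C (H.μ - 1)⁻¹ * (X - C H.c)) := by
      simp only [map_mul, map_sub, aeval_C, aeval_X]
      rw [om_eq, ← Algebra.smul_def, Algebra.algebraMap_eq_smul_one, add_sub_cancel_right, smul_smul,
        inv_mul_cancel₀ (sub_ne_zero.2 h1), one_smul]
    refine ⟨p.comp (C H.μ⁻¹ * X) * (C (H.μ - 1)⁻¹ * (X - C H.c)), ?_⟩
    rw [pow_succ', pow_succ, mul_assoc, ← mul_assoc (H.U ^ j), hp, ← mul_assoc, U_aeval, mul_assoc, h2, ← map_mul]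

theorem D_pow_mem (hn : ∀ n, 0 < n → H.μ ^ n ≠ 1) (J : Submodule F R) (hl : ∀ x ∈ J, ∀ r, r * x ∈ J) (hr : IsR J) (d : ℕ) :
    ∀ (p : F[X]) (i : ℕ), p.natDegree ≤ d → p.coeff 0 ≠ 0 → aeval H.om p * H.D ^ i ∈ J → H.D ^ (i + d) ∈ J := by
  induction d with
  | zero =>
    intro p i hd h0 hp
    rw [eq_C_of_natDegree_le_zero hd, aeval_C, ← Algebra.smul_def] at hp
    exact (Submodule.smul_mem_iff _ h0).1 hp
  | succ d ih =>
    intro p i hd h0 hp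
    have hco : ∀ n, (p.comp (C H.μ * X) - C (H.μ ^ (d + 1)) * p).coeff n = p.coeff n * (H.μ ^ n - H.μ ^ (d + 1)) := by
      intro n; rw [coeff_sub, comp_C_mul_X_coeff, coeff_C_mul]; ring
    have := ih (p.comp (C H.μ * X) - C (H.μ ^ (d + 1)) * p) (i + 1) ?_ ?_ ?_
    · rw [show i + (d + 1) = i + 1 + d by ring]; exact this
    · rw [natDegree_le_iff_coeff_eq_zero]
      intro n hn
      rw [hco]
      rcases (show n = d + 1 ∨ d + 1 < n by omega) with rfl | h
      · simp
      · rw [coeff_eq_zero_of_natDegree_lt (hd.trans_lt h), zero_mul]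
    · rw [hco, pow_zero]
      exact mul_ne_zero h0 (sub_ne_zero.2 (hn _ (Nat.succ_pos _)).symm)
    · rw [map_sub, sub_mul]
      refine sub_mem ?_ ?_
      · rw [pow_succ', ← mul_assoc, ← D_aeval, mul_assoc]
        exact hl _ hp _
      · rw [map_mul, aeval_C, ← Algebra.smul_def, smul_mul_assoc, pow_succ H.D, ← mul_assoc]
        exact Submodule.smul_mem _ _ (hr _ hp _)

theorem one_mem_of_D_pow (J : Submodule F R) (hl : ∀ x ∈ J, ∀ r, r * x ∈ J) (hr : IsR J)
    (hs : H.IsSat J) (h1 : H.μ ≠ 1) (i : ℕ) (hi : H.D ^ i ∈ J) : (1 : R) ∈ J := by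
  by_cases hc : H.c = 0
  · have : ∀ i, ∃ s : F, H.om ^ i = s • (H.U ^ i * H.D ^ i) := by
      intro i
      induction i with
      | zero => exact ⟨1, by simp⟩
      | succ i ih =>
        obtain ⟨s, hs⟩ := ih
        refine ⟨s * H.μ ^ i * (H.μ - 1), ?_⟩
        rw [pow_succ, hs, smul_mul_assoc, mul_assoc, D_pow_om, H.om_eq, hc, zero_smul, add_zero, smul_mul_assoc, mul_smul_comm,
          mul_smul_comm, smul_smul, smul_smul]
        rw [pow_succ, pow_succ' H.D]; simp only [mul_assoc]
    obtain ⟨s, hs'⟩ := this i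
    refine hs.pow H 1 i ?_
    rw [one_mul, hs']
    exact Submodule.smul_mem _ _ (hl _ hi _)
  · induction i with
    | zero => simpa using hi
    | succ i ih =>
      refine ih ?_
      have h := H.D_pow_U (i + 1)
      have h2 : (H.q (i + 1) * H.c) • H.D ^ i ∈ J := by
        have : (H.q (i + 1) * H.c) • H.D ^ i = H.D ^ (i + 1) * H.U - H.μ ^ (i + 1) • (H.U * H.D ^ (i + 1)) := by
          rw [h]; simp
        rw [this]
        exact sub_mem (hr _ hi _) (Submodule.smul_mem _ _ (hl _ hi _))
      exact (Submodule.smul_mem_iff _ (mul_ne_zero (H.hq _ (Nat.succ_pos _)) hc)).1 h2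

theorem om_ne_zero : H.om ≠ 0 := by
  intro h
  have h2 := H.om_eq
  rw [h] at h2
  have e1 : H.U * H.D = H.B (1, 1) := by rw [H.hB]; simp
  have e2 : (1 : R) = H.B (0, 0) := by rw [H.hB]; simp
  rw [e1, e2] at h2
  have a := congrArg (fun x => H.B.repr x (1, 1)) h2
  have b := congrArg (fun x => H.B.repr x (0, 0)) h2
  simp at a b
  rcases H.hcase with ⟨_, hc⟩ | hn
  · exact hc b.symm
  · apply hn 1 one_pos; rw [pow_one]; linear_combination -a

theorem fact2 (J : Submodule F R) (hl : ∀ x ∈ J, ∀ r, r * x ∈ J) (hr : IsR J) (x : R) (hx : x ∈ J) (hx0 : x ≠ 0) :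
    ∃ k, H.om ^ k ∈ J := by
  rcases H.hcase with ⟨h1, hc⟩ | hn
  · refine ⟨0, ?_⟩
    rw [pow_zero]
    refine H.weyl_simple h1 hc J hl hr ((H.B.repr x).support.sup fun p => p.1 + p.2) x hx hx0 ?_
    intro i j hij
    exact Finset.le_sup (f := fun p : ℕ × ℕ => p.1 + p.2) (Finsupp.mem_support_iff.2 hij)
  · have h1 : H.μ ≠ 1 := by simpa using hn 1 one_pos
    have hs := H.sat_isSat hr
    have hr' := H.sat_isR hr
    have hl' : ∀ x ∈ H.sat J, ∀ r, r * x ∈ H.sat J := by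
      intro x hx r
      rw [mem_sat _ hr] at hx ⊢
      obtain ⟨k, hk⟩ := hx
      exact ⟨k, by rw [mul_assoc]; exact hl _ hk _⟩
    suffices (1 : R) ∈ H.sat J by
      rw [mem_sat _ hr] at this
      simpa using this
    obtain ⟨h, hh, hh0, ⟨i, j⟩, hsg⟩ := H.exists_homog (H.sat J) (by
      intro x hx
      apply hs
      rw [← om_mul]; exact hl' _ hx _) _ x (H.le_sat hr hx) hx0 le_rfl
    set y := H.D ^ i * h * H.U ^ j with hy
    have hD0 : ∀ i, H.D ^ i ≠ 0 := fun i => by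
      have := H.B.ne_zero (0, i); rwa [H.hB, pow_zero, one_mul] at this
    have hU0 : ∀ i, H.U ^ i ≠ 0 := fun i => by
      have := H.B.ne_zero (i, 0); rwa [H.hB, pow_zero, mul_one] at this
    have hy0 : y ≠ 0 := H.mul_ne_zero' _ _ (H.mul_ne_zero' _ _ (hD0 i) hh0) (hU0 j)
    have hyJ : y ∈ H.sat J := hr' _ (hl' _ hh _) _
    have hcom : H.om * y = y * H.om := by
      have e1 : H.μ ^ i • (H.om * y) = H.μ ^ i • (y * H.om) := by
        calc H.μ ^ i • (H.om * y) = (H.μ ^ i • (H.om * H.D ^ i)) * h * H.U ^ j := by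
              rw [hy]; simp only [smul_mul_assoc, mul_assoc]
          _ = H.D ^ i * (H.om * h) * H.U ^ j := by rw [← D_pow_om]; simp only [mul_assoc]
          _ = H.fac (i, j) • (H.D ^ i * h * (H.om * H.U ^ j)) := by
              rw [om_mul, hsg]; simp only [smul_mul_assoc, mul_smul_comm, mul_assoc]
          _ = H.μ ^ i • (y * H.om) := by
              rw [om_U_pow, mul_smul_comm, smul_smul, fac, mul_assoc, inv_mul_cancel₀ (pow_ne_zero _ H.hμ), mul_one, hy]
              simp only [mul_assoc]
      exact smul_right_injective _ (pow_ne_zero i H.hμ) e1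
    have hsy : H.sg y = y := by
      rw [om_mul] at hcom
      by_contra hne
      exact H.mul_ne_zero' _ _ (sub_ne_zero.2 hne) H.om_ne_zero (by rw [sub_mul, hcom, sub_self])
    have hdiag : ∀ p ∈ (H.B.repr y).support, p.1 = p.2 := by
      rintro ⟨a, b⟩ hp
      rw [Finsupp.mem_support_iff] at hp
      have := H.repr_sg y (a, b)
      rw [hsy, fac] at this
      have h3 : H.μ ^ a * (H.μ ^ b)⁻¹ = 1 := by
        have h4 : (H.μ ^ a * (H.μ ^ b)⁻¹ - 1) * H.B.repr y (a, b) = 0 := by linear_combination -this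
        exact sub_eq_zero.1 ((mul_eq_zero.1 h4).resolve_right hp)
      have h4 : H.μ ^ a = H.μ ^ b := by
        have := pow_ne_zero b H.hμ
        field_simp at h3; exact h3
      by_contra hne
      rcases lt_or_gt_of_ne hne with hlt | hlt
      · dsimp only at hlt
        apply hn (b - a) (by omega)
        have := pow_add H.μ a (b - a)
        rw [Nat.add_sub_cancel' hlt.le, ← h4] at this
        exact mul_left_cancel₀ (pow_ne_zero a H.hμ) (by rw [← this, mul_one])
      · dsimp only at hlt
        apply hn (a - b) (by omega)
        have := pow_add H.μ b (a - b)
        rw [Nat.add_sub_cancel' hlt.le, h4] at this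
        exact mul_left_cancel₀ (pow_ne_zero b H.hμ) (by rw [← this, mul_one])
    have hpoly : ∃ p : F[X], aeval H.om p = y := by
      have : y ∈ LinearMap.range (aeval H.om : F[X] →ₐ[F] R).toLinearMap := by
        rw [← H.B.linearCombination_repr y, Finsupp.linearCombination_apply, Finsupp.sum]
        refine sum_mem fun p hp => Submodule.smul_mem _ _ ?_
        obtain ⟨a, b⟩ := p
        have := hdiag _ hp
        dsimp only at this
        subst this
        obtain ⟨p, hp⟩ := H.UD_diag h1 a
        exact ⟨p, by rw [H.hB, hp]; rfl⟩
      exact this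
    obtain ⟨p, hp⟩ := hpoly
    have hp0 : p ≠ 0 := by rintro rfl; rw [map_zero] at hp; exact hy0 hp.symm
    obtain ⟨g, hg, hnd⟩ := exists_eq_pow_rootMultiplicity_mul_and_not_dvd p hp0 0
    rw [C_0, sub_zero] at hg hnd
    have hg0 : g.coeff 0 ≠ 0 := fun h => hnd (X_dvd_iff.2 h)
    have hgJ : aeval H.om g ∈ H.sat J := by
      refine hs.pow H _ (rootMultiplicity 0 p) ?_
      rw [hg, mul_comm, map_mul, map_pow, aeval_X] at hp
      rw [hp]; exact hyJ
    exact H.one_mem_of_D_pow (H.sat J) hl' hr' hs h1 _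
      (H.D_pow_mem hn (H.sat J) hl' hr' g.natDegree g 0 le_rfl hg0 (by simpa using hgJ))

end QW

end

section

open Polynomial Module

namespace QW
variable {F R : Type} [Field F] [Ring R] [Algebra F R] (H : QW F R)

def T (n : ℕ) : Finset (ℕ × ℕ) := (Finset.range (n + 1) ×ˢ Finset.range (n + 1)).filter fun p => p.1 + p.2 ≤ n

theorem mem_T (n : ℕ) (p : ℕ × ℕ) : p ∈ T n ↔ p.1 + p.2 ≤ n := by
  rw [T, Finset.mem_filter, Finset.mem_product, Finset.mem_range, Finset.mem_range]; omega

theorem card_T_succ (n : ℕ) : (T (n + 1)).card ≤ (T n).card + (n + 2) := by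
  have : T (n + 1) ⊆ T n ∪ Finset.HasAntidiagonal.antidiagonal (n + 1) := by
    intro p hp
    rw [mem_T] at hp
    rw [Finset.mem_union, mem_T, Finset.HasAntidiagonal.mem_antidiagonal]; omega
  have h := (Finset.card_le_card this).trans (Finset.card_union_le _ _)
  rw [Finset.Nat.card_antidiagonal] at h; exact h

theorem card_T_ge (t : ℕ) : (t + 1) * (t + 1) ≤ (T (2 * t)).card := by
  have : Finset.range (t + 1) ×ˢ Finset.range (t + 1) ⊆ T (2 * t) := by
    intro p hp
    rw [Finset.mem_product, Finset.mem_range, Finset.mem_range] at hp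
    rw [mem_T]; omega
  simpa using Finset.card_le_card this

/-- total degree filtration -/
def Fil (n : ℕ) : Submodule F R := Submodule.span F (Set.range fun p : T n => H.B p)

instance (n : ℕ) : FiniteDimensional F (H.Fil n) := FiniteDimensional.span_of_finite F (Set.finite_range _)

theorem finrank_Fil (n : ℕ) : finrank F (H.Fil n) = (T n).card := by
  rw [Fil, finrank_span_eq_card, Fintype.card_coe]
  exact H.B.linearIndependent.comp _ Subtype.val_injective

theorem mem_Fil (i j n : ℕ) (h : i + j ≤ n) : H.U ^ i * H.D ^ j ∈ H.Fil n := by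
  rw [← H.hB]; exact Submodule.subset_span ⟨⟨(i, j), (mem_T _ _).2 h⟩, rfl⟩

theorem Fil_ind {n : ℕ} {S : Submodule F R} (f : R →ₗ[F] R) (h : ∀ i j, i + j ≤ n → f (H.U ^ i * H.D ^ j) ∈ S) :
    ∀ x ∈ H.Fil n, f x ∈ S := by
  intro x hx
  have : H.Fil n ≤ S.comap f := by
    rw [Fil, Submodule.span_le]
    rintro _ ⟨⟨⟨i, j⟩, hij⟩, rfl⟩
    dsimp only
    rw [H.hB]; exact h i j ((mem_T _ _).1 hij)
  exact this hx

theorem Fil_mono {n m : ℕ} (h : n ≤ m) : H.Fil n ≤ H.Fil m := by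
  intro x hx
  exact H.Fil_ind (S := H.Fil m) LinearMap.id (fun i j hij => H.mem_Fil i j m (hij.trans h)) x hx

theorem Fil_mul_U {n : ℕ} : ∀ x ∈ H.Fil n, x * H.U ∈ H.Fil (n + 1) := by
  refine H.Fil_ind (LinearMap.mulRight F H.U) ?_
  intro i j hij
  rw [LinearMap.mulRight_apply, mul_assoc, D_pow_U, mul_add, mul_smul_comm, mul_smul_comm, ← mul_assoc, ← pow_succ]
  exact add_mem (Submodule.smul_mem _ _ (H.mem_Fil _ _ _ (by omega))) (Submodule.smul_mem _ _ (H.mem_Fil _ _ _ (by omega)))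

theorem Fil_mul_D {n : ℕ} : ∀ x ∈ H.Fil n, x * H.D ∈ H.Fil (n + 1) := by
  refine H.Fil_ind (LinearMap.mulRight F H.D) ?_
  intro i j hij
  rw [LinearMap.mulRight_apply, mul_assoc, ← pow_succ]
  exact H.mem_Fil _ _ _ (by omega)

theorem Fil_mul {n m : ℕ} (x y : R) (hx : x ∈ H.Fil n) (hy : y ∈ H.Fil m) : x * y ∈ H.Fil (n + m) := by
  refine H.Fil_ind (LinearMap.mulLeft F x) ?_ y hy
  intro i j hij
  rw [LinearMap.mulLeft_apply, ← mul_assoc]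
  have h1 : ∀ i, x * H.U ^ i ∈ H.Fil (n + i) := by
    intro i
    induction i with
    | zero => simpa using hx
    | succ i ih => rw [pow_succ, ← mul_assoc]; exact H.Fil_mul_U _ ih
  have h2 : ∀ j, x * H.U ^ i * H.D ^ j ∈ H.Fil (n + i + j) := by
    intro j
    induction j with
    | zero => simpa using h1 i
    | succ j ih => rw [pow_succ, ← mul_assoc]; exact H.Fil_mul_D _ ih
  exact H.Fil_mono (by omega) (h2 j)

theorem exists_Fil (x : R) : ∃ n, x ∈ H.Fil n := by
  refine H.ind (P := fun x => ∃ n, x ∈ H.Fil n) ?_ ?_ ?_ ?_ x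
  · exact fun i j => ⟨_, H.mem_Fil i j _ le_rfl⟩
  · rintro x y ⟨n, hn⟩ ⟨m, hm⟩
    exact ⟨max n m, add_mem (H.Fil_mono (le_max_left _ _) hn) (H.Fil_mono (le_max_right _ _) hm)⟩
  · exact ⟨0, zero_mem _⟩
  · rintro a x ⟨n, hn⟩; exact ⟨n, Submodule.smul_mem _ _ hn⟩

theorem card_T_add (n d : ℕ) : (T (n + d)).card ≤ (T n).card + d * (n + d + 1) := by
  induction d with
  | zero => simp
  | succ d ih =>
    have := card_T_succ (n + d)
    rw [← add_assoc]
    nlinarith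

theorem not_finite (H : QW F R) : ¬ Module.Finite F R := fun _ => (not_finite_iff_infinite.2 inferInstance) (Module.Finite.finite_basis H.B)

/-- nonzero cyclic torsion-free modules are infinite dimensional -/
theorem fact1 (I : Submodule F R) (hI : IsR I) (hs : H.IsSat I) (m : R) (hm : m ∉ I) (n : ℕ)
    (hall : ∀ x, ∃ y ∈ H.Fil n, m * x - m * y ∈ I) : False := by
  set φ : R →ₗ[F] R ⧸ I := I.mkQ.comp (LinearMap.mulLeft F m) with hφ
  have hφa : ∀ x, φ x = 0 ↔ m * x ∈ I := fun x => by simp [hφ]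
  have hrange : LinearMap.range φ ≤ (H.Fil n).map φ := by
    rintro _ ⟨x, rfl⟩
    obtain ⟨y, hy, h⟩ := hall x
    refine ⟨y, hy, ?_⟩
    rw [← sub_eq_zero, ← map_sub, hφa, mul_sub, ← neg_sub]; exact neg_mem h
  have hfd : FiniteDimensional F (LinearMap.range φ) := Submodule.finiteDimensional_of_le hrange
  let Θ : R →ₗ[F] (H.Fil n →ₗ[F] LinearMap.range φ) :=
    { toFun := fun x => φ.rangeRestrict.comp ((LinearMap.mulRight F x).comp (H.Fil n).subtype)
      map_add' := by intro x y; ext; simp [mul_add]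
      map_smul' := by intro x y; ext; simp }
  have hker : LinearMap.ker Θ ≠ ⊥ := by
    intro h
    have hinj : Function.Injective Θ := by
      rw [injective_iff_map_eq_zero]
      intro a ha
      have : a ∈ LinearMap.ker Θ := LinearMap.mem_ker.2 ha
      rw [h] at this
      exact (Submodule.mem_bot F).1 this
    exact H.not_finite (Module.Finite.of_injective Θ hinj)
  obtain ⟨x, hx, hx0⟩ := Submodule.exists_mem_ne_zero_of_ne_bot hker
  have hx2 : ∀ y ∈ H.Fil n, m * (y * x) ∈ I := by
    intro y hy
    have := congrArg Subtype.val (LinearMap.congr_fun (LinearMap.mem_ker.1 hx) ⟨y, hy⟩)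
    rw [← hφa]; exact this
  have hx3 : ∀ r, m * r * x ∈ I := by
    intro r
    obtain ⟨y, hy, h⟩ := hall r
    have := add_mem (hI _ h x) (hx2 y hy)
    rw [sub_mul, mul_assoc m y, sub_add_cancel] at this; exact this
  let J : Submodule F R :=
    { carrier := {x | ∀ r, m * r * x ∈ I}
      add_mem' := fun {a b} ha hb r => by rw [mul_add]; exact add_mem (ha r) (hb r)
      zero_mem' := fun r => by rw [mul_zero]; exact zero_mem _
      smul_mem' := fun a x hx r => by rw [mul_smul_comm]; exact Submodule.smul_mem _ _ (hx r) }
  obtain ⟨k, hk⟩ := H.fact2 J (fun x hx s r => by rw [← mul_assoc, mul_assoc m]; exact hx _)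
    (fun x hx s r => by rw [← mul_assoc]; exact hI _ (hx r) _) x hx3 hx0
  have := hk 1
  rw [mul_one] at this
  exact hm (hs.pow H m k this)

theorem growth (I : Submodule F R) (hI : IsR I) (hs : H.IsSat I) (m : R) (hm : m ∉ I) (n : ℕ) :
    n + 1 ≤ finrank F ((H.Fil n).map (I.mkQ.comp (LinearMap.mulLeft F m))) := by
  set φ : R →ₗ[F] R ⧸ I := I.mkQ.comp (LinearMap.mulLeft F m) with hφ
  have hφa : ∀ x, φ x = 0 ↔ m * x ∈ I := fun x => by simp [hφ]
  induction n with
  | zero =>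
    rw [zero_add, Nat.one_le_iff_ne_zero]
    intro h
    rw [Submodule.finrank_eq_zero] at h
    have : φ 1 ∈ (H.Fil 0).map φ := ⟨1, by simpa using H.mem_Fil 0 0 0 le_rfl, rfl⟩
    rw [h, Submodule.mem_bot, hφa, mul_one] at this
    exact hm this
  | succ n ih =>
    refine Nat.succ_le_of_lt (lt_of_le_of_lt ih (Submodule.finrank_lt_finrank_of_lt ?_))
    refine lt_of_le_of_ne (Submodule.map_mono (H.Fil_mono (Nat.le_succ n))) ?_
    intro heq
    let S : Submodule F R := ((H.Fil n).map φ).comap φ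
    have hstep : ∀ x ∈ S, ∀ g, (∀ y ∈ H.Fil n, y * g ∈ H.Fil (n + 1)) → x * g ∈ S := by
      rintro x ⟨y, hy, hxy⟩ g hg
      change φ (x * g) ∈ (H.Fil n).map φ
      rw [heq]
      refine ⟨y * g, hg y hy, ?_⟩
      rw [← sub_eq_zero, ← map_sub, hφa] at hxy ⊢
      rw [← sub_mul, ← mul_assoc]
      exact hI _ hxy _
    have h1 : (1 : R) ∈ S := ⟨1, by simpa using H.mem_Fil 0 0 n (Nat.zero_le _), rfl⟩
    have hU : ∀ i, H.U ^ i ∈ S := by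
      intro i
      induction i with
      | zero => simpa using h1
      | succ i ih => rw [pow_succ]; exact hstep _ ih _ H.Fil_mul_U
    have hUD : ∀ i j, H.U ^ i * H.D ^ j ∈ S := by
      intro i j
      induction j with
      | zero => simpa using hU i
      | succ j ih => rw [pow_succ, ← mul_assoc]; exact hstep _ ih _ H.Fil_mul_D
    have htop : ∀ x, x ∈ S := fun x => H.ind (P := fun x => x ∈ S) hUD (fun _ _ => add_mem) (zero_mem _)
      (fun a _ => Submodule.smul_mem _ a) x
    refine H.fact1 I hI hs m hm n (fun x => ?_)
    obtain ⟨y, hy, h⟩ := htop x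
    refine ⟨y, hy, ?_⟩
    rw [eq_comm, ← sub_eq_zero, ← map_sub, hφa] at h
    rw [← mul_sub]; exact h

theorem step (I I' : Submodule F R) (hI : IsR I) (hs : H.IsSat I) (hI' : IsR I') (hle : I ≤ I') (m : R) (hm : m ∉ I) (hm' : m ∈ I') (e : ℕ)
    (he : m ∈ H.Fil e) (n : ℕ) :
    finrank F (I ⊓ H.Fil (e + n) : Submodule F R) + (n + 1) ≤ finrank F (I' ⊓ H.Fil (e + n) : Submodule F R) := by
  set S := I' ⊓ H.Fil (e + n) with hS
  have hfd : FiniteDimensional F S := Submodule.finiteDimensional_of_le inf_le_right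
  have h1 := LinearMap.finrank_range_add_finrank_ker (I.mkQ.comp S.subtype)
  have h2 : finrank F (LinearMap.ker (I.mkQ.comp S.subtype)) = finrank F (I ⊓ H.Fil (e + n) : Submodule F R) := by
    rw [LinearMap.ker_comp, Submodule.ker_mkQ, ← Submodule.finrank_map_subtype_eq, Submodule.map_comap_subtype]
    rw [show S ⊓ I = I ⊓ H.Fil (e + n) by rw [hS, inf_right_comm, inf_eq_right.2 hle]]
  have h3 : (H.Fil n).map (I.mkQ.comp (LinearMap.mulLeft F m)) ≤ LinearMap.range (I.mkQ.comp S.subtype) := by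
    rintro _ ⟨y, hy, rfl⟩
    exact ⟨⟨m * y, hI' _ hm' _, H.Fil_mul _ _ he hy⟩, rfl⟩
  have h4 := (H.growth I hI hs m hm n).trans (Submodule.finrank_mono h3)
  omega

theorem chain_bound (f : ℕ → Submodule F R) (k : ℕ) (hR : ∀ i, IsR (f i)) (hs : ∀ i, H.IsSat (f i)) (hlt : ∀ i < k, f i < f (i + 1))
    (v : R) (hv0 : v ≠ 0) (hv : v ∈ f 0) (d : ℕ) (hd : v ∈ H.Fil d) : k ≤ d := by
  have hex : ∀ i, ∃ e, i < k → ∃ m, m ∉ f i ∧ m ∈ f (i + 1) ∧ m ∈ H.Fil e := by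
    intro i
    by_cases hi : i < k
    · obtain ⟨m, hm, hm'⟩ := Set.exists_of_ssubset (hlt i hi)
      obtain ⟨e, he⟩ := H.exists_Fil m
      exact ⟨e, fun _ => ⟨m, hm', hm, he⟩⟩
    · exact ⟨0, fun h => absurd h hi⟩
  choose e he using hex
  set E := (Finset.range k).sup e with hE
  have hstep : ∀ n j, j ≤ k → finrank F (f 0 ⊓ H.Fil (E + n) : Submodule F R) + j * (n + 1) ≤ finrank F (f j ⊓ H.Fil (E + n) : Submodule F R) := by
    intro n j
    induction j with
    | zero => intro _; simp
    | succ j ih =>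
      intro hj
      obtain ⟨m, h1, h2, h3⟩ := he j (by omega)
      have h4 := H.step (f j) (f (j + 1)) (hR _) (hs _) (hR _) (hlt j (by omega)).le m h1 h2 E
        (H.Fil_mono (Finset.le_sup (f := e) (Finset.mem_range.2 (by omega))) h3) n
      have := ih (by omega)
      rw [Nat.succ_mul]; omega
  by_contra hkd
  set n := d * E + d with hn
  have h1 := hstep n k le_rfl
  have h2 : finrank F (f k ⊓ H.Fil (E + n) : Submodule F R) ≤ (T (E + n)).card := by
    rw [← H.finrank_Fil]; exact Submodule.finrank_mono inf_le_right
  have h3 : (T (E + d * E)).card ≤ finrank F (f 0 ⊓ H.Fil (E + n) : Submodule F R) := by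
    rw [← H.finrank_Fil]
    have hinj : Function.Injective ((LinearMap.mulLeft F v).comp (H.Fil (E + d * E)).subtype) := by
      rw [← LinearMap.ker_eq_bot, LinearMap.ker_eq_bot']
      intro y hy
      by_contra hy0
      exact H.mul_ne_zero' v y hv0 (fun h => hy0 (Subtype.ext h)) hy
    rw [← LinearMap.finrank_range_of_inj hinj]
    have hfd : FiniteDimensional F (f 0 ⊓ H.Fil (E + n) : Submodule F R) := Submodule.finiteDimensional_of_le inf_le_right
    refine Submodule.finrank_mono ?_
    rintro _ ⟨y, rfl⟩
    refine ⟨hR 0 _ hv _, ?_⟩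
    have := H.Fil_mul v y hd y.2
    rw [show E + n = d + (E + d * E) by rw [hn]; ring]
    exact this
  have h4 := card_T_add (E + d * E) d
  rw [show E + d * E + d = E + n by rw [hn]; ring] at h4
  have h5 : k * (n + 1) ≤ d * (E + n + 1) := by omega
  have h6 : (d + 1) * (n + 1) ≤ k * (n + 1) := Nat.mul_le_mul_right _ (by omega)
  nlinarith

theorem ore (H : QW F R) (n v : R) (hv : v ≠ 0) : ∃ b y, b ≠ 0 ∧ n * b = v * y := by
  obtain ⟨e, he⟩ := H.exists_Fil n
  obtain ⟨d, hd⟩ := H.exists_Fil v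
  set t := d * (e + d + 3) + d with ht
  set m := 2 * t with hm
  let ψ : (H.Fil m × H.Fil (m + e)) →ₗ[F] H.Fil (m + e + d) :=
    LinearMap.codRestrict _ (((LinearMap.mulLeft F n).comp (H.Fil m).subtype).coprod (-((LinearMap.mulLeft F v).comp (H.Fil (m + e)).subtype))) (by
      rintro ⟨b, y⟩
      simp only [LinearMap.coprod_apply, LinearMap.comp_apply, LinearMap.neg_apply, LinearMap.mulLeft_apply, Submodule.subtype_apply]
      refine add_mem ?_ (neg_mem ?_)
      · exact H.Fil_mono (by omega) (H.Fil_mul _ _ he b.2)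
      · exact H.Fil_mono (by omega) (H.Fil_mul _ _ hd y.2))
  have hker : LinearMap.ker ψ ≠ ⊥ := by
    apply LinearMap.ker_ne_bot_of_finrank_lt
    rw [Module.finrank_prod, finrank_Fil, finrank_Fil, finrank_Fil]
    have h1 := card_T_ge t
    have h2 := card_T_add (m + e) d
    rw [← hm] at h1
    have : d * (m + e + d + 1) < (t + 1) * (t + 1) := by
      rw [hm]
      have h4 : 4 * d ≤ t := by rw [ht]; nlinarith [Nat.zero_le (d * e), Nat.zero_le (d * d)]
      have h5 : d * (e + d + 1) ≤ t := by rw [ht]; nlinarith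
      have h6 : 4 * d * t ≤ t * t := Nat.mul_le_mul_right t h4
      have h7 : 0 ≤ d * t := Nat.zero_le _
      nlinarith
    omega
  obtain ⟨⟨b, y⟩, hby, hne⟩ := Submodule.exists_mem_ne_zero_of_ne_bot hker
  have h : n * b = v * y := by
    have := congrArg Subtype.val (LinearMap.mem_ker.1 hby)
    have h2 : n * b + -(v * y) = 0 := this
    rw [← sub_eq_add_neg, sub_eq_zero] at h2; exact h2
  refine ⟨b, y, ?_, h⟩
  intro hb
  rw [hb, mul_zero] at h
  have hy : (y : R) = 0 := by
    by_contra hy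
    exact H.mul_ne_zero' _ _ hv hy h.symm
  exact hne (Prod.ext (Subtype.ext hb) (Subtype.ext hy))

end QW

end

section

open Polynomial Module

namespace QW
variable {F R : Type} [Field F] [Ring R] [Algebra F R] (H : QW F R)

/-- `mR` -/
def rg (F : Type) {R : Type} [Field F] [Ring R] [Algebra F R] (m : R) : Submodule F R := LinearMap.range (LinearMap.mulLeft F m)

theorem mem_rg (m x : R) : x ∈ rg F m ↔ ∃ y, m * y = x := Iff.rfl

theorem rg_isR (m : R) : IsR (rg F m) := by
  rintro _ ⟨y, rfl⟩ r
  exact ⟨y * r, by simp [mul_assoc]⟩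

theorem self_mem_rg (m : R) : m ∈ rg F m := ⟨1, by simp⟩

theorem rg_le {m : R} {I : Submodule F R} (hI : IsR I) (h : m ∈ I) : rg F m ≤ I := by
  rintro _ ⟨y, rfl⟩; exact hI _ h _

theorem IsR.sup {I J : Submodule F R} (hI : IsR I) (hJ : IsR J) : IsR (I ⊔ J) := by
  intro x hx r
  obtain ⟨a, ha, b, hb, rfl⟩ := Submodule.mem_sup.1 hx
  rw [add_mul]
  exact Submodule.add_mem_sup (hI _ ha _) (hJ _ hb _)

theorem acc (v : R) (hv : v ≠ 0) (S : Set (Submodule F R)) (hS : S.Nonempty) (h : ∀ I ∈ S, IsR I ∧ H.IsSat I ∧ v ∈ I) :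
    ∃ W ∈ S, ∀ W' ∈ S, ¬ W < W' := by
  have hwf : WellFounded fun a b : S => b.1 < a.1 := by
    rw [wellFounded_iff_isEmpty_descending_chain]
    constructor
    rintro ⟨f, hf⟩
    obtain ⟨d, hd⟩ := H.exists_Fil v
    have := H.chain_bound (fun i => (f i).1) (d + 1) (fun i => (h _ (f i).2).1) (fun i => (h _ (f i).2).2.1)
      (fun i _ => hf i) v hv (h _ (f 0).2).2.2 d hd
    omega
  obtain ⟨I, hI⟩ := hS
  obtain ⟨W, -, hW⟩ := hwf.has_min Set.univ ⟨⟨I, hI⟩, trivial⟩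
  exact ⟨W.1, W.2, fun W' hW' => hW ⟨W', hW'⟩ trivial⟩

theorem dcc (v : R) (hv : v ≠ 0) (S : Set (Submodule F R)) (hS : S.Nonempty) (h : ∀ I ∈ S, IsR I ∧ H.IsSat I ∧ v ∈ I) :
    ∃ W ∈ S, ∀ W' ∈ S, ¬ W' < W := by
  have hwf : WellFounded fun a b : S => a.1 < b.1 := by
    rw [wellFounded_iff_isEmpty_descending_chain]
    constructor
    rintro ⟨f, hf⟩
    obtain ⟨d, hd⟩ := H.exists_Fil v
    have := H.chain_bound (fun i => (f (d + 1 - i)).1) (d + 1) (fun i => (h _ (f _).2).1) (fun i => (h _ (f _).2).2.1)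
      (fun i hi => by
        have := hf (d + 1 - (i + 1))
        rw [show d + 1 - (i + 1) + 1 = d + 1 - i by omega] at this
        exact this) v hv (h _ (f _).2).2.2 d hd
    omega
  obtain ⟨I, hI⟩ := hS
  obtain ⟨W, -, hW⟩ := hwf.has_min Set.univ ⟨⟨I, hI⟩, trivial⟩
  exact ⟨W.1, W.2, fun W' hW' => hW ⟨W', hW'⟩ trivial⟩

theorem merge (A0 : AddSubmonoid R) (hA : ∀ a : R, ∃ s : F, s ≠ 0 ∧ s • a ∈ A0) (V : Submodule F R) (hV : IsR V)
    (v : R) (hvV : v ∈ V) (hv : v ≠ 0) (m1 m2 : R) (k : ℕ) (hk : H.om ^ k ∈ V ⊔ rg F m1 ⊔ rg F m2) :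
    ∃ r ∈ A0, ∃ k, H.om ^ k ∈ V ⊔ rg F (m1 + m2 * r) := by
  have hVR : ∀ n, IsR (V ⊔ rg F n) := fun n => hV.sup (rg_isR n)
  have hVs : ∀ n, V ≤ H.sat (V ⊔ rg F n) := fun n => le_sup_left.trans (H.le_sat (hVR n))
  have hns : ∀ n, n ∈ H.sat (V ⊔ rg F n) := fun n => H.le_sat (hVR n) (Submodule.mem_sup_right (self_mem_rg n))
  obtain ⟨_, ⟨r, hr, rfl⟩, hmax⟩ := H.acc v hv {W | ∃ r ∈ A0, W = H.sat (V ⊔ rg F (m1 + m2 * r))} ⟨_, 0, zero_mem _, rfl⟩ (by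
    rintro _ ⟨r, _, rfl⟩
    exact ⟨H.sat_isR (hVR _), H.sat_isSat (hVR _), hVs _ hvV⟩)
  refine ⟨r, hr, ?_⟩
  set n := m1 + m2 * r with hn
  set W := H.sat (V ⊔ rg F n) with hW
  have hWR : IsR W := H.sat_isR (hVR n)
  have hWS : H.IsSat W := H.sat_isSat (hVR n)
  by_contra hno
  have h1 : (1 : R) ∉ W := by
    intro h
    rw [hW, mem_sat _ (hVR n)] at h
    simp only [one_mul] at h
    exact hno h
  have hm2 : m2 ∉ W := by
    intro h
    apply h1
    refine hWS.pow H 1 k ?_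
    rw [one_mul]
    have hm1 : m1 ∈ W := by
      have := sub_mem (hns n) (hWR _ h r)
      rwa [hn, add_sub_cancel_right] at this
    exact (sup_le (sup_le (hVs n) (rg_le hWR hm1)) (rg_le hWR h)) hk
  set Y := H.sat (V ⊔ rg F m2) with hY
  have hYR : IsR Y := H.sat_isR (hVR _)
  have hYS : H.IsSat Y := H.sat_isSat (hVR _)
  obtain ⟨X, ⟨hXR, hXS, hVX, hXY, hXW⟩, hmin⟩ := H.dcc v hv
    {X | IsR X ∧ H.IsSat X ∧ V ≤ X ∧ X ≤ Y ∧ ¬ X ≤ W} ⟨Y, hYR, hYS, hVs _, le_rfl, fun h => hm2 (h (hns m2))⟩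
    (by rintro I ⟨a, b, c, _⟩; exact ⟨a, b, c hvV⟩)
  obtain ⟨b0, y0, hb0, hb0'⟩ := H.ore n v hv
  obtain ⟨a, b, ha, hab, hb, habW⟩ : ∃ a b, a ∈ A0 ∧ m2 * a ∈ X ∧ n * b ∈ V ∧ m2 * a * b ∉ W := by
    by_contra hcon
    push Not at hcon
    obtain ⟨x, hx, hxW⟩ := SetLike.not_le_iff_exists.1 hXW
    have hxY := hXY hx
    rw [hY, mem_sat _ (hVR _)] at hxY
    obtain ⟨l, hl⟩ := hxY
    obtain ⟨w, hw, _, ⟨a, rfl⟩, hwa⟩ := Submodule.mem_sup.1 hl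
    rw [LinearMap.mulLeft_apply] at hwa
    have haX : m2 * a ∈ X := by
      have := sub_mem (hXR _ hx (H.om ^ l)) (hVX hw)
      rwa [← hwa, add_sub_cancel_left] at this
    have haW : m2 * a ∉ W := by
      intro h
      apply hxW
      refine hWS.pow H x l ?_
      rw [← hwa]; exact add_mem (hVs n hw) h
    -- the two-sided ideal generated by I
    let J : Submodule F R :=
      { carrier := {x | ∀ r, m2 * a * r * x ∈ W}
        add_mem' := fun {a b} ha hb r => by rw [mul_add]; exact add_mem (ha r) (hb r)
        zero_mem' := fun r => by rw [mul_zero]; exact zero_mem _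
        smul_mem' := fun a x hx r => by rw [mul_smul_comm]; exact Submodule.smul_mem _ _ (hx r) }
    obtain ⟨j, hj⟩ := H.fact2 J (fun x hx s r => by rw [← mul_assoc, mul_assoc (m2 * a)]; exact hx _)
      (fun x hx s r => by rw [← mul_assoc]; exact hWR _ (hx r) _) b0 (fun r => by
        obtain ⟨s, hs, hsa⟩ := hA (a * r)
        have := hcon (s • (a * r)) b0 hsa (by rw [mul_smul_comm, ← mul_assoc]; exact Submodule.smul_mem _ _ (hXR _ haX _))
          (by rw [hb0']; exact hV _ hvV _)
        rw [mul_smul_comm, smul_mul_assoc, Submodule.smul_mem_iff _ hs, ← mul_assoc] at this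
        exact this) hb0
    have := hj 1
    rw [mul_one] at this
    exact haW (hWS.pow H _ j this)
  set W' := H.sat (V ⊔ rg F (m1 + m2 * (r + a))) with hW'
  have hW'R : IsR W' := H.sat_isR (hVR _)
  have hW'S : H.IsSat W' := H.sat_isSat (hVR _)
  have hn' : m1 + m2 * (r + a) = n + m2 * a := by rw [hn, mul_add, add_assoc]
  have hnW' : n + m2 * a ∈ W' := by rw [← hn']; exact hns _
  have habW' : m2 * a * b ∈ W' := by
    have := sub_mem (hW'R _ hnW' b) (hVs (m1 + m2 * (r + a)) hb)
    rwa [add_mul, add_sub_cancel_left] at this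
  have hXW' : X ≤ W' := by
    by_contra hnot
    refine hmin (X ⊓ W') ⟨fun x hx r => ⟨hXR _ hx.1 _, hW'R _ hx.2 _⟩, fun x hx => ⟨hXS _ hx.1, hW'S _ hx.2⟩,
      le_inf hVX (hVs _), inf_le_left.trans hXY, ?_⟩ ?_
    · intro h; exact habW (h ⟨hXR _ hab _, habW'⟩)
    · exact lt_of_le_of_ne inf_le_left (fun h => hnot (inf_eq_left.1 h))
  have hnW2 : n ∈ W' := by
    have := sub_mem hnW' (hXW' hab)
    rwa [add_sub_cancel_right] at this
  refine hmax W' ⟨r + a, add_mem hr ha, rfl⟩ ?_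
  refine lt_of_le_of_ne (H.sat_le (hVR n) hW'S (sup_le (hVs _) (rg_le hW'R hnW2))) ?_
  intro h
  rw [h] at habW
  exact habW habW'

end QW

end

section

open Polynomial

namespace QWModel
variable {F : Type} [Field F] (μ c : F)

def q (i : ℕ) : F := ∑ k ∈ Finset.range i, μ ^ k

theorem q_succ' (i : ℕ) : q μ (i + 1) = 1 + μ * q μ i := by
  rw [q, Finset.sum_range_succ', q, Finset.mul_sum, add_comm]
  simp [pow_succ']

noncomputable def Uop (F : Type) [Field F] : Module.End F (ℕ × ℕ →₀ F) := Finsupp.linearCombination F fun p => Finsupp.single (p.1 + 1, p.2) 1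
noncomputable def Dop : Module.End F (ℕ × ℕ →₀ F) := Finsupp.linearCombination F fun p =>
  μ ^ p.1 • Finsupp.single (p.1, p.2 + 1) 1 + (q μ p.1 * c) • Finsupp.single (p.1 - 1, p.2) 1

theorem Uop_single (i j : ℕ) : Uop F (Finsupp.single (i, j) 1) = Finsupp.single (i + 1, j) 1 := by
  simp [Uop]

theorem Dop_single (i j : ℕ) : Dop μ c (Finsupp.single (i, j) 1) =
    μ ^ i • Finsupp.single (i, j + 1) 1 + (q μ i * c) • Finsupp.single (i - 1, j) 1 := by
  rw [Dop, Finsupp.linearCombination_single, one_smul]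

theorem op_rel : Dop μ c * Uop F = μ • (Uop F * Dop μ c) + c • (1 : Module.End F (ℕ × ℕ →₀ F)) := by
  apply Finsupp.lhom_ext'
  rintro ⟨i, j⟩
  apply LinearMap.ext_ring
  simp only [LinearMap.comp_apply, Finsupp.lsingle_apply, Module.End.mul_apply, LinearMap.add_apply, LinearMap.smul_apply,
    Uop_single, Dop_single, Module.End.one_apply, map_add, map_smul, smul_add, smul_smul]
  rw [q_succ', ← pow_succ', add_assoc]
  rcases i with _ | i
  · simp [q]
  · simp only [Nat.add_sub_cancel]
    rw [← add_smul]; congr 2; ring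

theorem Dop_pow (j : ℕ) : ((Dop μ c) ^ j) (Finsupp.single (0, 0) 1) = Finsupp.single (0, j) 1 := by
  induction j with
  | zero => simp
  | succ j ih => rw [pow_succ', Module.End.mul_apply, ih, Dop_single]; simp [q]

theorem UD_pow (i j : ℕ) : ((Uop F) ^ i * (Dop μ c) ^ j) (Finsupp.single (0, 0) 1) = Finsupp.single (i, j) 1 := by
  rw [Module.End.mul_apply, Dop_pow]
  induction i with
  | zero => simp
  | succ i ih => rw [pow_succ', Module.End.mul_apply, ih, Uop_single]

/-- normal-ordering identity -/
theorem D_U_pow {R : Type} [Ring R] [Algebra F R] (U D : R) (rel : D * U = μ • (U * D) + c • (1 : R)) (i : ℕ) :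
    D * U ^ i = μ ^ i • (U ^ i * D) + (q μ i * c) • U ^ (i - 1) := by
  induction i with
  | zero => simp [q]
  | succ i ih =>
    rw [pow_succ', ← mul_assoc, rel, add_mul, smul_mul_assoc, mul_assoc, ih, q_succ']
    rcases i with _ | i
    · simp [q]
    · simp only [Nat.add_sub_cancel, smul_mul_assoc, mul_add, mul_smul_comm, smul_add, one_mul, smul_smul]
      rw [← pow_succ', add_assoc, ← mul_assoc, ← pow_succ', ← pow_succ', ← add_smul]
      congr 2; ring

theorem span_all {R : Type} [Ring R] [Algebra F R] (U D : R) (rel : D * U = μ • (U * D) + c • (1 : R))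
    (x : R) (hx : x ∈ Algebra.adjoin F ({U, D} : Set R)) :
    x ∈ Submodule.span F (Set.range fun p : ℕ × ℕ => U ^ p.1 * D ^ p.2) := by
  set S := Submodule.span F (Set.range fun p : ℕ × ℕ => U ^ p.1 * D ^ p.2) with hS
  have mem : ∀ i j, U ^ i * D ^ j ∈ S := fun i j => Submodule.subset_span ⟨(i, j), rfl⟩
  have key : ∀ y, (∀ i j, y * (U ^ i * D ^ j) ∈ S) → ∀ s ∈ S, y * s ∈ S := by
    intro y hy s hs
    induction hs using Submodule.span_induction with
    | mem x h => obtain ⟨⟨i, j⟩, rfl⟩ := h; exact hy i j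
    | zero => simp
    | add a b _ _ ha hb => rw [mul_add]; exact add_mem ha hb
    | smul a b _ hb => rw [mul_smul_comm]; exact S.smul_mem _ hb
  have : ∀ s ∈ S, x * s ∈ S := by
    induction hx using Algebra.adjoin_induction with
    | mem y hy =>
      apply key
      intro i j
      rcases hy with rfl | rfl
      · rw [← mul_assoc, ← pow_succ']; exact mem _ _
      · rw [← mul_assoc, D_U_pow μ c U y rel, add_mul, smul_mul_assoc, smul_mul_assoc, mul_assoc, ← pow_succ']
        exact add_mem (S.smul_mem _ (mem _ _)) (S.smul_mem _ (mem _ _))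
    | algebraMap r => intro s hs; rw [← Algebra.smul_def]; exact S.smul_mem _ hs
    | add a b _ _ ha hb => intro s hs; rw [add_mul]; exact add_mem (ha s hs) (hb s hs)
    | mul a b _ _ ha hb => intro s hs; rw [mul_assoc]; exact ha _ (hb s hs)
  have h := this 1 (by simpa using mem 0 0)
  simpa using h

section generic
variable {E M : Type} [Ring E] [Algebra F E] [AddCommGroup M] [Module F M] (U D : E)

abbrev Mod (F : Type) [Field F] {E : Type} [Ring E] [Algebra F E] (U D : E) : Subalgebra F E := Algebra.adjoin F ({U, D} : Set E)

def Um (F : Type) [Field F] {E : Type} [Ring E] [Algebra F E] (U D : E) : Mod F U D := ⟨U, Algebra.subset_adjoin (by simp)⟩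
def Dm (F : Type) [Field F] {E : Type} [Ring E] [Algebra F E] (U D : E) : Mod F U D := ⟨D, Algebra.subset_adjoin (by simp)⟩

theorem rel_m (rel : D * U = μ • (U * D) + c • (1 : E)) : Dm F U D * Um F U D = μ • (Um F U D * Dm F U D) + c • (1 : Mod F U D) := by
  apply Subtype.ext
  exact rel

theorem li_m (ev : E →ₗ[F] M) (hli : LinearIndependent F fun p : ℕ × ℕ => ev (U ^ p.1 * D ^ p.2)) :
    LinearIndependent F fun p : ℕ × ℕ => Um F U D ^ p.1 * Dm F U D ^ p.2 := by
  apply LinearIndependent.of_comp (ev ∘ₗ (Mod F U D).val.toLinearMap)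
  exact hli

theorem span_m (rel : D * U = μ • (U * D) + c • (1 : E)) :
    ⊤ ≤ Submodule.span F (Set.range fun p : ℕ × ℕ => Um F U D ^ p.1 * Dm F U D ^ p.2) := by
  rintro x -
  apply span_all μ c _ _ (rel_m μ c U D rel)
  have : (Algebra.adjoin F ({Um F U D, Dm F U D} : Set (Mod F U D))).map (Mod F U D).val = Mod F U D := by
    rw [AlgHom.map_adjoin]
    congr 1
    simp [Set.image_pair]
    rfl
  have hx : (x : E) ∈ (Algebra.adjoin F ({Um F U D, Dm F U D} : Set (Mod F U D))).map (Mod F U D).val := by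
    rw [this]; exact x.2
  obtain ⟨y, hy, hyx⟩ := hx
  have : y = x := Subtype.ext hyx
  rwa [← this]

noncomputable def model (rel : D * U = μ • (U * D) + c • (1 : E)) (ev : E →ₗ[F] M)
    (hli : LinearIndependent F fun p : ℕ × ℕ => ev (U ^ p.1 * D ^ p.2))
    (hμ : μ ≠ 0) (hq : ∀ i, 0 < i → (∑ k ∈ Finset.range i, μ ^ k) ≠ 0)
    (hcase : (μ = 1 ∧ c ≠ 0) ∨ (∀ n, 0 < n → μ ^ n ≠ 1)) : QW F (Mod F U D) where
  U := Um F U D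
  D := Dm F U D
  μ := μ
  c := c
  rel := rel_m μ c U D rel
  B := Module.Basis.mk (li_m U D ev hli) (span_m μ c U D rel)
  hB := by intro i j; simp
  hμ := hμ
  hq := hq
  hcase := hcase
end generic

theorem exists_model (hμ : μ ≠ 0) (hq : ∀ i, 0 < i → (∑ k ∈ Finset.range i, μ ^ k) ≠ 0)
    (hcase : (μ = 1 ∧ c ≠ 0) ∨ (∀ n, 0 < n → μ ^ n ≠ 1)) :
    ∃ (R : Type) (_ : Ring R) (_ : Algebra F R) (H : QW F R), H.μ = μ ∧ H.c = c :=
  ⟨_, _, _, model μ c (Uop F) (Dop μ c) (op_rel μ c) (LinearMap.applyₗ (Finsupp.single (0, 0) 1)) (by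
    have : (fun p : ℕ × ℕ => (LinearMap.applyₗ (Finsupp.single (0, 0) (1 : F)) : Module.End F (ℕ × ℕ →₀ F) →ₗ[F] (ℕ × ℕ →₀ F)) (Uop F ^ p.1 * Dop μ c ^ p.2)) =
      fun p => Finsupp.single p 1 := by
      ext1 ⟨i, j⟩
      exact UD_pow μ c i j
    rw [this]
    exact (Finsupp.basisSingleOne (R := F) (ι := ℕ × ℕ)).linearIndependent) hμ hq hcase, rfl, rfl⟩

end QWModel

end

section

open Polynomial

namespace DUA
variable {K : Type} [Field K] (μ : K)

abbrev AA (K : Type) [Field K] (μ : K) := DownUp K (1 + μ) (-μ) 0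
noncomputable abbrev dd : AA K μ := DownUp.D K (1 + μ) (-μ) 0
noncomputable abbrev uu : AA K μ := DownUp.U K (1 + μ) (-μ) 0
noncomputable def zz : AA K μ := dd μ * uu μ - μ • (uu μ * dd μ)
noncomputable def oo : AA K μ := dd μ * uu μ - uu μ * dd μ

theorem rel1 : dd μ * uu μ * uu μ = (1 + μ) • (uu μ * dd μ * uu μ) + (-μ) • (uu μ * uu μ * dd μ) := by
  have := RingQuot.mkAlgHom_rel K (DownUpRel.rel1 (K := K) (a := 1 + μ) (b := -μ) (g := 0))
  simpa [-neg_smul, DownUp.D, DownUp.U, map_add, map_mul, map_smul] using this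

theorem rel2 : dd μ * dd μ * uu μ = (1 + μ) • (dd μ * uu μ * dd μ) + (-μ) • (uu μ * dd μ * dd μ) := by
  have := RingQuot.mkAlgHom_rel K (DownUpRel.rel2 (K := K) (a := 1 + μ) (b := -μ) (g := 0))
  simpa [-neg_smul, DownUp.D, DownUp.U, map_add, map_mul, map_smul] using this

theorem adjoin_top : Algebra.adjoin K ({uu μ, dd μ} : Set (AA K μ)) = ⊤ := by
  have h := RingQuot.mkAlgHom_surjective K (DownUpRel K (1 + μ) (-μ) 0)
  rw [eq_top_iff]
  rintro x -
  obtain ⟨y, rfl⟩ := h x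
  induction y using FreeAlgebra.induction with
  | grade0 r => rw [AlgHom.commutes]; exact Subalgebra.algebraMap_mem _ _
  | grade1 i =>
    apply Algebra.subset_adjoin
    fin_cases i
    · right; rfl
    · left; rfl
  | mul a b ha hb => rw [map_mul]; exact mul_mem ha hb
  | add a b ha hb => rw [map_add]; exact add_mem ha hb

theorem z_u : zz μ * uu μ = uu μ * zz μ := by
  rw [zz, sub_mul, mul_sub, smul_mul_assoc, mul_smul_comm, rel1, ← mul_assoc, ← mul_assoc]
  module

theorem z_d : zz μ * dd μ = dd μ * zz μ := by
  rw [zz, sub_mul, mul_sub, smul_mul_assoc, mul_smul_comm, ← mul_assoc, ← mul_assoc, rel2]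
  module

theorem o_eq : oo μ = zz μ + (μ - 1) • (uu μ * dd μ) := by
  rw [oo, zz]; module

theorem ind_adj {P : AA K μ → Prop} (hu : P (uu μ)) (hd : P (dd μ)) (hc : ∀ r, P (algebraMap K _ r))
    (ha : ∀ x y, P x → P y → P (x + y)) (hm : ∀ x y, P x → P y → P (x * y)) (x : AA K μ) : P x := by
  have hx : x ∈ Algebra.adjoin K ({uu μ, dd μ} : Set (AA K μ)) := by rw [adjoin_top]; trivial
  induction hx using Algebra.adjoin_induction with
  | mem y hy => rcases hy with rfl | rfl <;> assumption
  | algebraMap r => exact hc r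
  | add a b _ _ h1 h2 => exact ha _ _ h1 h2
  | mul a b _ _ h1 h2 => exact hm _ _ h1 h2

theorem z_comm (x : AA K μ) : zz μ * x = x * zz μ := by
  induction x using ind_adj with
  | hu => exact z_u μ
  | hd => exact z_d μ
  | hc r => exact (Algebra.commutes r _).symm
  | ha x y hx hy => rw [mul_add, add_mul, hx, hy]
  | hm x y hx hy => rw [← mul_assoc, hx, mul_assoc, hy, mul_assoc]

theorem az_comm (p : K[X]) (x : AA K μ) : aeval (zz μ) p * x = x * aeval (zz μ) p := by
  induction p using Polynomial.induction_on' with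
  | add p q hp hq => rw [map_add, add_mul, mul_add, hp, hq]
  | monomial n a =>
    rw [aeval_monomial, mul_assoc, (Commute.pow_left (z_comm μ x : Commute _ _) n).eq, ← mul_assoc, Algebra.commutes, mul_assoc]

theorem o_u : oo μ * uu μ = μ • (uu μ * oo μ) := by
  rw [oo, sub_mul, mul_sub, rel1, ← mul_assoc, ← mul_assoc]; module

theorem d_o : dd μ * oo μ = μ • (oo μ * dd μ) := by
  rw [oo, sub_mul, mul_sub, ← mul_assoc, rel2, ← mul_assoc]; module

theorem o_norm (hμ : μ ≠ 0) (x : AA K μ) : ∃ y, x * oo μ = oo μ * y := by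
  induction x using ind_adj with
  | hu => exact ⟨μ⁻¹ • uu μ, by rw [mul_smul_comm, o_u, smul_smul, inv_mul_cancel₀ hμ, one_smul]⟩
  | hd => exact ⟨μ • dd μ, by rw [mul_smul_comm, d_o]⟩
  | hc r => exact ⟨algebraMap K _ r, Algebra.commutes _ _⟩
  | ha x y hx hy => obtain ⟨a, ha⟩ := hx; obtain ⟨b, hb⟩ := hy; exact ⟨a + b, by rw [add_mul, ha, hb, mul_add]⟩
  | hm x y hx hy =>
    obtain ⟨a, ha⟩ := hx; obtain ⟨b, hb⟩ := hy; exact ⟨a * b, by rw [mul_assoc, hb, ← mul_assoc, ha, mul_assoc]⟩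

theorem o_norm_l (hμ : μ ≠ 0) (x : AA K μ) : ∃ y, oo μ * x = y * oo μ := by
  induction x using ind_adj with
  | hu => exact ⟨μ • uu μ, by rw [smul_mul_assoc, o_u]⟩
  | hd => exact ⟨μ⁻¹ • dd μ, by rw [smul_mul_assoc, d_o, smul_smul, inv_mul_cancel₀ hμ, one_smul]⟩
  | hc r => exact ⟨algebraMap K _ r, (Algebra.commutes _ _).symm⟩
  | ha x y hx hy => obtain ⟨a, ha⟩ := hx; obtain ⟨b, hb⟩ := hy; exact ⟨a + b, by rw [mul_add, ha, hb, add_mul]⟩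
  | hm x y hx hy =>
    obtain ⟨a, ha⟩ := hx; obtain ⟨b, hb⟩ := hy; exact ⟨a * b, by rw [← mul_assoc, ha, mul_assoc, hb, mul_assoc]⟩

theorem d_u_pow (i : ℕ) : dd μ * uu μ ^ i = μ ^ i • (uu μ ^ i * dd μ) + QWModel.q μ i • (uu μ ^ (i - 1) * zz μ) := by
  have rel : dd μ * uu μ = μ • (uu μ * dd μ) + zz μ := by rw [zz]; abel
  induction i with
  | zero => simp [QWModel.q]
  | succ i ih =>
    rw [pow_succ', ← mul_assoc, rel, add_mul, smul_mul_assoc, mul_assoc, ih, QWModel.q_succ']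
    rcases i with _ | i
    · simp [QWModel.q]
    · have h2 : zz μ * uu μ ^ (i + 1) = uu μ ^ (i + 1) * zz μ := z_comm μ _
      rw [h2]
      simp only [Nat.add_sub_cancel, mul_add, mul_smul_comm, smul_add, smul_smul, ← mul_assoc, ← pow_succ']
      module

/-- evaluation of formal normal forms -/
noncomputable def nf : (ℕ × ℕ →₀ K[X]) →ₗ[K] AA K μ :=
  Finsupp.lsum K fun ij => LinearMap.mulRight K (dd μ ^ ij.2) ∘ₗ LinearMap.mulLeft K (uu μ ^ ij.1) ∘ₗ (aeval (zz μ)).toLinearMap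

theorem nf_single (i j : ℕ) (p : K[X]) : nf μ (Finsupp.single (i, j) p) = uu μ ^ i * aeval (zz μ) p * dd μ ^ j := by
  simp [nf]

theorem nf_surj : Function.Surjective (nf μ) := by
  rw [← LinearMap.range_eq_top]
  set S := LinearMap.range (nf μ) with hS
  have mem : ∀ i j (p : K[X]), uu μ ^ i * aeval (zz μ) p * dd μ ^ j ∈ S := fun i j p => ⟨_, nf_single μ i j p⟩
  have key : ∀ y, (∀ i j (p : K[X]), y * (uu μ ^ i * aeval (zz μ) p * dd μ ^ j) ∈ S) → ∀ s ∈ S, y * s ∈ S := by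
    rintro y hy s ⟨P, rfl⟩
    induction P using Finsupp.induction_linear with
    | zero => simp
    | add f g hf hg => rw [map_add, mul_add]; exact add_mem hf hg
    | single ij p => obtain ⟨i, j⟩ := ij; rw [nf_single]; exact hy i j p
  have : ∀ x, ∀ s ∈ S, x * s ∈ S := by
    intro x
    induction x using ind_adj with
    | hu => apply key; intro i j p; rw [← mul_assoc, ← mul_assoc, ← pow_succ']; exact mem _ _ _
    | hd =>
      apply key; intro i j p
      rw [← mul_assoc, ← mul_assoc, d_u_pow, add_mul, add_mul, smul_mul_assoc, smul_mul_assoc, smul_mul_assoc, smul_mul_assoc]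
      refine add_mem (S.smul_mem _ ?_) (S.smul_mem _ ?_)
      · rw [mul_assoc (uu μ ^ i), ← az_comm, ← mul_assoc, mul_assoc, ← pow_succ']; exact mem _ _ _
      · have := mem (i - 1) j (X * p)
        rwa [map_mul, aeval_X, ← mul_assoc] at this
    | hc r => intro s hs; rw [← Algebra.smul_def]; exact S.smul_mem _ hs
    | ha a b ha hb => intro s hs; rw [add_mul]; exact add_mem (ha s hs) (hb s hs)
    | hm a b ha hb => intro s hs; rw [mul_assoc]; exact ha _ (hb s hs)
  rw [eq_top_iff]
  rintro x -
  simpa using this x 1 (by simpa using mem 0 0 1)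

end DUA

end

section

open Polynomial

namespace DUA
variable {K : Type} [Field K] 

structure Rep (μ : K) {F : Type} [Field F] (R : Type) [Ring R] [Algebra F R] (θ : K[X] →+* F) where
  H : QW F R
  φ : AA K μ →+* R
  hU : φ (uu μ) = H.U
  hD : φ (dd μ) = H.D
  hz : ∀ p, φ (aeval (zz μ) p) = algebraMap F R (θ p)

theorem exists_rep (μ : K) {F : Type} [Field F] (θ : K[X] →+* F) (hμ : θ (C μ) ≠ 0)
    (hq : ∀ i, 0 < i → (∑ k ∈ Finset.range i, (θ (C μ)) ^ k) ≠ 0)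
    (hcase : (θ (C μ) = 1 ∧ θ X ≠ 0) ∨ (∀ n, 0 < n → (θ (C μ)) ^ n ≠ 1)) :
    ∃ (R : Type) (_ : Ring R) (_ : Algebra F R), Nonempty (Rep μ R θ) := by
  obtain ⟨R, iR, iA, H, h1, h2⟩ := QWModel.exists_model (θ (C μ)) (θ X) hμ hq hcase
  refine ⟨R, iR, iA, ⟨?_⟩⟩
  letI : Algebra K R := RingHom.toAlgebra' ((algebraMap F R).comp (θ.comp C)) (fun c x => Algebra.commutes _ _)
  have hs : ∀ (k : K) (x : R), k • x = θ (C k) • x := by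
    intro k x
    rw [Algebra.smul_def, Algebra.smul_def]; rfl
  have hrel := H.rel
  rw [h1, h2] at hrel
  have e1 : H.D * H.U * H.U = (1 + μ) • (H.U * H.D * H.U) + (-μ) • (H.U * H.U * H.D) := by
    rw [hs, hs, map_neg, map_neg, map_add, map_add, C_1, map_one, mul_assoc H.U, hrel, mul_assoc H.U H.U H.D]
    simp only [add_mul, mul_add, smul_mul_assoc, mul_smul_comm, one_mul, mul_one, mul_assoc, hrel]
    module
  have e2 : H.D * H.D * H.U = (1 + μ) • (H.D * H.U * H.D) + (-μ) • (H.U * H.D * H.D) := by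
    rw [hs, hs, map_neg, map_neg, map_add, map_add, C_1, map_one, mul_assoc H.D H.D, hrel]
    simp only [add_mul, mul_add, smul_mul_assoc, mul_smul_comm, one_mul, mul_one, ← mul_assoc, hrel]
    module
  let f : AA K μ →ₐ[K] R := RingQuot.liftAlgHom K ⟨FreeAlgebra.lift K ![H.D, H.U], by
    intro x y hxy
    cases hxy
    · simpa [-neg_smul] using e1
    · simpa [-neg_smul] using e2⟩
  have fU : f (uu μ) = H.U := by simp [f, DownUp.U]
  have fD : f (dd μ) = H.D := by simp [f, DownUp.D]
  have fz : f (zz μ) = algebraMap F R (θ X) := by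
    rw [zz, map_sub, map_smul, map_mul, map_mul, fU, fD, hrel, hs, Algebra.algebraMap_eq_smul_one]; abel
  refine ⟨H, f.toRingHom, fU, fD, ?_⟩
  intro p
  induction p using Polynomial.induction_on' with
  | add p q hp hq => rw [map_add, map_add, hp, hq, map_add, map_add]
  | monomial n a =>
    rw [aeval_monomial]
    change f (algebraMap K _ a * zz μ ^ n) = _
    rw [map_mul, map_pow, fz, AlgHom.commutes, ← C_mul_X_pow_eq_monomial, map_mul, map_mul, map_pow, map_pow]
    rfl

namespace Rep
variable {μ : K} {F : Type} [Field F] {R : Type} [Ring R] [Algebra F R] {θ : K[X] →+* F} (P : Rep μ R θ)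

theorem map_oo : P.φ (oo μ) = P.H.om := by
  rw [oo, QW.om, map_sub, map_mul, map_mul, P.hU, P.hD]

theorem repr_nf (f : ℕ × ℕ →₀ K[X]) (p : ℕ × ℕ) : P.H.B.repr (P.φ (nf μ f)) p = θ (f p) := by
  induction f using Finsupp.induction_linear with
  | zero => simp
  | add f g hf hg => simp [hf, hg]
  | single ij q =>
    obtain ⟨i, j⟩ := ij
    have h : P.φ (uu μ ^ i * aeval (zz μ) q * dd μ ^ j) = θ q • P.H.B (i, j) := by
      rw [map_mul P.φ, map_mul P.φ, map_pow P.φ, map_pow P.φ, P.hU, P.hD, P.hz, ← Algebra.commutes, mul_assoc, ← Algebra.smul_def, ← P.H.hB]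
    rw [nf_single, h]
    simp only [map_smul, Module.Basis.repr_self, Finsupp.smul_single, smul_eq_mul, mul_one, Finsupp.single_apply]
    split_ifs <;> simp

theorem nf_eq_zero (f : ℕ × ℕ →₀ K[X]) : P.φ (nf μ f) = 0 ↔ ∀ p, θ (f p) = 0 := by
  rw [← map_eq_zero_iff _ P.H.B.repr.injective, Finsupp.ext_iff]
  simp only [repr_nf, Finsupp.coe_zero, Pi.zero_apply]

theorem φ_inj (hθ : Function.Injective θ) : Function.Injective P.φ := by
  rw [injective_iff_map_eq_zero]
  intro a ha
  obtain ⟨f, rfl⟩ := nf_surj μ a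
  rw [nf_eq_zero] at ha
  have : f = 0 := by ext1 p; exact hθ (by rw [ha p]; simp)
  rw [this, map_zero]

theorem φ_algebraMap (k : K) : P.φ (algebraMap K _ k) = algebraMap F R (θ (C k)) := by
  rw [← P.hz, aeval_C]

theorem one_ne_zero' (P : Rep μ R θ) : (1 : R) ≠ 0 := by
  have h := P.H.hB 0 0
  simp only [pow_zero, mul_one] at h
  rw [← h]; exact P.H.B.ne_zero _

theorem φ_surj (hθ : Function.Surjective θ) : Function.Surjective P.φ := by
  intro r
  refine P.H.ind (P := fun r => ∃ a, P.φ a = r) ?_ ?_ ?_ ?_ r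
  · intro i j; exact ⟨uu μ ^ i * dd μ ^ j, by rw [map_mul, map_pow, map_pow, P.hU, P.hD]⟩
  · rintro x y ⟨a, rfl⟩ ⟨b, rfl⟩; exact ⟨a + b, map_add _ _ _⟩
  · exact ⟨0, map_zero _⟩
  · rintro c x ⟨a, rfl⟩
    obtain ⟨p, rfl⟩ := hθ c
    exact ⟨aeval (zz μ) p * a, by rw [map_mul, P.hz, Algebra.smul_def]⟩

theorem clear [Algebra K[X] F] [IsFractionRing K[X] F] (hθ : θ = algebraMap K[X] F) (r : R) :
    ∃ p : K[X], p ≠ 0 ∧ ∃ a, P.φ a = θ p • r := by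
  refine P.H.ind (P := fun r => ∃ p : K[X], p ≠ 0 ∧ ∃ a, P.φ a = θ p • r) ?_ ?_ ?_ ?_ r
  · intro i j; exact ⟨1, one_ne_zero, uu μ ^ i * dd μ ^ j, by rw [map_mul, map_pow, map_pow, P.hU, P.hD]; simp⟩
  · rintro x y ⟨p, hp, a, ha⟩ ⟨q, hq, b, hb⟩
    refine ⟨p * q, mul_ne_zero hp hq, aeval (zz μ) q * a + aeval (zz μ) p * b, ?_⟩
    rw [map_add, map_mul, map_mul, P.hz, P.hz, ← Algebra.smul_def, ← Algebra.smul_def, ha, hb, smul_smul, smul_smul, smul_add, map_mul, mul_comm (θ q)]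
  · exact ⟨1, one_ne_zero, 0, by simp⟩
  · rintro c x ⟨p, hp, a, ha⟩
    obtain ⟨n, d, hd, rfl⟩ := IsFractionRing.div_surjective (A := K[X]) c
    refine ⟨d * p, mul_ne_zero (nonZeroDivisors.ne_zero hd) hp, aeval (zz μ) n * a, ?_⟩
    have hd' : algebraMap K[X] F d ≠ 0 := by
      simpa using nonZeroDivisors.ne_zero hd
    rw [map_mul, P.hz, ← Algebra.smul_def, ha, smul_smul, smul_smul]
    congr 1
    rw [hθ, map_mul]; field_simp

end Rep

theorem ker_eval {μ c : K} {R : Type} [Ring R] [Algebra K R] (P : Rep μ R (evalRingHom c)) (a : AA K μ) (ha : P.φ a = 0) :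
    ∃ b, a = (aeval (zz μ) (X - C c)) * b := by
  obtain ⟨f, rfl⟩ := nf_surj μ a
  rw [P.nf_eq_zero] at ha
  have : ∀ f : ℕ × ℕ →₀ K[X], (∀ p, (X - C c) ∣ f p) → ∃ b, nf μ f = (aeval (zz μ) (X - C c)) * b := by
    intro f hf
    have hr : nf μ f = f.sum fun p q => uu μ ^ p.1 * aeval (zz μ) q * dd μ ^ p.2 := by
      rw [nf, Finsupp.lsum_apply]; rfl
    choose g hg using hf
    refine ⟨f.sum fun p q => uu μ ^ p.1 * aeval (zz μ) (g p) * dd μ ^ p.2, ?_⟩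
    rw [hr, Finsupp.sum, Finsupp.sum, Finset.mul_sum]
    refine Finset.sum_congr rfl fun p _ => ?_
    rw [hg p, map_mul, ← mul_assoc, ← mul_assoc, ← mul_assoc, az_comm μ (X - C c) (uu μ ^ p.1)]
  exact this f fun p => dvd_iff_isRoot.2 (ha p)

/-- finitely many bad fibres -/
theorem finite_bad {μ : K} (a : AA K μ) (ha : a ≠ 0) : ∃ T : Finset K, ∀ c ∉ T, ∀ (R : Type) (_ : Ring R) (_ : Algebra K R) (P : Rep μ R (evalRingHom c)),
    P.φ a ≠ 0 := by
  classical
  obtain ⟨f, rfl⟩ := nf_surj μ a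
  have : f ≠ 0 := by rintro rfl; exact ha (map_zero _)
  obtain ⟨p, hp⟩ := Finsupp.ne_iff.1 this
  refine ⟨(f p).roots.toFinset, ?_⟩
  intro c hc R _ _ P h
  rw [P.nf_eq_zero] at h
  apply hc
  rw [Multiset.mem_toFinset, mem_roots hp]
  exact h p

end DUA

end

section

open Polynomial

namespace DUA
variable {K : Type} [Field K] (μ : K)

noncomputable def pp : AA K μ →ₐ[K] K[X][X] := piC K (1 + μ) (-μ) (by ring)

theorem pp_d : pp μ (dd μ) = C X := piC_D _ _ _ _
theorem pp_u : pp μ (uu μ) = X := piC_U _ _ _ _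
theorem pp_surj : Function.Surjective (pp μ) := piC_surj _ _ _ _
theorem pp_o : pp μ (oo μ) = 0 := by rw [oo, map_sub, map_mul, map_mul, pp_d, pp_u, mul_comm, sub_self]

noncomputable def sec : K[X][X] →ₗ[K] AA K μ := Polynomial.lsum fun n => LinearMap.mulLeft K (uu μ ^ n) ∘ₗ (aeval (dd μ)).toLinearMap

theorem sec_monomial (n : ℕ) (p : K[X]) : sec μ (monomial n p) = uu μ ^ n * aeval (dd μ) p := by
  simp [sec, Polynomial.sum_monomial_index]

theorem comm_u (hμ : μ ≠ 0) (n : ℕ) : ∃ b, dd μ * uu μ ^ n = uu μ ^ n * dd μ + oo μ * b := by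
  induction n with
  | zero => exact ⟨0, by simp⟩
  | succ n ih =>
    obtain ⟨b, hb⟩ := ih
    obtain ⟨y, hy⟩ := o_norm μ hμ (uu μ)
    refine ⟨uu μ ^ n + y * b, ?_⟩
    have : dd μ * uu μ = uu μ * dd μ + oo μ := by rw [oo]; abel
    rw [pow_succ', ← mul_assoc, this, add_mul, mul_assoc, hb, mul_add, ← mul_assoc, ← mul_assoc, hy, mul_add, ← mul_assoc]
    abel

theorem sec_mul (hμ : μ ≠ 0) (a : AA K μ) : ∀ f, ∃ b, a * sec μ f = sec μ (pp μ a * f) + oo μ * b := by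
  induction a using ind_adj with
  | hu =>
    intro f
    refine ⟨0, ?_⟩
    rw [mul_zero, add_zero, pp_u]
    induction f using Polynomial.induction_on' with
    | add p q hp hq => rw [map_add, mul_add, mul_add, map_add, hp, hq]
    | monomial n p => rw [X_mul_monomial, sec_monomial, sec_monomial, ← mul_assoc, pow_succ']
  | hd =>
    intro f
    rw [pp_d]
    induction f using Polynomial.induction_on' with
    | add p q hp hq =>
      obtain ⟨b, hb⟩ := hp
      obtain ⟨b', hb'⟩ := hq
      refine ⟨b + b', ?_⟩
      rw [map_add, mul_add, mul_add, map_add, hb, hb', mul_add]; abel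
    | monomial n p =>
      obtain ⟨b, hb⟩ := comm_u μ hμ n
      refine ⟨b * aeval (dd μ) p, ?_⟩
      rw [C_mul_monomial, sec_monomial, sec_monomial, ← mul_assoc, hb, map_mul, aeval_X, add_mul, mul_assoc, mul_assoc]
  | hc r =>
    intro f
    refine ⟨0, ?_⟩
    rw [AlgHom.commutes, ← Algebra.smul_def, ← Algebra.smul_def, map_smul]; simp
  | ha x y hx hy =>
    intro f
    obtain ⟨b, hb⟩ := hx f
    obtain ⟨b', hb'⟩ := hy f
    refine ⟨b + b', ?_⟩
    rw [add_mul, hb, hb', map_add, add_mul, map_add, mul_add]; abel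
  | hm x y hx hy =>
    intro f
    obtain ⟨b', hb'⟩ := hy f
    obtain ⟨b, hb⟩ := hx (pp μ y * f)
    obtain ⟨w, hw⟩ := o_norm μ hμ x
    refine ⟨b + w * b', ?_⟩
    rw [mul_assoc, hb', mul_add, hb, ← mul_assoc x, hw, map_mul (pp μ), mul_add, mul_assoc (pp μ x), mul_assoc (oo μ)]; abel

theorem ker_pp (hμ : μ ≠ 0) (a : AA K μ) (h : pp μ a = 0) : ∃ b, a = oo μ * b := by
  obtain ⟨b, hb⟩ := sec_mul μ hμ a 1
  rw [h, zero_mul, map_zero, zero_add, ← C_1, ← monomial_zero_left, sec_monomial] at hb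
  exact ⟨b, by simpa using hb⟩

end DUA

/-- avoidance of finitely many subspaces along the curve `x + s y + s² w` -/
theorem avoid {K A : Type} [Field K] [Infinite K] [AddCommGroup A] [Module K A] (T : Set (Submodule K A)) (hT : T.Finite)
    (x y w : A) (h : ∀ S ∈ T, ¬ (x ∈ S ∧ y ∈ S ∧ w ∈ S)) : ∃ s : K, ∀ S ∈ T, x + s • y + (s ^ 2) • w ∉ S := by
  classical
  by_contra hcon
  push Not at hcon
  have hfin : (⋃ S ∈ T, {s : K | x + s • y + (s ^ 2) • w ∈ S}).Finite := by
    refine hT.biUnion fun S hS => ?_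
    by_contra hinf
    have hinf : Set.Infinite {s : K | x + s • y + (s ^ 2) • w ∈ S} := hinf
    obtain ⟨t, ht, hc⟩ := hinf.exists_subset_card_eq 3
    obtain ⟨a, b, c, hab, hac, hbc, rfl⟩ := Finset.card_eq_three.1 hc
    have ha : x + a • y + (a ^ 2) • w ∈ S := ht (by simp)
    have hb : x + b • y + (b ^ 2) • w ∈ S := ht (by simp)
    have hc : x + c • y + (c ^ 2) • w ∈ S := ht (by simp)
    have h1 : y + (a + b) • w ∈ S := by
      have := S.sub_mem ha hb
      rw [show x + a • y + (a ^ 2) • w - (x + b • y + (b ^ 2) • w) = (a - b) • (y + (a + b) • w) by module] at this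
      exact (Submodule.smul_mem_iff _ (sub_ne_zero.2 hab)).1 this
    have h2 : y + (a + c) • w ∈ S := by
      have := S.sub_mem ha hc
      rw [show x + a • y + (a ^ 2) • w - (x + c • y + (c ^ 2) • w) = (a - c) • (y + (a + c) • w) by module] at this
      exact (Submodule.smul_mem_iff _ (sub_ne_zero.2 hac)).1 this
    have hw : w ∈ S := by
      have := S.sub_mem h1 h2
      rw [show y + (a + b) • w - (y + (a + c) • w) = (b - c) • w by module] at this
      exact (Submodule.smul_mem_iff _ (sub_ne_zero.2 hbc)).1 this
    have hy : y ∈ S := by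
      have := S.sub_mem h1 (S.smul_mem (a + b) hw)
      simpa using this
    have hx : x ∈ S := by
      have := S.sub_mem (S.sub_mem ha (S.smul_mem (a ^ 2) hw)) (S.smul_mem a hy)
      simpa using this
    exact h S hS ⟨hx, hy, hw⟩
  obtain ⟨s, hs⟩ := hfin.infinite_compl.nonempty
  obtain ⟨S, hS, hmem⟩ := hcon s
  exact hs (Set.mem_biUnion hS hmem)

theorem comm_finite {K : Type} [Field K] (p q : K[X][X]) (hp : p ≠ 0) (hq : ∀ P ∈ (Ideal.span {p}).minimalPrimes, q ∉ P) :
    {M : Ideal K[X][X] | M.IsMaximal ∧ p ∈ M ∧ q ∈ M}.Finite := by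
  refine (Ideal.finite_minimalPrimes_of_isNoetherianRing K[X][X] (Ideal.span {p, q})).subset ?_
  rintro M ⟨hM, hpM, hqM⟩
  have hMp : M.IsPrime := hM.isPrime
  obtain ⟨P', hP', hPM⟩ := Ideal.exists_minimalPrimes_le (I := Ideal.span {p, q}) (J := M) (by
    rw [Ideal.span_le]; rintro x (rfl | rfl) <;> assumption)
  have hP'p : P'.IsPrime := hP'.1.1
  have hpP' : p ∈ P' := hP'.1.2 (Ideal.subset_span (by simp))
  have hqP' : q ∈ P' := hP'.1.2 (Ideal.subset_span (by simp))
  obtain ⟨P, hP, hPP⟩ := Ideal.exists_minimalPrimes_le (I := Ideal.span {p}) (J := P') (by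
    rw [Ideal.span_le]; rintro x rfl; assumption)
  have hPp : P.IsPrime := hP.1.1
  have hpP : p ∈ P := hP.1.2 (Ideal.subset_span (by simp))
  by_cases hE : P' = M
  · rwa [← hE]
  exfalso
  have h1 : (⊥ : Ideal K[X][X]) < P := bot_lt_iff_ne_bot.2 fun h => hp (by rw [h] at hpP; simpa using hpP)
  have h2 : P < P' := lt_of_le_of_ne hPP fun h => hq P hP (h ▸ hqP')
  have h3 : P' < M := lt_of_le_of_ne hPM hE
  let L : LTSeries (PrimeSpectrum K[X][X]) := ⟨3, ![⟨⊥, Ideal.isPrime_bot⟩, ⟨P, hPp⟩, ⟨P', hP'p⟩, ⟨M, hMp⟩], by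
    intro i
    fin_cases i
    · exact h1
    · exact h2
    · exact h3⟩
  have hL := Order.LTSeries.length_le_krullDim L
  have hd : ringKrullDim K[X][X] = 2 := by
    rw [Polynomial.ringKrullDim_of_isNoetherianRing, Polynomial.ringKrullDim_of_isNoetherianRing, ringKrullDim_eq_zero_of_field]; rfl
  rw [ringKrullDim] at hd
  rw [hd] at hL
  have : (3 : WithBot ℕ∞) ≤ 2 := hL
  exact absurd this (by decide)

end

section

open Polynomial

namespace DUA
variable {K : Type} [Field K] (μ : K)

theorem o_norm_pow (hμ : μ ≠ 0) (k : ℕ) (x : AA K μ) : ∃ y, x * oo μ ^ k = oo μ ^ k * y := by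
  induction k generalizing x with
  | zero => exact ⟨x, by simp⟩
  | succ k ih =>
    obtain ⟨y, hy⟩ := ih x
    obtain ⟨w, hw⟩ := o_norm μ hμ y
    exact ⟨w, by rw [pow_succ, ← mul_assoc, hy, mul_assoc, hw, mul_assoc]⟩

theorem final_step [IsAlgClosed K] (hμ : μ ≠ 0) (I : Submodule K (AA K μ)) (hI : QW.IsR I) (f : K[X]) (hf : f ≠ 0)
    (h1 : ∃ i ∈ I, ∃ b, 1 = i + oo μ * b)
    (h2 : ∀ c, f.IsRoot c → ∃ k, ∃ i ∈ I, ∃ b, oo μ ^ k = i + aeval (zz μ) (X - C c) * b)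
    (k : ℕ) (h3 : aeval (zz μ) f * oo μ ^ k ∈ I) : (1 : AA K μ) ∈ I := by
  obtain ⟨i0, hi0, b0, h0⟩ := h1
  -- A = I + A o^k
  have ha1 : ∀ x : AA K μ, ∃ i ∈ I, ∃ b, x = i + b * oo μ := by
    intro x
    obtain ⟨y, hy⟩ := o_norm_l μ hμ (b0 * x)
    refine ⟨i0 * x, hI _ hi0 _, y, ?_⟩
    rw [← hy, ← mul_assoc, ← add_mul, ← h0, one_mul]
  have ha : ∀ k, ∀ x : AA K μ, ∃ i ∈ I, ∃ b, x = i + b * oo μ ^ k := by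
    intro k
    induction k with
    | zero => intro x; exact ⟨0, I.zero_mem, x, by simp⟩
    | succ k ih =>
      intro x
      obtain ⟨i, hi, b, hb⟩ := ih x
      obtain ⟨i', hi', b', hb'⟩ := ha1 b
      refine ⟨i + i' * oo μ ^ k, I.add_mem hi (hI _ hi' _), b', ?_⟩
      rw [hb, hb', add_mul, pow_succ', mul_assoc, add_assoc]
  have hb : ∀ c, f.IsRoot c → ∃ i ∈ I, ∃ b, 1 = i + aeval (zz μ) (X - C c) * b := by
    intro c hc
    obtain ⟨k, i', hi', b', hb'⟩ := h2 c hc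
    obtain ⟨i, hi, b, hb⟩ := ha k 1
    obtain ⟨y, hy⟩ := o_norm_pow μ hμ k b
    refine ⟨i + i' * y, I.add_mem hi (hI _ hi' _), b' * y, ?_⟩
    rw [hb, hy, hb', add_mul, mul_assoc, add_assoc]
  have hc : ∀ s : Multiset K, (∀ c ∈ s, f.IsRoot c) → ∃ i ∈ I, ∃ b, 1 = i + aeval (zz μ) (s.map fun c => X - C c).prod * b := by
    intro s
    induction s using Multiset.induction_on with
    | empty => intro _; exact ⟨0, I.zero_mem, 1, by simp⟩
    | cons c s ih =>
      intro hs
      obtain ⟨i, hi, b, hb⟩ := hb c (hs c (Multiset.mem_cons_self _ _))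
      obtain ⟨i', hi', b', hb'⟩ := ih fun c hc => hs c (Multiset.mem_cons_of_mem hc)
      refine ⟨i + i' * (aeval (zz μ) (X - C c) * b), I.add_mem hi (hI _ hi' _), b' * b, ?_⟩
      rw [Multiset.map_cons, Multiset.prod_cons, map_mul, az_comm μ (X - C c) (aeval (zz μ) _), add_assoc]
      conv_lhs => rw [hb, ← one_mul (aeval (zz μ) (X - C c) * b), hb']
      rw [add_mul]
      congr 2
      rw [mul_assoc, mul_assoc, ← mul_assoc b', ← az_comm, mul_assoc]
  have hd : ∃ i ∈ I, ∃ b, 1 = i + aeval (zz μ) f * b := by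
    obtain ⟨i, hi, b, hb⟩ := hc f.roots fun c hc => (mem_roots hf).1 hc
    have hl : f.leadingCoeff ≠ 0 := leadingCoeff_ne_zero.2 hf
    refine ⟨i, hi, algebraMap K _ (f.leadingCoeff)⁻¹ * b, ?_⟩
    have hfac := (IsAlgClosed.splits f).eq_prod_roots
    have e : aeval (zz μ) f = aeval (zz μ) (f.roots.map fun c => X - C c).prod * algebraMap K _ f.leadingCoeff := by
      conv_lhs => rw [hfac]
      rw [map_mul, aeval_C, Algebra.commutes]
    rw [e, mul_assoc, ← mul_assoc (algebraMap K _ f.leadingCoeff), ← map_mul, mul_inv_cancel₀ hl, map_one, one_mul, ← hb]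
  obtain ⟨i, hi, b, hb⟩ := hd
  have ho : oo μ ^ k ∈ I := by
    obtain ⟨y, hy⟩ := o_norm_pow μ hμ k b
    have : oo μ ^ k = i * oo μ ^ k + aeval (zz μ) f * oo μ ^ k * y := by
      rw [mul_assoc, ← hy, ← mul_assoc, ← add_mul, ← hb, one_mul]
    rw [this]
    exact I.add_mem (hI _ hi _) (hI _ h3 _)
  obtain ⟨i, hi, b, hb⟩ := ha k 1
  obtain ⟨y, hy⟩ := o_norm_pow μ hμ k b
  rw [hb, hy]
  exact I.add_mem hi (hI _ ho _)

theorem crt (T : Finset K) (s : K → AA K μ) : ∃ r, ∀ c ∈ T, ∃ b, r = s c + aeval (zz μ) (X - C c) * b := by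
  classical
  induction T using Finset.induction_on with
  | empty => exact ⟨0, by simp⟩
  | insert c T hc ih =>
    obtain ⟨r, hr⟩ := ih
    set G : K[X] := ∏ c' ∈ T, (X - C c') with hG
    have hGc : G.eval c ≠ 0 := by
      rw [hG, eval_prod, Finset.prod_ne_zero_iff]
      intro a ha
      simp only [eval_sub, eval_X, eval_C, sub_ne_zero]
      rintro rfl; exact hc ha
    obtain ⟨Q, hQ⟩ : (X - C c) ∣ (C (G.eval c)⁻¹ * G - 1) := by
      rw [dvd_iff_isRoot]; simp [IsRoot.def, hGc]
    refine ⟨r + aeval (zz μ) (C (G.eval c)⁻¹ * G) * (s c - r), ?_⟩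
    intro c' hc'
    rw [Finset.mem_insert] at hc'
    rcases hc' with rfl | hc'
    · refine ⟨aeval (zz μ) Q * (s c' - r), ?_⟩
      rw [← mul_assoc, ← map_mul, ← hQ, map_sub, map_one, sub_mul, one_mul]; abel
    · obtain ⟨b, hb⟩ := hr c' hc'
      obtain ⟨G', hG'⟩ : (X - C c') ∣ G := Finset.dvd_prod_of_mem _ hc'
      refine ⟨b + aeval (zz μ) (C (G.eval c)⁻¹ * G') * (s c - r), ?_⟩
      rw [mul_add, ← mul_assoc, ← map_mul, ← add_assoc, ← hb, hG']
      congr 3; ring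

end DUA

end

section

open Polynomial

namespace DUA
variable {K : Type} [Field K] {μ : K}

theorem gen_merge {F R : Type} [Field F] [Ring R] [Algebra F R] [Algebra K[X] F] [IsFractionRing K[X] F]
    (P : Rep μ R (algebraMap K[X] F)) (v1 w2 m3 m4 : AA K μ) (hv1 : v1 ≠ 0)
    (p : K[X]) (hp : p ≠ 0) (k : ℕ)
    (h : ∃ a1 a2 a3 a4, aeval (zz μ) p * oo μ ^ k = v1 * a1 + w2 * a2 + m3 * a3 + m4 * a4) :
    ∃ r t, ∃ f : K[X], f ≠ 0 ∧ ∃ k b1 b2, aeval (zz μ) f * oo μ ^ k = v1 * b1 + (w2 + (m3 + m4 * r) * t) * b2 := by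
  have hinj : Function.Injective (algebraMap K[X] F) := IsFractionRing.injective _ _
  have hφ := P.φ_inj hinj
  obtain ⟨a1, a2, a3, a4, h⟩ := h
  have hA : ∀ a : R, ∃ s : F, s ≠ 0 ∧ s • a ∈ (AddMonoidHom.mrange (P.φ : AA K μ →+ R)) := by
    intro a
    obtain ⟨q, hq, x, hx⟩ := P.clear rfl a
    exact ⟨algebraMap K[X] F q, by simpa using hq, x, hx⟩
  have hp' : algebraMap K[X] F p ≠ 0 := by simpa using hp
  have hv1' : P.φ v1 ≠ 0 := fun h => hv1 (hφ (by rw [h, map_zero]))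
  obtain ⟨r', ⟨r, rfl⟩, k1, hk1⟩ := P.H.merge _ hA (QW.rg F (P.φ v1) ⊔ QW.rg F (P.φ w2)) ((QW.rg_isR _).sup (QW.rg_isR _)) (P.φ v1)
    (Submodule.mem_sup_left (QW.self_mem_rg _)) hv1' (P.φ m3) (P.φ m4) k (by
      rw [← Submodule.smul_mem_iff _ hp', Algebra.smul_def, ← P.hz, ← P.map_oo, ← map_pow, ← map_mul, h]
      simp only [map_add, map_mul]
      refine Submodule.add_mem_sup (Submodule.add_mem_sup (Submodule.add_mem_sup ?_ ?_) ?_) ?_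
      all_goals exact QW.rg_isR _ _ (QW.self_mem_rg _) _)
  obtain ⟨t', ⟨t, rfl⟩, k2, hk2⟩ := P.H.merge _ hA (QW.rg F (P.φ v1)) (QW.rg_isR _) (P.φ v1) (QW.self_mem_rg _) hv1'
    (P.φ w2) _ k1 hk1
  obtain ⟨x, ⟨y1, hy1⟩, y, ⟨y2, hy2⟩, hxy⟩ := Submodule.mem_sup.1 hk2
  simp only [LinearMap.mulLeft_apply] at hy1 hy2
  obtain ⟨p1, hp1, b1, hb1⟩ := P.clear rfl y1
  obtain ⟨p2, hp2, b2, hb2⟩ := P.clear rfl y2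
  refine ⟨r, t, p1 * p2, mul_ne_zero hp1 hp2, k2, aeval (zz μ) p2 * b1, aeval (zz μ) p1 * b2, hφ ?_⟩
  simp only [map_mul, map_add, map_pow, P.map_oo, P.hz, hb1, hb2, ← Algebra.smul_def, smul_mul_assoc]
  rw [← hxy, ← hy1, ← hy2]
  simp only [mul_smul_comm, smul_smul, smul_add, AddMonoidHom.coe_coe]
  rw [mul_comm (algebraMap K[X] F p2)]

theorem fibre_merge {c : K} {R : Type} [Ring R] [Algebra K R] (hμ : μ ≠ 0) (P : Rep μ R (evalRingHom c))
    (v1 v2 v3 u4 : AA K μ) (hv : P.φ v1 ≠ 0 ∨ P.φ v2 ≠ 0)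
    (h : ∃ a1 a2 a3 a4, 1 = v1 * a1 + v2 * a2 + v3 * a3 + u4 * a4) :
    ∃ s, ∃ k b1 b2 b3 b4, oo μ ^ k = v1 * b1 + v2 * b2 + (v3 + u4 * oo μ * s) * b3 + aeval (zz μ) (X - C c) * b4 := by
  obtain ⟨a1, a2, a3, a4, h⟩ := h
  have hs : Function.Surjective (evalRingHom c) := fun x => ⟨C x, by simp⟩
  have hsur := P.φ_surj hs
  obtain ⟨v, hvV, hv0⟩ : ∃ v ∈ QW.rg K (P.φ v1) ⊔ QW.rg K (P.φ v2), v ≠ 0 := by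
    rcases hv with hv | hv
    · exact ⟨_, Submodule.mem_sup_left (QW.self_mem_rg _), hv⟩
    · exact ⟨_, Submodule.mem_sup_right (QW.self_mem_rg _), hv⟩
  obtain ⟨a, ha⟩ := o_norm μ hμ a4
  obtain ⟨r', -, k, hk⟩ := P.H.merge ⊤ (fun a => ⟨1, one_ne_zero, trivial⟩) (QW.rg K (P.φ v1) ⊔ QW.rg K (P.φ v2)) ((QW.rg_isR _).sup (QW.rg_isR _)) v
    hvV hv0 (P.φ v3) (P.φ (u4 * oo μ)) 1 (by
      have h2 : oo μ = v1 * (a1 * oo μ) + v2 * (a2 * oo μ) + v3 * (a3 * oo μ) + (u4 * oo μ) * a := by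
        rw [mul_assoc u4, ← ha]
        simp only [← mul_assoc]
        rw [← add_mul, ← add_mul, ← add_mul, ← h, one_mul]
      rw [pow_one, ← P.map_oo, h2, map_add, map_add, map_add, map_mul P.φ v1, map_mul P.φ v2, map_mul P.φ v3, map_mul P.φ _ a]
      refine Submodule.add_mem_sup (Submodule.add_mem_sup (Submodule.add_mem_sup ?_ ?_) ?_) ?_
      · exact QW.rg_isR _ _ (QW.self_mem_rg _) _
      · exact QW.rg_isR _ _ (QW.self_mem_rg _) _
      · exact QW.rg_isR _ _ (QW.self_mem_rg _) _
      · rw [← h2]; exact QW.rg_isR _ _ (QW.self_mem_rg _) _)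
  obtain ⟨s, rfl⟩ := hsur r'
  obtain ⟨x, hx, y, ⟨y3, hy3⟩, hxy⟩ := Submodule.mem_sup.1 hk
  obtain ⟨x1, ⟨y1, hy1⟩, x2, ⟨y2, hy2⟩, hxx⟩ := Submodule.mem_sup.1 hx
  simp only [LinearMap.mulLeft_apply] at hy1 hy2 hy3
  obtain ⟨b1, rfl⟩ := hsur y1
  obtain ⟨b2, rfl⟩ := hsur y2
  obtain ⟨b3, rfl⟩ := hsur y3
  obtain ⟨b4, hb4⟩ := ker_eval P (oo μ ^ k - (v1 * b1 + v2 * b2 + (v3 + u4 * oo μ * s) * b3)) (by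
    rw [map_sub, map_pow, P.map_oo, ← hxy, ← hxx, ← hy1, ← hy2, ← hy3, sub_eq_zero]
    simp only [map_add, map_mul])
  exact ⟨s, k, b1, b2, b3, b4, by rw [← hb4]; abel⟩

theorem hq_of [CharZero K] (hc : μ = 1 ∨ ∀ n, 0 < n → μ ^ n ≠ 1) (i : ℕ) (hi : 0 < i) : (∑ k ∈ Finset.range i, μ ^ k) ≠ 0 := by
  rcases hc with rfl | hc
  · simp; omega
  · intro h
    have := geom_sum_mul μ i
    rw [h, zero_mul] at this
    exact hc i hi (sub_eq_zero.1 this.symm)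

theorem fibre_rep [CharZero K] (hμ : μ ≠ 0) (hc : μ = 1 ∨ ∀ n, 0 < n → μ ^ n ≠ 1) (c : K) (hg : μ = 1 → c ≠ 0) :
    ∃ (R : Type) (_ : Ring R) (_ : Algebra K R), Nonempty (Rep μ R (evalRingHom c)) := by
  apply exists_rep
  · simpa using hμ
  · intro i hi
    simpa using hq_of hc i hi
  · rcases hc with h | h
    · left; simpa [h] using hg h
    · right; simpa using h

theorem gen_rep [CharZero K] (hμ : μ ≠ 0) (hc : μ = 1 ∨ ∀ n, 0 < n → μ ^ n ≠ 1) :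
    ∃ (R : Type) (_ : Ring R) (_ : Algebra (FractionRing K[X]) R), Nonempty (Rep μ R (algebraMap K[X] (FractionRing K[X]))) := by
  have hinj : Function.Injective ((algebraMap K[X] (FractionRing K[X])).comp C) := by
    rw [RingHom.coe_comp]; exact (IsFractionRing.injective K[X] (FractionRing K[X])).comp C_injective
  apply exists_rep
  · simpa using hμ
  · intro i hi h
    apply hq_of hc i hi
    apply hinj
    rw [map_zero, ← h, map_sum]
    simp
  · rcases hc with h | h
    · left; simp [h]
    · right; intro n hn h1
      apply h n hn
      apply hinj
      simpa using h1

end DUA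

end

section

open Polynomial

namespace DUA
variable {K : Type} [Field K] {μ : K}

/-- the submodule `(z - c) A` -/
noncomputable def Sc (μ c : K) : Submodule K (AA K μ) := LinearMap.range (LinearMap.mulLeft K (aeval (zz μ) (X - C c)))

theorem Sc_map {c : K} {R : Type} [Ring R] [Algebra K R] (P : Rep μ R (evalRingHom c)) (a : AA K μ) : a ∈ Sc μ c ↔ P.φ a = 0 := by
  constructor
  · rintro ⟨b, rfl⟩
    rw [LinearMap.mulLeft_apply, map_mul, P.hz]; simp
  · intro h
    obtain ⟨b, hb⟩ := ker_eval P a h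
    exact ⟨b, hb.symm⟩

theorem choose_step [Infinite K] (u1 u2 u3 u4 : AA K μ) (h : ∃ a1 a2 a3 a4, 1 = u1 * a1 + u2 * a2 + u3 * a3 + u4 * a4)
    (hne : ¬ (u1 = 0 ∧ u3 = 0 ∧ u4 = 0)) :
    ∃ s1 s2 : K, ∃ T : Finset K, ∃ v1 w2 : AA K μ, v1 = u1 + s1 • u3 + (s1 ^ 2) • u4 ∧ w2 = u2 + s2 • u3 + (s2 ^ 2) • u4 ∧
      v1 ≠ 0 ∧ {M : Ideal K[X][X] | M.IsMaximal ∧ pp μ v1 ∈ M ∧ pp μ w2 ∈ M}.Finite ∧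
      ∀ (c : K) (R : Type) (_ : Ring R) (_ : Algebra K R) (P : Rep μ R (evalRingHom c)),
        (c ∉ T → P.φ v1 ≠ 0) ∧ (c ∈ T → P.φ w2 ≠ 0) := by
  classical
  obtain ⟨a1, a2, a3, a4, h⟩ := h
  -- choose v1
  have hv : ∃ s1 : K, u1 + s1 • u3 + (s1 ^ 2) • u4 ≠ 0 ∧ (pp μ (u1 + s1 • u3 + (s1 ^ 2) • u4) = 0 → pp μ u1 = 0 ∧ pp μ u3 = 0 ∧ pp μ u4 = 0) := by
    by_cases hz : pp μ u1 = 0 ∧ pp μ u3 = 0 ∧ pp μ u4 = 0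
    · obtain ⟨s, hs⟩ := avoid (K := K) {(⊥ : Submodule K (AA K μ))} (Set.finite_singleton _) u1 u3 u4 (by
        rintro S rfl; simpa using hne)
      exact ⟨s, fun h => hs ⊥ rfl (by rw [h]; exact Submodule.zero_mem _), fun _ => hz⟩
    · obtain ⟨s, hs⟩ := avoid (K := K) {LinearMap.ker (pp μ).toLinearMap} (Set.finite_singleton _) u1 u3 u4 (by
        rintro S rfl; simpa using hz)
      refine ⟨s, fun h => hs _ rfl (by rw [h]; exact Submodule.zero_mem _), fun h => (hs _ rfl ?_).elim⟩
      exact h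
  obtain ⟨s1, hv0, hvp⟩ := hv
  obtain ⟨v1, hv1⟩ : ∃ v1, v1 = u1 + s1 • u3 + (s1 ^ 2) • u4 := ⟨_, rfl⟩
  rw [← hv1] at hv0 hvp
  have hu1 : u1 = v1 - s1 • u3 - (s1 ^ 2) • u4 := by rw [hv1]; abel
  obtain ⟨T0, hT0⟩ := finite_bad v1 hv0
  set T := T0.filter fun c => ∃ (R : Type) (_ : Ring R) (_ : Algebra K R) (P : Rep μ R (evalRingHom c)), P.φ v1 = 0 with hT
  set Y : Set (Ideal K[X][X]) := if pp μ v1 = 0 then ∅ else (Ideal.span {pp μ v1}).minimalPrimes with hY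
  have hYfin : Y.Finite := by
    rw [hY]; split_ifs
    · exact Set.finite_empty
    · exact Ideal.finite_minimalPrimes_of_isNoetherianRing _ _
  obtain ⟨s2, hs2⟩ := avoid (K := K) (((fun I : Ideal K[X][X] => (I.restrictScalars K).comap (pp μ).toLinearMap) '' Y) ∪ (Sc μ '' (T : Set K)))
    ((hYfin.image _).union (T.finite_toSet.image _)) u2 u3 u4 (by
      rintro S (⟨I, hI, rfl⟩ | ⟨c, hc, rfl⟩)
      · rintro ⟨h2, h3, h4⟩
        replace h2 : pp μ u2 ∈ I := h2
        replace h3 : pp μ u3 ∈ I := h3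
        replace h4 : pp μ u4 ∈ I := h4
        rw [hY] at hI
        split_ifs at hI with h0
        · exact hI
        have hIp : I.IsPrime := hI.1.1
        have hv1I : pp μ v1 ∈ I := hI.1.2 (Ideal.subset_span rfl)
        have hu1I : pp μ u1 ∈ I := by
          rw [hu1, map_sub, map_sub, map_smul, map_smul]
          exact (I.restrictScalars K).sub_mem ((I.restrictScalars K).sub_mem hv1I ((I.restrictScalars K).smul_mem _ h3)) ((I.restrictScalars K).smul_mem _ h4)
        apply hIp.ne_top
        rw [Ideal.eq_top_iff_one, ← map_one (pp μ), h]
        simp only [map_add, map_mul]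
        exact I.add_mem (I.add_mem (I.add_mem (I.mul_mem_right _ hu1I) (I.mul_mem_right _ h2)) (I.mul_mem_right _ h3)) (I.mul_mem_right _ h4)
      · rintro ⟨h2, h3, h4⟩
        rw [hT, Finset.mem_coe, Finset.mem_filter] at hc
        obtain ⟨-, R, _, _, P, hP⟩ := hc
        have h1 : u1 ∈ Sc μ c := by
          rw [← Sc_map P] at hP
          rw [hu1]
          exact (Sc μ c).sub_mem ((Sc μ c).sub_mem hP ((Sc μ c).smul_mem _ h3)) ((Sc μ c).smul_mem _ h4)
        rw [Sc_map P] at h1 h2 h3 h4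
        apply P.one_ne_zero'
        rw [← map_one P.φ, h]
        simp [h1, h2, h3, h4])
  refine ⟨s1, s2, T, v1, _, hv1, rfl, hv0, ?_, ?_⟩
  · by_cases h0 : pp μ v1 = 0
    · obtain ⟨e1, e3, e4⟩ := hvp h0
      convert Set.finite_empty
      rw [Set.eq_empty_iff_forall_notMem]
      rintro M ⟨hM, -, hw⟩
      apply hM.ne_top
      rw [map_add, map_add, map_smul, map_smul, e3, e4, smul_zero, smul_zero, add_zero, add_zero] at hw
      rw [Ideal.eq_top_iff_one, ← map_one (pp μ), h]
      simp only [map_add, map_mul, e1, e3, e4, zero_mul, zero_add, add_zero]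
      exact M.mul_mem_right _ hw
    · refine comm_finite _ _ h0 fun I hI hw => ?_
      refine hs2 ((I.restrictScalars K).comap (pp μ).toLinearMap) (Or.inl ⟨I, ?_, rfl⟩) hw
      rw [hY, if_neg h0]; exact hI
  · intro c R _ _ P
    refine ⟨fun hc h0 => ?_, fun hc h0 => ?_⟩
    · by_cases hc0 : c ∈ T0
      · exact hc (Finset.mem_filter.2 ⟨hc0, R, _, _, P, h0⟩)
      · exact hT0 c hc0 R _ _ P h0
    · exact hs2 (Sc μ c) (Or.inr ⟨c, hc, rfl⟩) ((Sc_map P _).2 h0)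

theorem comm_step [Infinite K] (v1 v2 u3 u4 : AA K μ) (h : ∃ a1 a2 a3 a4, 1 = v1 * a1 + v2 * a2 + u3 * a3 + u4 * a4)
    (hfin : {M : Ideal K[X][X] | M.IsMaximal ∧ pp μ v1 ∈ M ∧ pp μ v2 ∈ M}.Finite) :
    ∃ s : K, Ideal.span {pp μ v1, pp μ v2, pp μ (u3 + s • u4)} = ⊤ := by
  obtain ⟨a1, a2, a3, a4, h⟩ := h
  obtain ⟨s, hs⟩ := avoid (K := K) ((fun I : Ideal K[X][X] => (I.restrictScalars K).comap (pp μ).toLinearMap) '' {M : Ideal K[X][X] | M.IsMaximal ∧ pp μ v1 ∈ M ∧ pp μ v2 ∈ M})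
    (hfin.image _) u3 u4 0 (by
      rintro S ⟨I, ⟨hM, h1, h2⟩, rfl⟩ ⟨h3, h4, -⟩
      replace h3 : pp μ u3 ∈ I := h3
      replace h4 : pp μ u4 ∈ I := h4
      apply hM.ne_top
      rw [Ideal.eq_top_iff_one, ← map_one (pp μ), h]
      simp only [map_add, map_mul]
      exact I.add_mem (I.add_mem (I.add_mem (I.mul_mem_right _ h1) (I.mul_mem_right _ h2)) (I.mul_mem_right _ h3)) (I.mul_mem_right _ h4))
  refine ⟨s, ?_⟩
  by_contra hne
  obtain ⟨M, hM, hle⟩ := Ideal.exists_le_maximal _ hne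
  refine hs _ ⟨M, ⟨hM, hle (Ideal.subset_span (by simp)), hle (Ideal.subset_span (by simp))⟩, rfl⟩ ?_
  rw [smul_zero, add_zero]
  exact hle (Ideal.subset_span (by simp))

end DUA

end

section

open Polynomial

namespace DUA
variable {K : Type} [Field K] {μ : K}

theorem remove_z (v : AA K μ → Prop) (f : K[X]) (hf : f ≠ 0) (k : ℕ) (h : v (aeval (zz μ) f * oo μ ^ k)) :
    ∃ f' : K[X], f' ≠ 0 ∧ (∀ c, f'.IsRoot c → μ = 1 → c ≠ 0) ∧ ∃ k, v (aeval (zz μ) f' * oo μ ^ k) := by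
  by_cases h1 : μ = 1
  · obtain ⟨q, hq, hnd⟩ := exists_eq_pow_rootMultiplicity_mul_and_not_dvd f hf 0
    refine ⟨q, ?_, ?_, rootMultiplicity 0 f + k, ?_⟩
    · rintro rfl; exact hnd (dvd_zero _)
    · rintro c hc - rfl
      exact hnd (dvd_iff_isRoot.2 hc)
    · have ho : oo μ = zz μ := by rw [o_eq, h1, sub_self, zero_smul, add_zero]
      rw [hq, C_0, sub_zero, map_mul, map_pow, aeval_X, ← ho, (Commute.pow_left (show oo μ * _ = _ * oo μ from by rw [ho]; exact z_comm μ _) _ : Commute _ _).eq, mul_assoc, ← pow_add] at h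
      rw [ho] at h ⊢
      exact h
  · exact ⟨f, hf, fun _ _ h => (h1 h).elim, k, h⟩

theorem main_up [IsAlgClosed K] [CharZero K] (hμ : μ ≠ 0) (hc : μ = 1 ∨ ∀ n, 0 < n → μ ^ n ≠ 1)
    (u1 u2 u3 u4 : AA K μ) (h : ∃ a1 a2 a3 a4, 1 = u1 * a1 + u2 * a2 + u3 * a3 + u4 * a4) :
    ∃ r1 r2 r3 y1 y2 y3, (u1 + u4 * r1) * y1 + (u2 + u4 * r2) * y2 + (u3 + u4 * r3) * y3 = 1 := by
  classical
  have hinf : Infinite K := IsAlgClosed.instInfinite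
  by_cases hne : u1 = 0 ∧ u3 = 0 ∧ u4 = 0
  · obtain ⟨rfl, rfl, rfl⟩ := hne
    obtain ⟨a1, a2, a3, a4, h⟩ := h
    exact ⟨0, 0, 0, 0, a2, 0, by rw [h]; simp⟩
  obtain ⟨s1, s2, T, v1, w2, hv1, hw2, hv1ne, hfin, hfib⟩ := choose_step u1 u2 u3 u4 h hne
  obtain ⟨a1, a2, a3, a4, h⟩ := h
  have hA : 1 = v1 * a1 + w2 * a2 + u3 * (a3 - s1 • a1 - s2 • a2) + u4 * (a4 - s1 ^ 2 • a1 - s2 ^ 2 • a2) := by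
    rw [h, hv1, hw2]
    simp only [mul_sub, add_mul, smul_mul_assoc, mul_smul_comm]; abel
  generalize a3 - s1 • a1 - s2 • a2 = c3 at hA
  generalize a4 - s1 ^ 2 • a1 - s2 ^ 2 • a2 = c4 at hA
  obtain ⟨hT, hhT⟩ : ∃ hT : K[X], hT = ∏ c ∈ T, (X - C c) := ⟨_, rfl⟩
  have hT0 : hT ≠ 0 := by
    rw [hhT, Finset.prod_ne_zero_iff]; intro c _; exact X_sub_C_ne_zero c
  obtain ⟨g, hg⟩ : ∃ g, g = aeval (zz μ) hT * oo μ := ⟨_, rfl⟩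
  have hgn : ∀ a, ∃ a', a * g = g * a' := by
    intro a
    obtain ⟨y, hy⟩ := o_norm μ hμ a
    exact ⟨y, by rw [hg, ← mul_assoc, ← az_comm, mul_assoc, hy, mul_assoc]⟩
  obtain ⟨R, _, _, ⟨P⟩⟩ := gen_rep (K := K) hμ hc
  obtain ⟨r, t, f0, hf0, k0, hk0⟩ := gen_merge P v1 w2 (u3 * g) (u4 * g) hv1ne hT hT0 1 (by
    obtain ⟨d3, hd3⟩ := hgn c3
    obtain ⟨d4, hd4⟩ := hgn c4
    refine ⟨a1 * g, a2 * g, d3, d4, ?_⟩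
    rw [pow_one, ← hg, mul_assoc u3, mul_assoc u4, ← hd3, ← hd4]
    simp only [← mul_assoc]
    rw [← add_mul, ← add_mul, ← add_mul, ← hA, one_mul])
  obtain ⟨v2, hv2⟩ : ∃ v2, v2 = w2 + (u3 * g + u4 * g * r) * t := ⟨_, rfl⟩
  rw [← hv2] at hk0
  obtain ⟨f, hf, hroot, k, b1, b2, hk⟩ := remove_z (fun x => ∃ b1 b2, x = v1 * b1 + v2 * b2) f0 hf0 k0 hk0
  have hgp : pp μ g = 0 := by rw [hg, map_mul, pp_o, mul_zero]
  have hv2p : pp μ v2 = pp μ w2 := by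
    rw [hv2]; simp [hgp]
  have hv2e : v2 = u2 + u3 * (algebraMap K _ s2 + g * t) + u4 * (algebraMap K _ (s2 ^ 2) + g * r * t) := by
    rw [hv2, hw2]
    simp only [mul_add, add_mul, ← Algebra.commutes, ← Algebra.smul_def, mul_assoc]; abel
  have hB : 1 = v1 * a1 + v2 * a2 + u3 * (c3 - g * t * a2) + u4 * (c4 - g * r * t * a2) := by
    rw [hA, hv2]
    simp only [mul_sub, add_mul, mul_assoc]; abel
  generalize c3 - g * t * a2 = e3 at hB
  generalize c4 - g * r * t * a2 = e4 at hB
  obtain ⟨s3, hs3⟩ := comm_step v1 v2 u3 u4 ⟨_, _, _, _, hB⟩ (by rw [hv2p]; exact hfin)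
  obtain ⟨v30, hv30⟩ : ∃ v, v = u3 + s3 • u4 := ⟨_, rfl⟩
  rw [← hv30] at hs3
  have hC : 1 = v1 * a1 + v2 * a2 + v30 * e3 + u4 * (e4 - s3 • e3) := by
    rw [hB, hv30]
    simp only [mul_sub, add_mul, smul_mul_assoc, mul_smul_comm]; abel
  have hfm : ∀ c, f.IsRoot c → ∃ s, ∃ k b1 b2 b3 b4, oo μ ^ k = v1 * b1 + v2 * b2 + (v30 + u4 * oo μ * s) * b3 + aeval (zz μ) (X - C c) * b4 := by
    intro c hcr
    obtain ⟨R, _, _, ⟨P⟩⟩ := fibre_rep (K := K) hμ hc c (hroot c hcr)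
    refine fibre_merge hμ P v1 v2 v30 u4 ?_ ⟨_, _, _, _, hC⟩
    by_cases hcT : c ∈ T
    · right
      have : P.φ g = 0 := by
        rw [hg, map_mul, P.hz, hhT]
        simp only [coe_evalRingHom, eval_prod]
        rw [Finset.prod_eq_zero hcT (by simp)]; simp
      rw [hv2]
      simp only [map_add, map_mul, this, mul_zero, zero_mul, add_zero]
      exact (hfib c R _ _ P).2 hcT
    · left; exact (hfib c R _ _ P).1 hcT
  choose! s hs using hfm
  obtain ⟨r3, hr3⟩ := crt μ f.roots.toFinset s
  obtain ⟨v3, hv3⟩ : ∃ v, v = v30 + u4 * oo μ * r3 := ⟨_, rfl⟩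
  have hone : (1 : AA K μ) ∈ QW.rg K v1 ⊔ QW.rg K v2 ⊔ QW.rg K v3 := by
    have m1 : ∀ b, v1 * b ∈ QW.rg K v1 ⊔ QW.rg K v2 ⊔ QW.rg K v3 := fun b => Submodule.mem_sup_left (Submodule.mem_sup_left ⟨b, rfl⟩)
    have m2 : ∀ b, v2 * b ∈ QW.rg K v1 ⊔ QW.rg K v2 ⊔ QW.rg K v3 := fun b => Submodule.mem_sup_left (Submodule.mem_sup_right ⟨b, rfl⟩)
    have m3 : ∀ b, v3 * b ∈ QW.rg K v1 ⊔ QW.rg K v2 ⊔ QW.rg K v3 := fun b => Submodule.mem_sup_right ⟨b, rfl⟩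
    refine final_step μ hμ _ (((QW.rg_isR _).sup (QW.rg_isR _)).sup (QW.rg_isR _)) f hf ?_ ?_ k ?_
    · have h1 : (1 : K[X][X]) ∈ Ideal.span {pp μ v1, pp μ v2, pp μ v30} := by rw [hs3]; trivial
      rw [Ideal.mem_span_insert] at h1
      obtain ⟨x1, y, hy, h1⟩ := h1
      rw [Ideal.mem_span_pair] at hy
      obtain ⟨x2, x3, hy⟩ := hy
      obtain ⟨x1, rfl⟩ := pp_surj μ x1
      obtain ⟨x2, rfl⟩ := pp_surj μ x2
      obtain ⟨x3, rfl⟩ := pp_surj μ x3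
      obtain ⟨b, hb⟩ := ker_pp μ hμ (1 - (v1 * x1 + v2 * x2 + v3 * x3)) (by
        rw [hv3]
        simp only [map_sub, map_one, map_add, map_mul, pp_o]
        rw [h1, ← hy]; ring)
      exact ⟨_, Submodule.add_mem _ (Submodule.add_mem _ (m1 x1) (m2 x2)) (m3 x3), b, by rw [← hb]; abel⟩
    · intro c hcr
      obtain ⟨k, b1, b2, b3, b4, hk⟩ := hs c hcr
      obtain ⟨b, hb⟩ := hr3 c (by rw [Multiset.mem_toFinset]; exact (mem_roots hf).2 hcr)
      refine ⟨k, _, Submodule.add_mem _ (Submodule.add_mem _ (m1 b1) (m2 b2)) (m3 b3), b4 - u4 * oo μ * b * b3, ?_⟩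
      have e : u4 * oo μ * r3 = u4 * oo μ * s c + aeval (zz μ) (X - C c) * (u4 * oo μ * b) := by
        rw [hb, mul_add, ← mul_assoc (aeval (zz μ) (X - C c)), az_comm μ (X - C c) (u4 * oo μ), mul_assoc (u4 * oo μ)]
      rw [hk, hv3, e]
      simp only [add_mul, mul_sub, mul_assoc]; abel
    · rw [hk]; exact Submodule.add_mem _ (m1 _) (m2 _)
  obtain ⟨x, hx, y, ⟨x3, hx3⟩, hxy⟩ := Submodule.mem_sup.1 hone
  obtain ⟨z1, ⟨x1, hx1⟩, z2, ⟨x2, hx2⟩, hxx⟩ := Submodule.mem_sup.1 hx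
  simp only [LinearMap.mulLeft_apply] at hx1 hx2 hx3
  have hfinal : v1 * x1 + v2 * x2 + v3 * x3 = 1 := by rw [hx1, hx2, hx3, hxx, hxy]
  obtain ⟨ρ, hρ⟩ : ∃ ρ, ρ = algebraMap K _ s3 + oo μ * r3 := ⟨_, rfl⟩
  have e3 : v3 = u3 + u4 * ρ := by
    rw [hv3, hv30, hρ, mul_add, ← Algebra.commutes, ← Algebra.smul_def, mul_assoc, add_assoc]
  have e1 : v1 = u1 + u3 * algebraMap K _ s1 + u4 * algebraMap K _ (s1 ^ 2) := by
    rw [hv1, ← Algebra.commutes, ← Algebra.commutes, ← Algebra.smul_def, ← Algebra.smul_def]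
  generalize algebraMap K (AA K μ) s1 = σ1 at e1
  generalize algebraMap K (AA K μ) (s1 ^ 2) = σ2 at e1
  generalize algebraMap K (AA K μ) s2 + g * t = τ1 at hv2e
  generalize algebraMap K (AA K μ) (s2 ^ 2) + g * r * t = τ2 at hv2e
  refine ⟨σ2 - ρ * σ1, τ2 - ρ * τ1, ρ, x1, x2, x3 + σ1 * x1 + τ1 * x2, ?_⟩
  rw [← hfinal, e1, hv2e, e3]
  simp only [mul_add, add_mul, mul_sub, sub_mul, mul_assoc]; abel

theorem rows_stable [IsAlgClosed K] [CharZero K] (hμ : μ ≠ 0) (hc : μ = 1 ∨ ∀ n, 0 < n → μ ^ n ≠ 1)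
    (u : Fin 4 → AA K μ) (hu : IsUnimodularRow u) : IsStableRow u := by
  rw [unimod_iff] at hu
  obtain ⟨b, hb⟩ := hu
  rw [Fin.sum_univ_four] at hb
  obtain ⟨r1, r2, r3, y1, y2, y3, h⟩ := main_up hμ hc (u 0) (u 1) (u 2) (u 3) ⟨_, _, _, _, hb.symm⟩
  refine ⟨![r1, r2, r3], ?_⟩
  rw [unimod_iff]
  refine ⟨![y1, y2, y3], ?_⟩
  rw [Fin.sum_univ_three]
  exact h

end DUA

end

/-- Let `K` be algebraically closed of characteristic zero with
transcendence degree at least `1` over `ℚ`, and let `A = A(α,β,0)` with `β ≠ 0`,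
`α + β = 1`, so that the roots of `t² − αt − β` are `λ = 1` and `μ = −β`. If either
(i) `λ = μ = 1` (i.e. `α = 2`, `β = −1`), or (ii) `μ ≠ 1` and `μ` is not a root of unity,
then `sr(A) = 3`. -/
theorem downUp_stableRank_eq_three
    (K : Type) [Field K] [IsAlgClosed K] [CharZero K] (α β : K)
    (hβ : β ≠ 0) (h1 : α + β = 1) (htr : ∃ x : K, Transcendental ℚ x)
    (hcase : (α = 2 ∧ β = -1) ∨ ((-β ≠ 1) ∧ ∀ n : ℕ, 0 < n → (-β) ^ n ≠ 1)) :
    stableRank (DownUp K α β 0) = 3 := by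
  obtain ⟨μ, rfl⟩ : ∃ μ, β = -μ := ⟨-β, by ring⟩
  obtain rfl : α = 1 + μ := by linear_combination h1
  rw [neg_neg] at hcase
  refine stableRank_eq_of K _ _ h1 htr fun u hu => DUA.rows_stable (neg_ne_zero.1 hβ) ?_ u hu
  rcases hcase with ⟨-, h⟩ | ⟨-, h⟩
  · left; exact neg_injective h
  · right; exact h
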